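/- (Volume–projection-body case of Theorem 4.4: j = n, k = n-1.) Let n ≥ 2, p ∈ (1,∞) and K, L ∈ 𝒦ⁿₒ. Let ΠK, ΠL and Π(K +_p L) denote the projection bodies of K, L and K +_p L respectively, i.e. the convex bodies whose support functions are given by h_{ΠM}(u) = H^{n-1}(M|u^⊥) for u ∈ S^{n-1}. Then V_n(Π(K +_p L))^{p/(n(n-1))} ≥ V_n(ΠK)^{p/(n(n-1))} + V_n(ΠL)^{p/(n(n-1))}, with equality if and only if K and L are dilates. -/

import Mathlib

open scoped Pointwise RealInnerProductSpace

/-- A convex body in `ℝⁿ`: a compact convex set with nonempty interior. -/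
def IsConvexBody {n : ℕ} (K : Set (EuclideanSpace ℝ (Fin n))) : Prop :=
  IsCompact K ∧ Convex ℝ K ∧ (interior K).Nonempty

/-- A convex body containing the origin in its interior. -/
def IsConvexBodyO {n : ℕ} (K : Set (EuclideanSpace ℝ (Fin n))) : Prop :=
  IsCompact K ∧ Convex ℝ K ∧ (0 : EuclideanSpace ℝ (Fin n)) ∈ interior K

/-- The support function of a set: `h_K(u) = sup { ⟪x, u⟫ : x ∈ K }`. -/
noncomputable def supp {n : ℕ} (K : Set (EuclideanSpace ℝ (Fin n)))
    (u : EuclideanSpace ℝ (Fin n)) : ℝ :=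
  sSup ((fun x => ⟪x, u⟫) '' K)

open scoped MeasureTheory
open MeasureTheory

/-- The orthogonal projection `K | u^⊥` of a set `K` onto the hyperplane through the
origin orthogonal to the unit vector `u`. -/
noncomputable def projPerp {n : ℕ} (u : EuclideanSpace ℝ (Fin n))
    (K : Set (EuclideanSpace ℝ (Fin n))) : Set (EuclideanSpace ℝ (Fin n)) :=
  (fun x => x - ⟪x, u⟫ • u) '' K

open scoped Pointwise RealInnerProductSpace
open scoped MeasureTheory
open MeasureTheory
namespace PB

/-- one-dimensional Brunn–Minkowski, compact sets -/
lemma bm1_compact {A B C : Set ℝ} (hA : IsCompact A) (hB : IsCompact B) (hA0 : A.Nonempty)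
    (hB0 : B.Nonempty) (h : ∀ a ∈ A, ∀ b ∈ B, a + b ∈ C) :
    volume A + volume B ≤ volume C := by
  obtain ⟨M, hM, hMmax⟩ := hA.exists_isMaxOn hA0 continuous_id.continuousOn
  obtain ⟨m, hm, hmmin⟩ := hB.exists_isMinOn hB0 continuous_id.continuousOn
  have h1 : (fun x => m + x) '' A ⊆ C := by
    rintro _ ⟨x, hx, rfl⟩; have := h x hx m hm; rwa [add_comm] at this
  have h2 : (fun x => M + x) '' B ⊆ C := by
    rintro _ ⟨x, hx, rfl⟩; exact h M hM x hx
  have v1 : volume ((fun x => m + x) '' A) = volume A := by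
    rw [Set.image_add_left]; exact measure_preimage_add volume _ _
  have v2 : volume ((fun x => M + x) '' B) = volume B := by
    rw [Set.image_add_left]; exact measure_preimage_add volume _ _
  have hB' : MeasurableSet ((fun x => M + x) '' B) :=
    (hB.image (by fun_prop)).measurableSet
  have hd : AEDisjoint volume ((fun x => m + x) '' A) ((fun x => M + x) '' B) := by
    have : ((fun x => m + x) '' A) ∩ ((fun x => M + x) '' B) ⊆ {m + M} := by
      rintro z ⟨⟨x, hx, rfl⟩, ⟨y, hy, hxy⟩⟩
      have e1 : x ≤ M := hMmax hx
      have e2 : m ≤ y := hmmin hy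
      simp only [Set.mem_singleton_iff] at *
      linarith
    exact measure_mono_null this (by simp)
  rw [← v1, ← v2, ← measure_union₀ hB'.nullMeasurableSet hd]
  exact measure_mono (Set.union_subset h1 h2)

lemma bm1 {A B C : Set ℝ} (hA : MeasurableSet A) (hB : MeasurableSet B) (hA0 : A.Nonempty)
    (hB0 : B.Nonempty) (h : ∀ a ∈ A, ∀ b ∈ B, a + b ∈ C) :
    volume A + volume B ≤ volume C := by
  obtain ⟨a0, ha0⟩ := hA0
  obtain ⟨b0, hb0⟩ := hB0
  have key : ∀ K ⊆ A, IsCompact K → ∀ K' ⊆ B, IsCompact K' → volume K + volume K' ≤ volume C := by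
    intro K hK hKc K' hK' hKc'
    refine le_trans (add_le_add (measure_mono (Set.subset_insert a0 K))
      (measure_mono (Set.subset_insert b0 K'))) ?_
    refine bm1_compact (hKc.insert a0) (hKc'.insert b0) ⟨a0, by simp⟩ ⟨b0, by simp⟩ ?_
    intro a ha b hb
    refine h a ?_ b ?_
    · rcases ha with rfl | ha; exacts [ha0, hK ha]
    · rcases hb with rfl | hb; exacts [hb0, hK' hb]
  rw [hA.measure_eq_iSup_isCompact, hB.measure_eq_iSup_isCompact]
  have h3 := ENNReal.biSup_add_biSup_le' (p := fun s : Set ℝ => s ⊆ A ∧ IsCompact s)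
    (q := fun s : Set ℝ => s ⊆ B ∧ IsCompact s) (f := fun s => volume s) (g := fun s => volume s)
    (a := volume C) ⟨∅, by simp⟩ ⟨∅, by simp⟩
    (fun s hs t ht => key s hs.1 hs.2 t ht.1 ht.2)
  simpa only [iSup_and] using h3

/-- normalised 1-D Prékopa–Leindler. -/
lemma pl1_norm {f g h : ℝ → ℝ} (hf : Measurable f) (hg : Measurable g) (hh : Measurable h)
    (f0 : ∀ s, 0 ≤ f s) (g0 : ∀ s, 0 ≤ g s) (h0 : ∀ s, 0 ≤ h s)
    (f1 : ∀ s, f s ≤ 1) (g1 : ∀ s, g s ≤ 1)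
    (fs : ∀ τ < 1, ∃ s, τ < f s) (gs : ∀ τ < 1, ∃ s, τ < g s)
    {l : ℝ} (l0 : 0 < l) (l1 : l < 1)
    (H : ∀ s t, f s ^ (1 - l) * g t ^ l ≤ h ((1 - l) * s + l * t)) :
    ENNReal.ofReal (1 - l) * (∫⁻ s, ENNReal.ofReal (f s)) + ENNReal.ofReal l * (∫⁻ s, ENNReal.ofReal (g s))
      ≤ ∫⁻ s, ENNReal.ofReal (h s) := by
  rw [lintegral_eq_lintegral_meas_lt volume (Filter.Eventually.of_forall f0) hf.aemeasurable,
    lintegral_eq_lintegral_meas_lt volume (Filter.Eventually.of_forall g0) hg.aemeasurable,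
    lintegral_eq_lintegral_meas_lt volume (Filter.Eventually.of_forall h0) hh.aemeasurable,
    ← lintegral_const_mul' _ _ ENNReal.ofReal_ne_top, ← lintegral_const_mul' _ _ ENNReal.ofReal_ne_top]
  have mono : ∀ k : ℝ → ℝ, Measurable (fun t => volume {a | t < k a}) := by
    intro k
    refine Antitone.measurable (fun a b hab => measure_mono fun x hx => lt_of_le_of_lt hab hx)
  rw [← lintegral_add_left ((mono f).const_mul _)]
  refine lintegral_mono_ae ?_
  filter_upwards [ae_restrict_mem measurableSet_Ioi] with τ hτ
  have hτ : 0 < τ := hτ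
  by_cases hτ1 : τ < 1
  · have sc : ∀ (c : ℝ), 0 < c → ∀ S : Set ℝ, ENNReal.ofReal c * volume S = volume (c • S) := by
      intro c hc S
      rw [Measure.addHaar_smul]; simp [abs_of_pos hc]
    rw [sc _ (by linarith), sc _ l0]
    have mf : MeasurableSet {a | τ < f a} := measurableSet_lt measurable_const hf
    have mg : MeasurableSet {a | τ < g a} := measurableSet_lt measurable_const hg
    refine bm1 (mf.const_smul_of_ne_zero (by linarith)) (mg.const_smul_of_ne_zero (by linarith))
      (Set.Nonempty.smul_set (fs τ hτ1)) (Set.Nonempty.smul_set (gs τ hτ1)) ?_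
    rintro _ ⟨s, hs, rfl⟩ _ ⟨t, ht, rfl⟩
    simp only [Set.mem_ofPred_eq, smul_eq_mul] at *
    refine lt_of_lt_of_le ?_ (H s t)
    have : τ = τ ^ (1 - l) * τ ^ l := by
      rw [← Real.rpow_add hτ]; simp
    rw [this]
    exact mul_lt_mul'' (Real.rpow_lt_rpow hτ.le hs (by linarith)) (Real.rpow_lt_rpow hτ.le ht l0)
      (by positivity) (by positivity)
  · have e1 : {a | τ < f a} = ∅ := by
      ext a; simp; linarith [f1 a]
    have e2 : {a | τ < g a} = ∅ := by
      ext a; simp; linarith [g1 a]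
    simp [e1, e2]

lemma pl1 {f g h : ℝ → ℝ} (hf : Measurable f) (hg : Measurable g) (hh : Measurable h)
    (f0 : ∀ s, 0 ≤ f s) (g0 : ∀ s, 0 ≤ g s) (h0 : ∀ s, 0 ≤ h s)
    (fb : BddAbove (Set.range f)) (gb : BddAbove (Set.range g))
    (fi : ∫⁻ s, ENNReal.ofReal (f s) ≠ ⊤) (gi : ∫⁻ s, ENNReal.ofReal (g s) ≠ ⊤)
    {l : ℝ} (l0 : 0 < l) (l1 : l < 1)
    (H : ∀ s t, f s ^ (1 - l) * g t ^ l ≤ h ((1 - l) * s + l * t)) :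
    (∫⁻ s, ENNReal.ofReal (f s)) ^ (1 - l) * (∫⁻ s, ENNReal.ofReal (g s)) ^ l
      ≤ ∫⁻ s, ENNReal.ofReal (h s) := by
  by_cases hfz : ∀ s, f s = 0
  · simp [hfz, ENNReal.zero_rpow_of_pos (sub_pos.2 l1)]
  by_cases hgz : ∀ s, g s = 0
  · simp [hgz, ENNReal.zero_rpow_of_pos l0]
  push Not at hfz hgz
  obtain ⟨s0, hs0⟩ := hfz
  obtain ⟨t0, ht0⟩ := hgz
  set M := ⨆ s, f s with hM
  set N := ⨆ s, g s with hN
  have Mpos : 0 < M := lt_of_lt_of_le (lt_of_le_of_ne (f0 s0) hs0.symm) (le_ciSup fb s0)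
  have Npos : 0 < N := lt_of_lt_of_le (lt_of_le_of_ne (g0 t0) ht0.symm) (le_ciSup gb t0)
  set R := M ^ (1 - l) * N ^ l with hR
  have Rpos : 0 < R := by positivity
  have key := pl1_norm (f := fun s => M⁻¹ * f s) (g := fun s => N⁻¹ * g s) (h := fun s => R⁻¹ * h s)
    (hf.const_mul _) (hg.const_mul _) (hh.const_mul _)
    (fun s => mul_nonneg (by positivity) (f0 s)) (fun s => mul_nonneg (by positivity) (g0 s))
    (fun s => mul_nonneg (by positivity) (h0 s))
    (fun s => by rw [inv_mul_le_iff₀ Mpos]; simpa using le_ciSup fb s)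
    (fun s => by rw [inv_mul_le_iff₀ Npos]; simpa using le_ciSup gb s)
    (fun τ hτ => by
      have : M * τ < M := by nlinarith
      obtain ⟨s, hs⟩ := exists_lt_of_lt_ciSup this
      exact ⟨s, by rwa [lt_inv_mul_iff₀ Mpos]⟩)
    (fun τ hτ => by
      have : N * τ < N := by nlinarith
      obtain ⟨s, hs⟩ := exists_lt_of_lt_ciSup this
      exact ⟨s, by rwa [lt_inv_mul_iff₀ Npos]⟩) l0 l1
    (fun s t => by
      rw [le_inv_mul_iff₀ Rpos]
      refine le_trans (le_of_eq ?_) (H s t)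
      rw [Real.mul_rpow (by positivity) (f0 s), Real.mul_rpow (by positivity) (g0 t),
        Real.inv_rpow Mpos.le, Real.inv_rpow Npos.le, hR]
      field_simp)
  have sc : ∀ (c : ℝ), 0 < c → ∀ k : ℝ → ℝ, Measurable k → ∫⁻ s, ENNReal.ofReal (c * k s) = ENNReal.ofReal c * ∫⁻ s, ENNReal.ofReal (k s) := by
    intro c hc k hk
    rw [← lintegral_const_mul' _ _ ENNReal.ofReal_ne_top]
    simp only [ENNReal.ofReal_mul hc.le]
  rw [sc _ (by positivity) f hf, sc _ (by positivity) g hg, sc _ (by positivity) h hh] at key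
  set a := (∫⁻ s, ENNReal.ofReal (f s)).toReal with ha
  set b := (∫⁻ s, ENNReal.ofReal (g s)).toReal with hb
  have ea : ∫⁻ s, ENNReal.ofReal (f s) = ENNReal.ofReal a := (ENNReal.ofReal_toReal fi).symm
  have eb : ∫⁻ s, ENNReal.ofReal (g s) = ENNReal.ofReal b := (ENNReal.ofReal_toReal gi).symm
  have a0 : 0 ≤ a := ENNReal.toReal_nonneg
  have b0 : 0 ≤ b := ENNReal.toReal_nonneg
  rw [ea, eb] at key ⊢
  have am := Real.geom_mean_le_arith_mean2_weighted (sub_pos.2 l1).le l0.le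
    (show 0 ≤ M⁻¹ * a by positivity) (show 0 ≤ N⁻¹ * b by positivity) (by ring)
  rw [← ENNReal.ofReal_mul (inv_nonneg.2 Mpos.le), ← ENNReal.ofReal_mul (inv_nonneg.2 Npos.le),
    ← ENNReal.ofReal_mul (sub_pos.2 l1).le, ← ENNReal.ofReal_mul l0.le,
    ← ENNReal.ofReal_add (mul_nonneg (by linarith) (by positivity)) (by positivity)] at key
  have key2 := (ENNReal.ofReal_le_ofReal am).trans key
  have hab : a ^ (1 - l) * b ^ l = R * ((M⁻¹ * a) ^ (1 - l) * (N⁻¹ * b) ^ l) := by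
    rw [Real.mul_rpow (by positivity) a0, Real.mul_rpow (by positivity) b0,
        Real.inv_rpow Mpos.le, Real.inv_rpow Npos.le, hR]
    field_simp
  rw [ENNReal.ofReal_rpow_of_nonneg a0 (by linarith), ENNReal.ofReal_rpow_of_nonneg b0 l0.le,
    ← ENNReal.ofReal_mul (by positivity), hab, ENNReal.ofReal_mul Rpos.le]
  refine (mul_le_mul_right key2 _).trans ?_
  rw [← mul_assoc, ← ENNReal.ofReal_mul Rpos.le, mul_inv_cancel₀ Rpos.ne']
  simp

/-- multiplicative Brunn–Minkowski -/
lemma bm_mul (n : ℕ) : ∀ {A B C : Set (Fin n → ℝ)}, IsCompact A → IsCompact B → IsCompact C →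
    ∀ {l : ℝ}, 0 < l → l < 1 → (∀ a ∈ A, ∀ b ∈ B, (1 - l) • a + l • b ∈ C) →
    volume A ^ (1 - l) * volume B ^ l ≤ volume C := by
  induction n with
  | zero =>
    intro A B C hA hB hC l l0 l1 H
    by_cases hA0 : A.Nonempty
    · by_cases hB0 : B.Nonempty
      · obtain ⟨a, ha⟩ := hA0
        obtain ⟨b, hb⟩ := hB0
        have hu : ∀ S : Set (Fin 0 → ℝ), S.Nonempty → volume S = 1 := by
          intro S hS
          have : S = Set.univ := Subsingleton.eq_univ_of_nonempty hS
          rw [this, volume_pi]; simp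
        rw [hu A ⟨a, ha⟩, hu B ⟨b, hb⟩, hu C ⟨_, H a ha b hb⟩]
        simp
      · rw [Set.not_nonempty_iff_eq_empty.1 hB0]
        simp [ENNReal.zero_rpow_of_pos l0]
    · rw [Set.not_nonempty_iff_eq_empty.1 hA0]
      simp [ENNReal.zero_rpow_of_pos (sub_pos.2 l1)]
  | succ n ih =>
    intro A B C hA hB hC l l0 l1 H
    let e := MeasurableEquiv.piFinSuccAbove (fun _ : Fin (n+1) => ℝ) 0
    have ep : MeasurePreserving e volume volume := volume_preserving_piFinSuccAbove (fun _ => ℝ) 0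
    let sl : Set (Fin (n+1) → ℝ) → ℝ → Set (Fin n → ℝ) := fun S s => {y | Fin.cons s y ∈ S}
    have slc : ∀ S, IsCompact S → ∀ s, IsCompact (sl S s) := by
      intro S hS s
      have hc : Continuous (fun y : Fin n → ℝ => (Fin.cons s y : Fin (n+1) → ℝ)) := by
        fun_prop
      have : sl S s ⊆ (fun x : Fin (n+1) → ℝ => fun i : Fin n => x i.succ) '' S := by
        intro y hy
        exact ⟨_, hy, by ext i; simp⟩
      exact (hS.image (by fun_prop)).of_isClosed_subset (hS.isClosed.preimage hc) this
    have vol : ∀ S, IsCompact S → volume S = ∫⁻ s, volume (sl S s) ∧ Measurable (fun s => volume (sl S s)) := by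
      intro S hS
      have hm : MeasurableSet (e.symm ⁻¹' S) := e.symm.measurable hS.measurableSet
      have h1 : volume S = volume (e.symm ⁻¹' S) := by
        rw [(ep.symm e).measure_preimage hS.measurableSet.nullMeasurableSet]
      have h2 : ∀ s, Prod.mk s ⁻¹' (e.symm ⁻¹' S) = sl S s := by
        intro s; ext y
        simp [e, sl, Set.mem_preimage, MeasurableEquiv.piFinSuccAbove]
        rfl
      constructor
      · rw [h1, Measure.volume_eq_prod, Measure.prod_apply hm]
        simp only [h2]
      · have := measurable_measure_prodMk_left (ν := (volume : Measure (Fin n → ℝ))) hm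
        simpa only [h2] using this
    have fin : ∀ S, IsCompact S → ∀ s, volume (sl S s) ≠ ⊤ := fun S hS s => (slc S hS s).measure_lt_top.ne
    have bdd : ∀ S, IsCompact S → BddAbove (Set.range fun s => (volume (sl S s)).toReal) := by
      intro S hS
      have hc : IsCompact ((fun x : Fin (n+1) → ℝ => fun i : Fin n => x i.succ) '' S) :=
        hS.image (by fun_prop)
      refine ⟨(volume ((fun x : Fin (n+1) → ℝ => fun i : Fin n => x i.succ) '' S)).toReal, ?_⟩
      rintro _ ⟨s, rfl⟩
      refine ENNReal.toReal_mono hc.measure_lt_top.ne (measure_mono ?_)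
      intro y hy
      exact ⟨_, hy, by ext i; simp⟩
    have ofr : ∀ S, IsCompact S → ∀ s, ENNReal.ofReal (volume (sl S s)).toReal = volume (sl S s) :=
      fun S hS s => ENNReal.ofReal_toReal (fin S hS s)
    have key := pl1 (f := fun s => (volume (sl A s)).toReal) (g := fun s => (volume (sl B s)).toReal)
      (h := fun s => (volume (sl C s)).toReal) ((vol A hA).2.ennreal_toReal) ((vol B hB).2.ennreal_toReal)
      ((vol C hC).2.ennreal_toReal) (fun s => ENNReal.toReal_nonneg) (fun s => ENNReal.toReal_nonneg)
      (fun s => ENNReal.toReal_nonneg) (bdd A hA) (bdd B hB)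
      (by simp only [ofr A hA]; rw [← (vol A hA).1]; exact hA.measure_lt_top.ne)
      (by simp only [ofr B hB]; rw [← (vol B hB).1]; exact hB.measure_lt_top.ne) l0 l1
      (by
        intro s t
        have := ih (slc A hA s) (slc B hB t) (slc C hC ((1 - l) * s + l * t)) l0 l1 (by
          intro a ha b hb
          have := H _ ha _ hb
          simp only [sl, Set.mem_ofPred_eq]
          convert this using 1
          ext i
          refine Fin.cases ?_ (fun i => ?_) i <;> simp)
        have h2 := ENNReal.toReal_mono (fin C hC _) this
        rwa [ENNReal.toReal_mul, ← ENNReal.toReal_rpow, ← ENNReal.toReal_rpow] at h2)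
    simp only [ofr A hA, ofr B hB, ofr C hC] at key
    rwa [← (vol A hA).1, ← (vol B hB).1, ← (vol C hC).1] at key

end PB

open scoped Pointwise RealInnerProductSpace
open scoped MeasureTheory
open MeasureTheory
namespace PB

abbrev Eu (n : ℕ) := EuclideanSpace ℝ (Fin n)

lemma vol_smul {n : ℕ} (c : ℝ) (hc : 0 ≤ c) (S : Set (Eu n)) :
    volume.real (c • S) = c ^ n * volume.real S := by
  rw [Measure.real, Measure.addHaar_smul, ENNReal.toReal_mul, finrank_euclideanSpace_fin,
    ENNReal.toReal_ofReal (abs_nonneg _), abs_of_nonneg (by positivity), Measure.real]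

lemma vol_add_left {n : ℕ} (x : Eu n) (S : Set (Eu n)) :
    volume.real ((fun y => x + y) '' S) = volume.real S := by
  rw [Measure.real, Measure.real, Set.image_add_left, measure_preimage_add]

lemma vol_mono {n : ℕ} {S T : Set (Eu n)} (hT : IsCompact T) (h : S ⊆ T) :
    volume.real S ≤ volume.real T :=
  ENNReal.toReal_mono hT.measure_lt_top.ne (measure_mono h)

lemma bm_mul_eu {n : ℕ} {A B C : Set (Eu n)} (hA : IsCompact A) (hB : IsCompact B) (hC : IsCompact C)
    {l : ℝ} (l0 : 0 < l) (l1 : l < 1) (H : ∀ a ∈ A, ∀ b ∈ B, (1 - l) • a + l • b ∈ C) :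
    volume A ^ (1 - l) * volume B ^ l ≤ volume C := by
  have hv : ∀ S : Set (Eu n), IsCompact S → volume S = volume ((WithLp.toLp 2 : (Fin n → ℝ) → Eu n) ⁻¹' S) := by
    intro S hS
    exact ((EuclideanSpace.volume_preserving_symm_measurableEquiv_toLp (Fin n)).symm.measure_preimage
      hS.measurableSet.nullMeasurableSet).symm
  have hc : ∀ S : Set (Eu n), IsCompact S → IsCompact ((WithLp.toLp 2 : (Fin n → ℝ) → Eu n) ⁻¹' S) := by
    intro S hS
    exact (EuclideanSpace.equiv (Fin n) ℝ).symm.toHomeomorph.isCompact_preimage.2 hS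
  rw [hv A hA, hv B hB, hv C hC]
  refine bm_mul n (hc A hA) (hc B hB) (hc C hC) l0 l1 ?_
  intro a ha b hb
  exact H _ ha _ hb

/-- Brunn–Minkowski. -/
lemma bm {n : ℕ} (hn : 0 < n) {A B C : Set (Eu n)} (hA : IsCompact A) (hB : IsCompact B) (hC : IsCompact C)
    (hA0 : A.Nonempty) (hB0 : B.Nonempty) (H : ∀ a ∈ A, ∀ b ∈ B, a + b ∈ C) :
    volume.real A ^ (1 / (n:ℝ)) + volume.real B ^ (1 / (n:ℝ)) ≤ volume.real C ^ (1 / (n:ℝ)) := by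
  have hn' : (0:ℝ) < n := by exact_mod_cast hn
  have z : (0:ℝ) ^ (1 / (n:ℝ)) = 0 := Real.zero_rpow (by positivity)
  have hn1 : (0:ℝ) ≤ 1 / (n:ℝ) := by positivity
  obtain ⟨a0, ha0⟩ := hA0
  obtain ⟨b0, hb0⟩ := hB0
  by_cases hVA : volume.real A = 0
  · rw [hVA, z, zero_add]
    refine Real.rpow_le_rpow measureReal_nonneg ?_ hn1
    rw [← vol_add_left a0 B]
    refine vol_mono hC ?_
    rintro _ ⟨b, hb, rfl⟩; exact H _ ha0 _ hb
  by_cases hVB : volume.real B = 0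
  · rw [hVB, z, add_zero]
    refine Real.rpow_le_rpow measureReal_nonneg ?_ hn1
    rw [← vol_add_left b0 A]
    refine vol_mono hC ?_
    rintro _ ⟨a, ha, rfl⟩; simpa [add_comm] using H _ ha _ hb0
  have pA : 0 < volume.real A := lt_of_le_of_ne measureReal_nonneg (Ne.symm hVA)
  have pB : 0 < volume.real B := lt_of_le_of_ne measureReal_nonneg (Ne.symm hVB)
  set a := volume.real A ^ (1 / (n:ℝ)) with ha
  set b := volume.real B ^ (1 / (n:ℝ)) with hb
  have apos : 0 < a := by positivity
  have bpos : 0 < b := by positivity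
  have an : a ^ n = volume.real A := by
    rw [ha, ← Real.rpow_natCast, ← Real.rpow_mul pA.le]; field_simp; simp
  have bn : b ^ n = volume.real B := by
    rw [hb, ← Real.rpow_natCast, ← Real.rpow_mul pB.le]; field_simp; simp
  have l0 : 0 < b / (a + b) := by positivity
  have l1 : b / (a + b) < 1 := by rw [div_lt_one (by positivity)]; linarith
  have key := bm_mul_eu (A := a⁻¹ • A) (B := b⁻¹ • B) (C := (a+b)⁻¹ • C) (hA.smul _) (hB.smul _) (hC.smul _)
    l0 l1 (by
      rintro _ ⟨x, hx, rfl⟩ _ ⟨y, hy, rfl⟩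
      refine ⟨x + y, H x hx y hy, ?_⟩
      have e1 : (1 - b / (a + b)) * a⁻¹ = (a+b)⁻¹ := by field_simp; ring
      have e2 : (b / (a + b)) * b⁻¹ = (a+b)⁻¹ := by field_simp
      simp only [smul_smul, e1, e2, smul_add])
  have key2 := ENNReal.toReal_mono (hC.smul ((a+b)⁻¹)).measure_lt_top.ne key
  rw [ENNReal.toReal_mul, ← ENNReal.toReal_rpow, ← ENNReal.toReal_rpow] at key2
  change volume.real _ ^ _ * volume.real _ ^ _ ≤ volume.real _ at key2
  rw [vol_smul _ (by positivity), vol_smul _ (by positivity), vol_smul _ (by positivity), ← an, ← bn,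
    ← mul_pow, ← mul_pow, inv_mul_cancel₀ apos.ne', inv_mul_cancel₀ bpos.ne'] at key2
  simp only [one_pow, Real.one_rpow, mul_one, inv_pow] at key2
  have hcn : (a + b) ^ n ≤ volume.real C := by
    rw [inv_mul_eq_div, one_le_div (by positivity)] at key2; exact key2
  have : a + b = ((a + b) ^ n) ^ (1 / (n:ℝ)) := by
    rw [← Real.rpow_natCast, ← Real.rpow_mul (by positivity)]; field_simp; simp
  rw [this]
  exact Real.rpow_le_rpow (by positivity) hcn hn1

/-- orthonormal frame adapted to a unit vector -/
lemma frame {n : ℕ} (e : Eu (n+1)) (he : ‖e‖ = 1) :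
    ∃ J : Eu n →ₗᵢ[ℝ] Eu (n+1), (∀ y, ⟪J y, e⟫ = 0) ∧ (∀ x, ∃ y, x = ⟪x, e⟫ • e + J y) ∧
      MeasurePreserving (fun p : ℝ × Eu n => p.1 • e + J p.2) (volume.prod volume) volume := by
  obtain ⟨b, hb⟩ : ∃ b : OrthonormalBasis (Fin (n+1)) ℝ (Eu (n+1)), b 0 = e := by
    have ho : Orthonormal ℝ (({0} : Set (Fin (n+1))).domRestrict (fun _ => e)) := by
      constructor
      · intro i; exact he
      · intro i j hij; exact absurd (Subsingleton.elim i j) hij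
    obtain ⟨b, hb⟩ := ho.exists_orthonormalBasis_extension_of_card_eq (ι := Fin (n+1)) (by simp)
    exact ⟨b, hb 0 rfl⟩
  have hinner : ∀ i : Fin n, ⟪b i.succ, e⟫ = 0 := by
    intro i
    rw [← hb]; exact b.orthonormal.2 (Fin.succ_ne_zero i)
  let J0 : Eu n →ₗ[ℝ] Eu (n+1) :=
    { toFun := fun y => ∑ i, y i • b i.succ
      map_add' := fun x y => by simp [add_smul, Finset.sum_add_distrib]
      map_smul' := fun c y => by simp [mul_smul, Finset.smul_sum] }
  have hnorm : ∀ y, ‖J0 y‖ = ‖y‖ := by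
    intro y
    have h1 : J0 y = b.repr.symm (WithLp.toLp 2 (Fin.cons 0 y.ofLp : Fin (n+1) → ℝ)) := by
      rw [← b.sum_repr_symm]; simp [Fin.sum_univ_succ, J0]
    rw [h1, LinearIsometryEquiv.norm_map, EuclideanSpace.norm_eq, EuclideanSpace.norm_eq]
    simp [Fin.sum_univ_succ]
  refine ⟨⟨J0, hnorm⟩, ?_, ?_, ?_⟩
  · intro y
    change ⟪J0 y, e⟫ = 0
    simp [J0, sum_inner, inner_smul_left, hinner]
  · intro x
    refine ⟨WithLp.toLp 2 (fun i => ⟪b i.succ, x⟫), ?_⟩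
    change x = _ + J0 _
    conv_lhs => rw [← b.sum_repr' x]
    rw [Fin.sum_univ_succ, hb, real_inner_comm]
    simp [J0]
  · have m1 : MeasurePreserving (fun p : ℝ × Eu n => (p.1, p.2.ofLp)) (volume.prod volume) (volume.prod volume) :=
      (MeasurePreserving.id _).prod (EuclideanSpace.volume_preserving_symm_measurableEquiv_toLp (Fin n))
    have m2 : MeasurePreserving (MeasurableEquiv.piFinSuccAbove (fun _ : Fin (n+1) => ℝ) 0).symm (volume.prod volume) volume :=
      (volume_preserving_piFinSuccAbove (fun _ : Fin (n+1) => ℝ) 0).symm _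
    have m3 := (EuclideanSpace.volume_preserving_symm_measurableEquiv_toLp (Fin (n+1))).symm
    have m4 := b.measurePreserving_repr_symm
    have := m4.comp (m3.comp (m2.comp m1))
    convert this using 1
    ext p : 1
    simp only [Function.comp]
    have hcons : (MeasurableEquiv.piFinSuccAbove (fun _ : Fin (n+1) => ℝ) 0).symm (p.1, p.2.ofLp)
        = (Fin.cons p.1 p.2.ofLp : Fin (n+1) → ℝ) := by
      simp [MeasurableEquiv.piFinSuccAbove]; rfl
    rw [hcons]
    change _ + J0 p.2 = b.repr.symm (WithLp.toLp 2 (Fin.cons p.1 p.2.ofLp : Fin (n+1) → ℝ))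
    rw [← b.sum_repr_symm]; simp [Fin.sum_univ_succ, J0, hb]

end PB

open scoped Pointwise RealInnerProductSpace
open scoped MeasureTheory
open MeasureTheory
namespace PB

section linalg
variable {ι : Type*} [Fintype ι] [DecidableEq ι]

lemma ground_state (Q : ι → ι → ℝ) (hs : ∀ i j, Q i j = Q j i) (a w x : ι → ℝ) (ha : ∀ i, 0 < a i)
    (hw : ∀ i, ∑ j, Q i j * a j = w i * a i) :
    ∑ i, ∑ j, Q i j * a i * a j * (x i / a i - x j / a j) ^ 2 =
      2 * (∑ i, w i * x i ^ 2 - ∑ i, ∑ j, Q i j * x i * x j) := by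
  have e1 : ∀ i j, Q i j * a i * a j * (x i / a i - x j / a j) ^ 2 =
      x i ^ 2 / a i * (Q i j * a j) + x j ^ 2 / a j * (Q j i * a i) - 2 * (Q i j * x i * x j) := by
    intro i j
    have := (ha i).ne'
    have := (ha j).ne'
    rw [hs j i]
    field_simp
    ring
  simp only [e1, Finset.sum_add_distrib, Finset.sum_sub_distrib]
  rw [Finset.sum_comm (f := fun i j => x j ^ 2 / a j * (Q j i * a i))]
  simp only [← Finset.mul_sum, hw]
  have : ∀ i, x i ^ 2 / a i * (w i * a i) = w i * x i ^ 2 := by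
    intro i; have := (ha i).ne'; field_simp
  simp only [this]
  ring

lemma eig_alt (Q : ι → ι → ℝ) (hs : ∀ i j, Q i j = Q j i) (a w : ι → ℝ) (ha : ∀ i, 0 < a i)
    (hw0 : ∀ i, 0 < w i) (hw : ∀ i, ∑ j, Q i j * a j = w i * a i)
    (hoff : ∀ i j, i ≠ j → 0 ≤ Q i j)
    (hB : ∀ x : ι → ℝ, ∑ i, ∑ j, Q i j * x i * x j ≤ ∑ i, (∑ j, Q i j * x j) ^ 2 / w i)
    (hconn : ∀ S : Set ι, S.Nonempty → S ≠ Set.univ → ∃ i ∈ S, ∃ j ∉ S, Q i j ≠ 0)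
    (x : ι → ℝ) (μ : ℝ) (hE : ∀ i, ∑ j, Q i j * x j = μ * (w i * x i)) :
    μ ≤ 0 ∨ ∃ c : ℝ, ∀ i, x i = c * a i := by
  by_cases hx : ∀ i, x i = 0
  · exact Or.inr ⟨0, by simpa using hx⟩
  push Not at hx
  obtain ⟨i0, hi0⟩ := hx
  set N := ∑ i, w i * x i ^ 2 with hN
  have Npos : 0 < N := Finset.sum_pos' (fun i _ => mul_nonneg (hw0 i).le (sq_nonneg _))
    ⟨i0, Finset.mem_univ _, mul_pos (hw0 i0) (by positivity)⟩
  have hQ : ∑ i, ∑ j, Q i j * x i * x j = μ * N := by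
    rw [hN, Finset.mul_sum]
    refine Finset.sum_congr rfl fun i _ => ?_
    have : ∑ j, Q i j * x i * x j = x i * ∑ j, Q i j * x j := by
      rw [Finset.mul_sum]; exact Finset.sum_congr rfl fun j _ => by ring
    rw [this, hE]; ring
  have hB' : ∑ i, (∑ j, Q i j * x j) ^ 2 / w i = μ ^ 2 * N := by
    rw [hN, Finset.mul_sum]
    refine Finset.sum_congr rfl fun i _ => ?_
    rw [hE]; have := (hw0 i).ne'; field_simp
  have h1 := hB x
  rw [hQ, hB'] at h1
  have h2 : μ ≤ μ ^ 2 := le_of_mul_le_mul_right h1 Npos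
  have gs := ground_state Q hs a w x ha hw
  rw [hQ] at gs
  have tn : ∀ i j, 0 ≤ Q i j * a i * a j * (x i / a i - x j / a j) ^ 2 := by
    intro i j
    by_cases hij : i = j
    · subst hij; simp
    · exact mul_nonneg (mul_nonneg (mul_nonneg (hoff i j hij) (ha i).le) (ha j).le) (sq_nonneg _)
  by_cases hμ : μ ≤ 0
  · exact Or.inl hμ
  right
  push Not at hμ
  have hμ1 : 1 ≤ μ := by nlinarith
  have hz : ∑ i, ∑ j, Q i j * a i * a j * (x i / a i - x j / a j) ^ 2 ≤ 0 := by
    rw [gs]; nlinarith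
  have hz0 : ∀ i j, Q i j * a i * a j * (x i / a i - x j / a j) ^ 2 = 0 := by
    have := (Finset.sum_eq_zero_iff_of_nonneg (fun i _ => Finset.sum_nonneg fun j _ => tn i j)).1
      (le_antisymm hz (Finset.sum_nonneg fun i _ => Finset.sum_nonneg fun j _ => tn i j))
    intro i j
    exact (Finset.sum_eq_zero_iff_of_nonneg (fun j _ => tn i j)).1 (this i (Finset.mem_univ _)) j (Finset.mem_univ _)
  refine ⟨x i0 / a i0, ?_⟩
  let S : Set ι := {i | x i / a i = x i0 / a i0}
  have hS : S = Set.univ := by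
    by_contra hS
    obtain ⟨i, hi, j, hj, hij⟩ := hconn S ⟨i0, rfl⟩ hS
    have := hz0 i j
    have h3 : x i / a i - x j / a j = 0 := by
      have := (ha i).ne'; have := (ha j).ne'
      simp_all
    exact hj (by change x j / a j = _; have hi : x i / a i = _ := hi; linarith)
  intro i
  have : i ∈ S := hS ▸ Set.mem_univ i
  have h4 : x i / a i = x i0 / a i0 := this
  rw [← h4]; have := (ha i).ne'; field_simp

lemma bochner (Q : ι → ι → ℝ) (hs : ∀ i j, Q i j = Q j i) (a w : ι → ℝ) (ha : ∀ i, 0 < a i)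
    (hw0 : ∀ i, 0 < w i) (hw : ∀ i, ∑ j, Q i j * a j = w i * a i)
    (hoff : ∀ i j, i ≠ j → 0 ≤ Q i j)
    (hB : ∀ x : ι → ℝ, ∑ i, ∑ j, Q i j * x i * x j ≤ ∑ i, (∑ j, Q i j * x j) ^ 2 / w i)
    (hconn : ∀ S : Set ι, S.Nonempty → S ≠ Set.univ → ∃ i ∈ S, ∃ j ∉ S, Q i j ≠ 0)
    (x : ι → ℝ) (hx : ∑ i, x i * (w i * a i) = 0) :
    ∑ i, ∑ j, Q i j * x i * x j ≤ 0 := by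
  let r : ι → ℝ := fun i => √(w i)
  have r0 : ∀ i, 0 < r i := fun i => Real.sqrt_pos.2 (hw0 i)
  have rr : ∀ i, r i * r i = w i := fun i => Real.mul_self_sqrt (hw0 i).le
  let M : Matrix ι ι ℝ := Matrix.of fun i j => Q i j / (r i * r j)
  have hM : M.IsHermitian := by
    ext i j; simp [M, hs i j, mul_comm]
  let b := hM.eigenvectorBasis
  let T := Matrix.toEuclideanLin M
  have hT : T.IsSymmetric := Matrix.isHermitian_iff_isSymmetric.1 hM
  have hTb : ∀ k, T (b k) = hM.eigenvalues k • b k := by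
    intro k
    have := hM.mulVec_eigenvectorBasis k
    apply (WithLp.ofLp_injective 2)
    rw [Matrix.ofLp_toLpLin]
    exact this
  let z : EuclideanSpace ℝ ι := WithLp.toLp 2 fun i => r i * x i
  have hzi : ∀ i, z i = r i * x i := fun i => rfl
  have h1 : ⟪z, T z⟫ = ∑ i, ∑ j, Q i j * x i * x j := by
    simp only [PiLp.inner_apply, T, Matrix.ofLp_toLpLin, Matrix.toLin'_apply, Matrix.mulVec, dotProduct]
    refine Finset.sum_congr rfl fun i _ => ?_
    simp only [RCLike.inner_apply, conj_trivial, Finset.sum_mul]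
    refine Finset.sum_congr rfl fun j _ => ?_
    rw [hzi, hzi]
    simp only [M, Matrix.of_apply]
    have := (r0 i).ne'; have := (r0 j).ne'
    field_simp
  rw [← h1, ← b.sum_inner_mul_inner]
  refine Finset.sum_nonpos fun k _ => ?_
  rw [← hT (b k) z, hTb, inner_smul_left]
  simp only [conj_trivial]
  have hE : ∀ i, ∑ j, Q i j * (b k j / r j) = hM.eigenvalues k * (w i * (b k i / r i)) := by
    intro i
    have h2 := congrArg (fun v : EuclideanSpace ℝ ι => r i * v i) (hTb k)
    simp only [T, Matrix.ofLp_toLpLin, Matrix.toLin'_apply, Matrix.mulVec, dotProduct, M, Matrix.of_apply, PiLp.smul_apply, smul_eq_mul, Finset.mul_sum] at h2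
    have h3 : ∑ j, Q i j * (b k j / r j) = ∑ j, r i * (Q i j / (r i * r j) * b k j) := by
      refine Finset.sum_congr rfl fun j _ => ?_
      have := (r0 i).ne'; have := (r0 j).ne'
      field_simp
    rw [h3, h2, ← rr i]
    have := (r0 i).ne'
    field_simp
  rcases eig_alt Q hs a w ha hw0 hw hoff hB hconn (fun j => b k j / r j) _ hE with h | ⟨c, hc⟩
  · rw [real_inner_comm (b k) z]
    nlinarith [mul_nonneg (neg_nonneg.2 h) (mul_self_nonneg ⟪b k, z⟫)]
  · have : ⟪z, b k⟫ = 0 := by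
      have : ⟪z, b k⟫ = c * ∑ i, x i * (w i * a i) := by
        rw [PiLp.inner_apply, Finset.mul_sum]
        refine Finset.sum_congr rfl fun i _ => ?_
        have h5 := hc i
        have h6 : b k i = c * a i * r i := by
          rw [← h5]; have := (r0 i).ne'; field_simp
        rw [h6, hzi, ← rr i]
        simp only [RCLike.inner_apply, conj_trivial]
        ring
      rw [this, hx, mul_zero]
    rw [this, zero_mul]

end linalg
end PB

open scoped Pointwise RealInnerProductSpace
open scoped MeasureTheory
open MeasureTheory
namespace PB
set_option linter.unusedSectionVars false

lemma vol_slice {n : ℕ} {e : Eu (n+1)} {J : Eu n →ₗᵢ[ℝ] Eu (n+1)}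
    (hm : MeasurePreserving (fun p : ℝ × Eu n => p.1 • e + J p.2) (volume.prod volume) volume)
    {S : Set (Eu (n+1))} (hS : IsCompact S) :
    Integrable (fun s : ℝ => volume.real {y | s • e + J y ∈ S}) ∧
      volume.real S = ∫ s : ℝ, volume.real {y | s • e + J y ∈ S} := by
  set g : ℝ × Eu n → Eu (n+1) := fun p => p.1 • e + J p.2 with hg
  have hgm : MeasurableSet (g ⁻¹' S) := hm.measurable hS.measurableSet
  have hmeas := measurable_measure_prodMk_left (ν := (volume : Measure (Eu n))) hgm
  have hc : ∀ s : ℝ, IsCompact {y | s • e + J y ∈ S} := by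
    intro s
    have hcl : IsClosed {y | s • e + J y ∈ S} :=
      hS.isClosed.preimage (by fun_prop : Continuous fun y => s • e + J y)
    refine Metric.isCompact_of_isClosed_isBounded hcl ?_
    obtain ⟨R, hR⟩ := hS.isBounded.exists_norm_le
    refine (isBounded_iff_forall_norm_le).2 ⟨R + ‖s • e‖, fun y hy => ?_⟩
    have h1 := hR _ hy
    have h2 : ‖J y‖ ≤ ‖s • e + J y‖ + ‖s • e‖ := by
      have := norm_sub_le (s • e + J y) (s • e)
      simpa using this
    rw [J.norm_map] at h2
    linarith
  have h1 : volume S = ∫⁻ s : ℝ, volume {y | s • e + J y ∈ S} := by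
    rw [← hm.measure_preimage hS.measurableSet.nullMeasurableSet, Measure.prod_apply hgm]
    rfl
  have hfin : ∫⁻ s : ℝ, volume {y | s • e + J y ∈ S} ≠ ⊤ := by rw [← h1]; exact hS.measure_lt_top.ne
  refine ⟨?_, ?_⟩
  · exact integrable_toReal_of_lintegral_ne_top hmeas.aemeasurable hfin
  · rw [Measure.real, h1]
    exact (integral_toReal hmeas.aemeasurable (Filter.Eventually.of_forall fun s => (hc s).measure_lt_top)).symm

/-- partial derivatives continuous implies differentiable -/
lemma hasFDerivAt_of_partials {ι : Type*} [Fintype ι] [DecidableEq ι] {F : (ι → ℝ) → ℝ} {G : ι → (ι → ℝ) → ℝ}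
    {C : Set (ι → ℝ)} (hC : IsOpen C)
    (hF : ∀ h ∈ C, ∀ i, HasDerivAt (fun t => F (Function.update h i t)) (G i h) (h i))
    (hG : ∀ i, ContinuousOn (G i) C) {h : ι → ℝ} (hh : h ∈ C) :
    HasFDerivAt F (∑ i, G i h • (ContinuousLinearMap.proj i : (ι → ℝ) →L[ℝ] ℝ)) h := by
  -- main claim by induction on finsets
  have claim : ∀ (s : Finset ι) (ε : ℝ), 0 < ε → ∃ δ > 0, ∀ y : ι → ℝ, ‖y‖ < δ →
      |F (h + s.piecewise y 0) - F h - ∑ i ∈ s, G i h * y i| ≤ ε * ‖y‖ := by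
    intro s
    induction s using Finset.induction_on with
    | empty =>
      intro ε hε
      refine ⟨1, one_pos, fun y _ => ?_⟩
      simp; positivity
    | insert i s his ih =>
      intro ε hε
      obtain ⟨δ1, hδ1, H1⟩ := ih (ε / 2) (by positivity)
      have hcont : ContinuousAt (G i) h := (hG i).continuousAt (hC.mem_nhds hh)
      obtain ⟨δ2, hδ2, H2⟩ := Metric.continuousAt_iff.1 hcont (ε / 2) (by positivity)
      obtain ⟨δ3, hδ3, H3⟩ := Metric.isOpen_iff.1 hC h hh
      refine ⟨min δ1 (min δ2 δ3), by positivity, fun y hy => ?_⟩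
      have hy1 : ‖y‖ < δ1 := lt_of_lt_of_le hy (min_le_left _ _)
      have hy2 : ‖y‖ < δ2 := lt_of_lt_of_le hy ((min_le_right _ _).trans (min_le_left _ _))
      have hy3 : ‖y‖ < δ3 := lt_of_lt_of_le hy ((min_le_right _ _).trans (min_le_right _ _))
      set p := h + s.piecewise y 0 with hp
      have hpi : p i = h i := by simp [hp, his]
      have hq : h + (insert i s).piecewise y 0 = Function.update p i (h i + y i) := by
        ext j
        by_cases hj : j = i
        · subst hj; simp
        · simp [hp, hj, Finset.piecewise, Finset.mem_insert]
      have hp0 : p = Function.update p i (h i) := by rw [← hpi]; simp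
      have hnear : ∀ t ∈ Set.uIcc (h i) (h i + y i), dist (Function.update p i t) h ≤ ‖y‖ := by
        intro t ht
        rw [dist_pi_le_iff (norm_nonneg _)]
        intro j
        by_cases hj : j = i
        · subst hj
          simp only [Function.update_self, Real.dist_eq]
          have h1 := Set.abs_sub_left_of_mem_uIcc ht
          have h2 : |y j| ≤ ‖y‖ := norm_le_pi_norm y j
          simp at h1; linarith
        · simp only [Function.update_of_ne hj, hp, Pi.add_apply, Real.dist_eq, add_sub_cancel_left]
          by_cases hjs : j ∈ s
          · simpa [hjs] using norm_le_pi_norm y j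
          · simp [hjs]
      have mvt := Convex.norm_image_sub_le_of_norm_hasDerivWithin_le
        (f := fun t => F (Function.update p i t) - G i h * t)
        (f' := fun t => G i (Function.update p i t) - G i h) (s := Set.uIcc (h i) (h i + y i)) (C := ε / 2)
        (x := h i) (y := h i + y i)
        (fun t ht => by
          have hin : Function.update p i t ∈ C := H3 (lt_of_le_of_lt (hnear t ht) hy3)
          have h1 := hF _ hin i
          simp only [Function.update_idem, Function.update_self] at h1
          have h2 : HasDerivAt (fun t => G i h * t) (G i h) t := by
            simpa using (hasDerivAt_id t).const_mul (G i h)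
          exact (h1.sub h2).hasDerivWithinAt)
        (fun t ht => by
          have := H2 (lt_of_le_of_lt (hnear t ht) hy2)
          rw [Real.dist_eq] at this
          exact this.le)
        (convex_uIcc _ _) Set.left_mem_uIcc Set.right_mem_uIcc
      rw [hq, Finset.sum_insert his]
      have h4 := H1 y hy1
      simp only [← hp0, Real.norm_eq_abs, add_sub_cancel_left] at mvt
      have h2 : |y i| ≤ ‖y‖ := norm_le_pi_norm y i
      have e : F (Function.update p i (h i + y i)) - F h - (G i h * y i + ∑ j ∈ s, G j h * y j)
        = (F (Function.update p i (h i + y i)) - G i h * (h i + y i) - (F p - G i h * h i)) +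
          (F p - F h - ∑ j ∈ s, G j h * y j) := by ring
      rw [e]
      refine (abs_add_le _ _).trans ?_
      have : ε / 2 * |y i| ≤ ε / 2 * ‖y‖ := by gcongr
      linarith
  rw [hasFDerivAt_iff_isLittleO_nhds_zero, Asymptotics.isLittleO_iff]
  intro ε hε
  obtain ⟨δ, hδ, H⟩ := claim Finset.univ ε hε
  filter_upwards [Metric.ball_mem_nhds 0 hδ] with y hy
  have := H y (by simpa using hy)
  simpa using this

section chamber
variable {n : ℕ} {ι : Type} [Fintype ι] [DecidableEq ι]

def PH {n : ℕ} {ι : Type} (u : ι → Eu n) (h : ι → ℝ) : Set (Eu n) := {x | ∀ i, ⟪u i, x⟫ ≤ h i}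

structure Good {n : ℕ} {ι : Type} (u : ι → Eu n) (C : Set (ι → ℝ)) : Prop where
  isOpen : IsOpen C
  add : ∀ h ∈ C, ∀ h' ∈ C, h + h' ∈ C
  smul : ∀ t : ℝ, 0 < t → ∀ h ∈ C, t • h ∈ C
  bdd : ∀ h ∈ C, Bornology.IsBounded (PH u h)
  addP : ∀ h ∈ C, ∀ h' ∈ C, PH u (h + h') ⊆ PH u h + PH u h'

noncomputable def vv {n : ℕ} {ι : Type} (u : ι → Eu n) (h : ι → ℝ) : ℝ := volume.real (PH u h)

lemma PH_closed {ι : Type} (u : ι → Eu n) (h : ι → ℝ) : IsClosed (PH u h) := by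
  have : PH u h = ⋂ i, {x | ⟪u i, x⟫ ≤ h i} := by ext; simp [PH]
  rw [this]
  exact isClosed_iInter fun i => isClosed_le (by fun_prop) continuous_const

lemma PH_convex {ι : Type} (u : ι → Eu n) (h : ι → ℝ) : Convex ℝ (PH u h) := by
  intro x hx y hy a b ha hb hab i
  rw [inner_add_right, inner_smul_right, inner_smul_right]
  calc _ ≤ a * h i + b * h i := by gcongr; exacts [hx i, hy i]
    _ = h i := by rw [← add_mul, hab, one_mul]

lemma PH_add {ι : Type} {u : ι → Eu n} {h h' : ι → ℝ} {x y : Eu n} (hx : x ∈ PH u h) (hy : y ∈ PH u h') :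
    x + y ∈ PH u (h + h') := fun i => by
  rw [inner_add_right]; exact add_le_add (hx i) (hy i)

lemma PH_smul {ι : Type} (u : ι → Eu n) (h : ι → ℝ) {t : ℝ} (ht : 0 < t) : PH u (t • h) = t • PH u h := by
  ext x
  rw [Set.mem_smul_set_iff_inv_smul_mem₀ ht.ne']
  simp only [PH, Set.mem_ofPred_eq, inner_smul_right, Pi.smul_apply, smul_eq_mul]
  refine forall_congr' fun i => ?_
  rw [inv_mul_le_iff₀ ht]

lemma PH_translate {ι : Type} (u : ι → Eu n) (h : ι → ℝ) (x0 : Eu n) :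
    PH u (h + fun i => ⟪u i, x0⟫) = (fun y => x0 + y) '' PH u h := by
  ext x
  simp only [Set.mem_image, PH, Set.mem_ofPred_eq, Pi.add_apply]
  constructor
  · intro H
    exact ⟨x - x0, fun i => by rw [inner_sub_right]; linarith [H i], by simp⟩
  · rintro ⟨y, hy, rfl⟩ i
    rw [inner_add_right]; linarith [hy i]

lemma vv_smul {ι : Type} (u : ι → Eu n) (h : ι → ℝ) {t : ℝ} (ht : 0 < t) : vv u (t • h) = t ^ n * vv u h := by
  rw [vv, PH_smul u h ht, vol_smul t ht.le, vv]

lemma vv_translate {ι : Type} (u : ι → Eu n) (h : ι → ℝ) (x0 : Eu n) :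
    vv u (h + fun i => ⟪u i, x0⟫) = vv u h := by
  rw [vv, PH_translate, vol_add_left, vv]

lemma vv_nonneg {ι : Type} (u : ι → Eu n) (h : ι → ℝ) : 0 ≤ vv u h := measureReal_nonneg

namespace Good
variable {u : ι → Eu n} {C : Set (ι → ℝ)}

lemma compact (g : Good u C) {h : ι → ℝ} (hh : h ∈ C) : IsCompact (PH u h) :=
  Metric.isCompact_of_isClosed_isBounded (PH_closed u h) (g.bdd h hh)

lemma sub_mem (g : Good u C) {h : ι → ℝ} (hh : h ∈ C) (z : ι → ℝ) : ∃ ε > 0, ∀ t : ℝ, |t| ≤ ε → h + t • z ∈ C := by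
  have hc : ContinuousAt (fun t : ℝ => h + t • z) 0 := by fun_prop
  have h0 : C ∈ nhds (h + (0:ℝ) • z) := by simpa using g.isOpen.mem_nhds hh
  obtain ⟨ε, hε, H⟩ := Metric.mem_nhds_iff.1 (hc h0)
  refine ⟨ε / 2, by positivity, fun t ht => ?_⟩
  exact H (by simp only [Metric.mem_ball, dist_zero_right, Real.norm_eq_abs]; linarith)

lemma nonempty_of (g : Good u C) {h h' : ι → ℝ} (hh : h ∈ C) (hh' : h' ∈ C) (hn : (PH u h').Nonempty) :
    (PH u h).Nonempty := by
  obtain ⟨ε, hε, H⟩ := g.sub_mem hh' h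
  have h1 := H (-ε) (by simp [abs_of_pos hε])
  have h2 := g.smul ε hε h hh
  have h3 : h' = (h' + (-ε) • h) + ε • h := by simp
  obtain ⟨x, hx⟩ := hn
  rw [h3] at hx
  obtain ⟨a, ha, b, hb, rfl⟩ := g.addP _ h1 _ h2 hx
  rw [PH_smul u h hε] at hb
  obtain ⟨c, hc, rfl⟩ := hb
  exact ⟨c, hc⟩

lemma slack (g : Good u C) {h : ι → ℝ} (hh : h ∈ C) (hn : (PH u h).Nonempty) :
    ∃ x0 : Eu n, ∃ ε > 0, ∀ i, ⟪u i, x0⟫ + ε ≤ h i := by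
  obtain ⟨ε, hε, H⟩ := g.sub_mem hh (fun _ => 1)
  have h1 := H (-ε) (by simp [abs_of_pos hε])
  obtain ⟨x, hx⟩ := g.nonempty_of h1 hh hn
  refine ⟨x, ε, hε, fun i => ?_⟩
  have := hx i
  simp at this
  linarith

lemma pos (g : Good u C) {h : ι → ℝ} (hh : h ∈ C) (hn : (PH u h).Nonempty) : 0 < vv u h := by
  obtain ⟨x0, ε, hε, H⟩ := g.slack hh hn
  have hU : IsOpen {x : Eu n | ∀ i, ⟪u i, x⟫ < h i} := by
    simp only [Set.ofPred_forall]
    exact isOpen_iInter_of_finite fun i => isOpen_lt (by fun_prop) continuous_const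
  have hpos : 0 < volume {x : Eu n | ∀ i, ⟪u i, x⟫ < h i} :=
    hU.measure_pos volume ⟨x0, fun i => by linarith [H i]⟩
  have hle : volume {x : Eu n | ∀ i, ⟪u i, x⟫ < h i} ≤ volume (PH u h) :=
    measure_mono fun x hx i => (hx i).le
  exact ENNReal.toReal_pos (hpos.trans_le hle).ne' (g.compact hh).measure_lt_top.ne

lemma zero_of_empty {h : ι → ℝ} (hn : ¬ (PH u h).Nonempty) : vv u h = 0 := by
  rw [vv, Set.not_nonempty_iff_eq_empty.1 hn]; simp

lemma mono (g : Good u C) {h h' : ι → ℝ} (hh : h ∈ C) (hh' : h' ∈ C) : vv u h ≤ vv u (h + h') := by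
  by_cases hn : (PH u h).Nonempty
  · obtain ⟨x, hx⟩ := g.nonempty_of hh' hh hn
    rw [vv, ← vol_add_left x]
    refine vol_mono (g.compact (g.add _ hh _ hh')) ?_
    rintro _ ⟨y, hy, rfl⟩
    have := PH_add hy hx
    rwa [add_comm y x] at this
  · rw [zero_of_empty hn]; exact vv_nonneg _ _

end Good

end chamber
end PB

open scoped Pointwise RealInnerProductSpace
open scoped MeasureTheory
open MeasureTheory
namespace PB
set_option linter.unusedSectionVars false

section chamber2
variable {n : ℕ} {ι : Type} [Fintype ι] [DecidableEq ι]

/-- coordinates of the facet system -/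
def Tm (i : ι) (κ : ι → ℝ) : (ι → ℝ) →ₗ[ℝ] ({j : ι // j ≠ i} → ℝ) where
  toFun h := fun j => h j - κ j * h i
  map_add' x y := by ext j; simp; ring
  map_smul' c x := by ext j; simp; ring

lemma Tm_surj (i : ι) (κ : ι → ℝ) : Function.Surjective (Tm i κ) := by
  intro g
  refine ⟨fun j => if hj : j ≠ i then g ⟨j, hj⟩ else 0, ?_⟩
  ext j
  simp [Tm, j.2]

lemma facet (u : ι → Eu (n+1)) (i : ι) (hu : u i ≠ 0) :
    ∃ (w : {j : ι // j ≠ i} → Eu n) (κ : ι → ℝ), ∀ C : Set (ι → ℝ), Good u C →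
      Good w (Tm i κ '' C) ∧ ∀ h ∈ C, ContinuousOn (vv w) (Tm i κ '' C) →
        HasDerivAt (fun t => vv u (Function.update h i t)) (‖u i‖⁻¹ * vv w (Tm i κ h)) (h i) := by
  have r0 : 0 < ‖u i‖ := norm_pos_iff.2 hu
  set r := ‖u i‖ with hr
  set e : Eu (n+1) := r⁻¹ • u i with he
  have hen : ‖e‖ = 1 := by rw [he, norm_smul, norm_inv, norm_norm, ← hr, inv_mul_cancel₀ r0.ne']
  obtain ⟨J, hJe, hJs, hJm⟩ := frame e hen
  have hue : u i = r • e := by rw [he, smul_smul, mul_inv_cancel₀ r0.ne', one_smul]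
  have hee : ⟪e, e⟫ = 1 := by rw [real_inner_self_eq_norm_sq, hen]; norm_num
  have hui : ∀ x, ⟪u i, x⟫ = r * ⟪x, e⟫ := fun x => by
    rw [real_inner_comm e x, he, real_inner_smul_left]; field_simp
  let w : {j : ι // j ≠ i} → Eu n := fun j => J.toContinuousLinearMap.adjoint (u j)
  let κ : ι → ℝ := fun j => ⟪u j, e⟫ / r
  have hw : ∀ j y, ⟪w j, y⟫ = ⟪u j, J y⟫ := fun j y => by
    simp only [w]; rw [ContinuousLinearMap.adjoint_inner_left]; rfl
  -- key equivalence
  have key : ∀ (h : ι → ℝ) (s : ℝ) (y : Eu n), s • e + J y ∈ PH u h ↔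
      (r * s ≤ h i ∧ y ∈ PH w (Tm i κ (Function.update h i (r * s)))) := by
    intro h s y
    have hi : ⟪u i, s • e + J y⟫ = r * s := by
      rw [hui, inner_add_left, real_inner_smul_left, hee, hJe]
      simp
    have hj : ∀ j, ⟪u j, s • e + J y⟫ = κ j * (r * s) + ⟪u j, J y⟫ := by
      intro j
      rw [inner_add_right, inner_smul_right]
      simp only [κ]; field_simp
    constructor
    · intro H
      refine ⟨hi ▸ H i, fun j => ?_⟩
      have := H j
      rw [hj] at this
      rw [hw]
      simp only [Tm, LinearMap.coe_mk, AddHom.coe_mk, Function.update_self, Function.update_of_ne j.2]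
      linarith
    · rintro ⟨h1, h2⟩ j
      by_cases hji : j = i
      · subst hji; rw [hi]; exact h1
      · have := h2 ⟨j, hji⟩
        rw [hw] at this
        simp only [Tm, LinearMap.coe_mk, AddHom.coe_mk, Function.update_self, Function.update_of_ne hji] at this
        rw [hj]; linarith
  have key0 : ∀ (h : ι → ℝ) (y : Eu n), (h i / r) • e + J y ∈ PH u h ↔ y ∈ PH w (Tm i κ h) := by
    intro h y
    rw [key]
    have : r * (h i / r) = h i := by field_simp
    rw [this]; simp
  refine ⟨w, κ, fun C g => ⟨⟨?_, ?_, ?_, ?_, ?_⟩, ?_⟩⟩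
  · exact (Tm i κ).isOpenMap_of_finiteDimensional (Tm_surj i κ) C g.isOpen
  · rintro _ ⟨h, hh, rfl⟩ _ ⟨h', hh', rfl⟩
    exact ⟨h + h', g.add _ hh _ hh', map_add _ _ _⟩
  · rintro t ht _ ⟨h, hh, rfl⟩
    exact ⟨t • h, g.smul t ht _ hh, map_smul _ _ _⟩
  · rintro _ ⟨h, hh, rfl⟩
    obtain ⟨R, hR⟩ := (g.bdd h hh).exists_norm_le
    refine (isBounded_iff_forall_norm_le).2 ⟨R + ‖(h i / r) • e‖, fun y hy => ?_⟩
    have h1 := hR _ ((key0 h y).2 hy)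
    have h2 : ‖J y‖ ≤ ‖(h i / r) • e + J y‖ + ‖(h i / r) • e‖ := by
      have := norm_sub_le ((h i / r) • e + J y) ((h i / r) • e)
      simpa using this
    rw [J.norm_map] at h2
    linarith
  · rintro _ ⟨h, hh, rfl⟩ _ ⟨h', hh', rfl⟩ y hy
    rw [← map_add] at hy
    obtain ⟨a, ha, b, hb, hab⟩ := g.addP h hh h' hh' ((key0 (h + h') y).2 hy)
    have hab : a + b = ((h + h') i / r) • e + J y := hab
    have ha1 := ha i
    have hb1 := hb i
    have hs : ⟪u i, a⟫ + ⟪u i, b⟫ = h i + h' i := by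
      rw [← inner_add_right, hab, hui, inner_add_left, real_inner_smul_left, hee, hJe]
      simp; field_simp
    have ha2 : ⟪a, e⟫ = h i / r := by
      have : ⟪u i, a⟫ = h i := by linarith
      rw [hui] at this
      rw [eq_div_iff r0.ne']; linarith
    have hb2 : ⟪b, e⟫ = h' i / r := by
      have : ⟪u i, b⟫ = h' i := by linarith
      rw [hui] at this
      rw [eq_div_iff r0.ne']; linarith
    obtain ⟨ya, hya⟩ := hJs a
    obtain ⟨yb, hyb⟩ := hJs b
    rw [ha2] at hya
    rw [hb2] at hyb
    refine ⟨ya, (key0 h ya).1 (hya ▸ ha), yb, (key0 h' yb).1 (hyb ▸ hb), ?_⟩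
    apply J.injective
    have h5 : ((h + h') i / r) • e = (h i / r) • e + (h' i / r) • e := by
      rw [← add_smul, Pi.add_apply, add_div]
    change J (ya + yb) = J y
    rw [map_add]
    have h6 : (h i / r) • e + J ya + ((h' i / r) • e + J yb) = (h i / r) • e + (h' i / r) • e + J y := by
      rw [← hya, ← hyb, hab, h5]
    have h7 : ((h i / r) • e + (h' i / r) • e) + (J ya + J yb) = ((h i / r) • e + (h' i / r) • e) + J y := by
      rw [← h6]; abel
    exact add_left_cancel h7
  · intro h hh hcont
    -- slices
    set ψ : ℝ → ℝ := fun s => vv w (Tm i κ (Function.update h i (r * s))) with hψ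
    have hsl : ∀ t s, volume.real {y | s • e + J y ∈ PH u (Function.update h i t)} =
        (Set.Iic (t / r)).indicator ψ s := by
      intro t s
      have hiff : s ∈ Set.Iic (t / r) ↔ r * s ≤ t := by
        rw [Set.mem_Iic, le_div_iff₀ r0, mul_comm]
      by_cases hs : s ∈ Set.Iic (t / r)
      · rw [Set.indicator_of_mem hs]
        simp only [hψ, vv]
        congr 1
        ext y
        rw [Set.mem_ofPred_eq, key]
        simp [hiff.1 hs]
      · rw [Set.indicator_of_notMem hs]
        have : {y | s • e + J y ∈ PH u (Function.update h i t)} = ∅ := by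
          ext y
          rw [Set.mem_ofPred_eq, key]
          simp only [Function.update_self, Set.mem_empty_iff_false, iff_false, not_and]
          intro h9
          exact absurd (hiff.2 h9) hs
        rw [this]; simp
    obtain ⟨ε, hε, Hε⟩ := g.sub_mem hh (Pi.single i 1)
    have hin : ∀ t, |t - h i| ≤ ε → Function.update h i t ∈ C := by
      intro t ht
      have := Hε _ ht
      convert this using 1
      ext j
      by_cases hj : j = i
      · subst hj; simp
      · simp [hj]
    have hvol : ∀ t, |t - h i| ≤ ε → IntegrableOn ψ (Set.Iic (t / r)) ∧
        vv u (Function.update h i t) = ∫ s in Set.Iic (t / r), ψ s := by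
      intro t ht
      obtain ⟨h1, h2⟩ := vol_slice hJm (g.compact (hin t ht))
      simp only [hsl] at h1 h2
      refine ⟨(integrable_indicator_iff measurableSet_Iic).1 h1, ?_⟩
      rw [vv, h2, integral_indicator measurableSet_Iic]
    have hI := (hvol (h i + ε) (by simp [abs_of_pos hε])).1
    set b0 := h i / r with hb0
    have hψc : ContinuousAt ψ b0 := by
      have hmem : Tm i κ (Function.update h i (r * b0)) ∈ Tm i κ '' C := by
        refine ⟨_, hin (r * b0) ?_, rfl⟩
        rw [hb0]; field_simp; simp [hε.le]
      have hop : IsOpen (Tm i κ '' C) := (Tm i κ).isOpenMap_of_finiteDimensional (Tm_surj i κ) C g.isOpen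
      have c1 : ContinuousAt (vv w) (Tm i κ (Function.update h i (r * b0))) :=
        hcont.continuousAt (hop.mem_nhds hmem)
      have c2 : Continuous (fun s : ℝ => Tm i κ (Function.update h i (r * s))) := by
        have := (Tm i κ).continuous_of_finiteDimensional
        refine this.comp ?_
        exact (continuous_const.update i (continuous_const.mul continuous_id))
      exact ContinuousAt.comp (f := fun s : ℝ => Tm i κ (Function.update h i (r * s))) c1 c2.continuousAt
    have hlt : b0 < (h i + ε) / r := by rw [hb0]; gcongr; linarith
    set a0 := b0 - 1 with ha0
    have hII : IntervalIntegrable ψ volume a0 b0 := by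
      rw [intervalIntegrable_iff_integrableOn_Ioc_of_le (by linarith)]
      exact hI.mono_set (fun x hx => (hx.2.trans hlt.le))
    have hsm : StronglyMeasurableAtFilter ψ (nhds b0) volume :=
      ⟨Set.Iic ((h i + ε) / r), Iic_mem_nhds hlt, hI.aestronglyMeasurable⟩
    have D1 := intervalIntegral.integral_hasDerivAt_right hII hsm hψc
    have D2 : HasDerivAt (fun t : ℝ => t / r) (r⁻¹) (h i) := by
      simpa [div_eq_mul_inv] using (hasDerivAt_id (h i)).mul_const r⁻¹
    have D3 : HasDerivAt (fun t : ℝ => ∫ x in a0..(t / r), ψ x) (ψ b0 * r⁻¹) (h i) :=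
      HasDerivAt.comp (h₂ := fun b => ∫ x in a0..b, ψ x) (h i) D1 D2
    have D4 := D3.const_add (∫ x in Set.Iic a0, ψ x)
    have hval : ψ b0 * r⁻¹ = r⁻¹ * vv w (Tm i κ h) := by
      have : r * b0 = h i := by rw [hb0]; field_simp
      simp only [hψ, this, Function.update_eq_self]; ring
    rw [hval] at D4
    refine D4.congr_of_eventuallyEq ?_
    filter_upwards [Metric.closedBall_mem_nhds (h i) (show 0 < min ε r by positivity)] with t ht
    rw [Metric.mem_closedBall, Real.dist_eq, le_min_iff] at ht
    rw [(hvol t ht.1).2]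
    have h8 := intervalIntegral.integral_Iic_sub_Iic (a := a0) (b := t / r) (f := ψ) (μ := volume)
      (hI.mono_set (Set.Iic_subset_Iic.2 (by linarith))) ((hvol t ht.1).1)
    rw [← h8]; ring

lemma partial_zero {u : ι → Eu n} {C : Set (ι → ℝ)} (g : Good u C) (i : ι) (hu : u i = 0) {h : ι → ℝ} (hh : h ∈ C) :
    HasDerivAt (fun t => vv u (Function.update h i t)) 0 (h i) := by
  obtain ⟨ε, hε, Hε⟩ := g.sub_mem hh (Pi.single i 1)
  have hin : ∀ t, |t - h i| ≤ ε → Function.update h i t ∈ C := by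
    intro t ht
    have := Hε _ ht
    convert this using 1
    ext j
    by_cases hj : j = i
    · subst hj; simp
    · simp [hj]
  refine (hasDerivAt_const (h i) (vv u h)).congr_of_eventuallyEq ?_
  filter_upwards [Metric.closedBall_mem_nhds (h i) hε] with t ht
  rw [Metric.mem_closedBall, Real.dist_eq] at ht
  by_cases hn : (PH u h).Nonempty
  · have hn2 := g.nonempty_of (hin t ht) hh hn
    obtain ⟨x, hx⟩ := hn
    obtain ⟨x', hx'⟩ := hn2
    have e1 := hx i
    have e2 := hx' i
    simp only [hu, inner_zero_left, Function.update_self] at e1 e2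
    have : PH u (Function.update h i t) = PH u h := by
      ext z
      constructor <;> intro H j <;> by_cases hj : j = i
      · subst hj; simpa [hu] using e1
      · simpa [hj] using H j
      · subst hj; simpa [hu] using e2
      · simpa [hj] using H j
    simp [vv, this]
  · have hn2 : ¬ (PH u (Function.update h i t)).Nonempty := fun h2 => hn (g.nonempty_of hh (hin t ht) h2)
    rw [Good.zero_of_empty hn, Good.zero_of_empty hn2]

end chamber2

open scoped ContDiff in
theorem Good.contDiffOn (n : ℕ) : ∀ {ι : Type} [Fintype ι] [DecidableEq ι] {u : ι → Eu n} {C : Set (ι → ℝ)},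
    Good u C → ContDiffOn ℝ ∞ (vv u) C ∧
     ∃ G : ι → (ι → ℝ) → ℝ, (∀ i, ContDiffOn ℝ ∞ (G i) C) ∧
      ∀ h ∈ C, HasFDerivAt (vv u) (∑ i, G i h • (ContinuousLinearMap.proj i : (ι → ℝ) →L[ℝ] ℝ)) h := by
  induction n with
  | zero =>
    intro ι _ _ u C g
    have hu : ∀ i, u i = 0 := fun i => Subsingleton.elim _ _
    have hG : ∀ h ∈ C, HasFDerivAt (vv u) (∑ i, (0:ℝ) • (ContinuousLinearMap.proj i : (ι → ℝ) →L[ℝ] ℝ)) h := fun h hh =>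
      hasFDerivAt_of_partials (G := fun _ _ => 0) g.isOpen (fun h hh i => partial_zero g i (hu i) hh) (fun i => continuousOn_const) hh
    refine ⟨?_, fun _ _ => 0, fun i => contDiffOn_const, hG⟩
    rw [contDiffOn_infty_iff_fderiv_of_isOpen g.isOpen]
    refine ⟨fun h hh => (hG h hh).differentiableAt.differentiableWithinAt, ?_⟩
    refine (contDiffOn_const (c := (0 : (ι → ℝ) →L[ℝ] ℝ))).congr fun h hh => ?_
    rw [(hG h hh).fderiv]; simp
  | succ n ih =>
    intro ι _ _ u C g
    have hp : ∀ i, ∃ G : (ι → ℝ) → ℝ, ContDiffOn ℝ ∞ G C ∧ ∀ h ∈ C,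
        HasDerivAt (fun t => vv u (Function.update h i t)) (G h) (h i) := by
      intro i
      by_cases hu : u i = 0
      · exact ⟨fun _ => 0, contDiffOn_const, fun h hh => partial_zero g i hu hh⟩
      · obtain ⟨w, κ, H⟩ := facet u i hu
        obtain ⟨gw, H2⟩ := H C g
        have sm := (ih gw).1
        refine ⟨fun h => ‖u i‖⁻¹ * vv w (Tm i κ h), ?_, fun h hh => H2 h hh sm.continuousOn⟩
        refine contDiffOn_const.mul ?_
        have : ContDiff ℝ ∞ (Tm i κ) := (Tm i κ).toContinuousLinearMap.contDiff
        exact sm.comp this.contDiffOn (fun h hh => ⟨h, hh, rfl⟩)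
    choose G hG1 hG2 using hp
    have hG : ∀ h ∈ C, HasFDerivAt (vv u) (∑ i, G i h • (ContinuousLinearMap.proj i : (ι → ℝ) →L[ℝ] ℝ)) h := fun h hh =>
      hasFDerivAt_of_partials (G := G) g.isOpen (fun h hh i => hG2 i h hh) (fun i => (hG1 i).continuousOn) hh
    refine ⟨?_, G, hG1, hG⟩
    rw [contDiffOn_infty_iff_fderiv_of_isOpen g.isOpen]
    refine ⟨fun h hh => (hG h hh).differentiableAt.differentiableWithinAt, ?_⟩
    refine (ContDiffOn.sum (fun i _ => (hG1 i).smul contDiffOn_const) :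
      ContDiffOn ℝ ∞ (fun h => ∑ i, G i h • (ContinuousLinearMap.proj i : (ι → ℝ) →L[ℝ] ℝ)) C).congr fun h hh => ?_
    rw [(hG h hh).fderiv]

end PB

open scoped Pointwise RealInnerProductSpace
open scoped MeasureTheory
open MeasureTheory
namespace PB
set_option linter.unusedSectionVars false

section calculus
open scoped ContDiff

/-- second derivative test for locally concave powers -/
lemma ineq_of_concave {f f' : ℝ → ℝ} {f'' α ε : ℝ} (hα : 0 < α) (hε : 0 < ε)
    (hf : ∀ t ∈ Set.Ioo (-ε) ε, HasDerivAt f (f' t) t) (hf' : HasDerivAt f' f'' 0)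
    (hpos : ∀ t ∈ Set.Ioo (-ε) ε, 0 < f t)
    (hc : ConcaveOn ℝ (Set.Ioo (-ε) ε) (fun t => f t ^ α)) :
    f 0 * f'' ≤ (1 - α) * f' 0 ^ 2 := by
  have h0 : (0:ℝ) ∈ Set.Ioo (-ε) ε := by constructor <;> linarith
  have hg : ∀ t ∈ Set.Ioo (-ε) ε, HasDerivAt (fun t => f t ^ α) (f' t * α * f t ^ (α - 1)) t := by
    intro t ht
    exact (hf t ht).rpow_const (Or.inl (hpos t ht).ne')
  have hanti : AntitoneOn (fun t => f' t * α * f t ^ (α - 1)) (Set.Ioo (-ε) ε) := by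
    intro a ha b hb hab
    rcases hab.eq_or_lt with rfl | hlt
    · exact le_rfl
    have h1 := hc.le_slope_of_hasDerivAt ha hb hlt (hg b hb)
    have h2 := hc.slope_le_of_hasDerivAt ha hb hlt (hg a ha)
    exact h1.trans h2
  have hg2 : HasDerivAt (fun t => f' t * α * f t ^ (α - 1))
      (f'' * α * f 0 ^ (α - 1) + f' 0 * α * (f' 0 * (α - 1) * f 0 ^ (α - 1 - 1))) 0 := by
    exact (hf'.mul_const α).mul ((hf 0 h0).rpow_const (Or.inl (hpos 0 h0).ne'))
  have hle : f'' * α * f 0 ^ (α - 1) + f' 0 * α * (f' 0 * (α - 1) * f 0 ^ (α - 1 - 1)) ≤ 0 := by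
    rw [← hg2.deriv]
    have : deriv (fun t => f' t * α * f t ^ (α - 1)) 0 =
      derivWithin (fun t => f' t * α * f t ^ (α - 1)) (Set.Ioo (-ε) ε) 0 :=
      (derivWithin_of_isOpen isOpen_Ioo h0).symm
    rw [this]
    exact hanti.derivWithin_nonpos
  have hp := hpos 0 h0
  have e1 : f 0 ^ (α - 1) = f 0 * f 0 ^ (α - 1 - 1) := by
    rw [Real.rpow_sub_one hp.ne' (α - 1)]; field_simp
  rw [e1] at hle
  have hq : 0 < f 0 ^ (α - 1 - 1) := Real.rpow_pos_of_pos hp _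
  have : α * f 0 ^ (α - 1 - 1) * (f 0 * f'' - (1 - α) * f' 0 ^ 2) ≤ 0 := by nlinarith
  have h3 : 0 < α * f 0 ^ (α - 1 - 1) := by positivity
  nlinarith [nonpos_of_mul_nonpos_right this h3]

lemma concave_of_ineq {f f' f'' : ℝ → ℝ} {α : ℝ} (hα : 0 < α)
    (hf : ∀ t ∈ Set.Icc (0:ℝ) 1, HasDerivAt f (f' t) t) (hf' : ∀ t ∈ Set.Icc (0:ℝ) 1, HasDerivAt f' (f'' t) t)
    (hpos : ∀ t ∈ Set.Icc (0:ℝ) 1, 0 < f t)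
    (hc : ∀ t ∈ Set.Icc (0:ℝ) 1, f t * f'' t ≤ (1 - α) * f' t ^ 2) :
    ConcaveOn ℝ (Set.Icc (0:ℝ) 1) (fun t => f t ^ α) := by
  have hg : ∀ t ∈ Set.Icc (0:ℝ) 1, HasDerivAt (fun t => f t ^ α) (f' t * α * f t ^ (α - 1)) t := by
    intro t ht
    exact (hf t ht).rpow_const (Or.inl (hpos t ht).ne')
  have hg2 : ∀ t ∈ Set.Icc (0:ℝ) 1, HasDerivAt (fun t => f' t * α * f t ^ (α - 1))
      (f'' t * α * f t ^ (α - 1) + f' t * α * (f' t * (α - 1) * f t ^ (α - 1 - 1))) t := by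
    intro t ht
    exact ((hf' t ht).mul_const α).mul ((hf t ht).rpow_const (Or.inl (hpos t ht).ne'))
  refine concaveOn_of_hasDerivWithinAt2_nonpos (convex_Icc 0 1)
    (fun t ht => (hg t ht).continuousAt.continuousWithinAt)
    (fun t ht => (hg t (interior_subset ht)).hasDerivWithinAt)
    (fun t ht => (hg2 t (interior_subset ht)).hasDerivWithinAt) ?_
  intro t ht
  have ht := interior_subset ht
  have hp := hpos t ht
  have e1 : f t ^ (α - 1) = f t * f t ^ (α - 1 - 1) := by
    rw [Real.rpow_sub_one hp.ne' (α - 1)]; field_simp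
  rw [e1]
  have hq : 0 < f t ^ (α - 1 - 1) := Real.rpow_pos_of_pos hp _
  have h3 : 0 < α * f t ^ (α - 1 - 1) := by positivity
  have := mul_le_mul_of_nonneg_left (hc t ht) h3.le
  nlinarith

variable {E : Type*} [NormedAddCommGroup E] [NormedSpace ℝ E] [FiniteDimensional ℝ E]
variable {E' : Type*} [NormedAddCommGroup E'] [NormedSpace ℝ E'] [FiniteDimensional ℝ E']

noncomputable def D (a : E) (F : E → ℝ) (h : E) : ℝ := fderiv ℝ F h a

lemma D_add (a b : E) (F : E → ℝ) (h : E) : D (a + b) F h = D a F h + D b F h := by simp [D]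
lemma D_sub (a b : E) (F : E → ℝ) (h : E) : D (a - b) F h = D a F h - D b F h := by simp [D]
lemma D_smul (c : ℝ) (b : E) (F : E → ℝ) (h : E) : D (c • b) F h = c * D b F h := by simp [D]
lemma D_sum {κ : Type*} (s : Finset κ) (b : κ → E) (F : E → ℝ) (h : E) : D (∑ i ∈ s, b i) F h = ∑ i ∈ s, D (b i) F h := by
  simp [D]

lemma D_single {ι : Type} [Fintype ι] [DecidableEq ι] (a : ι → ℝ) (F : (ι → ℝ) → ℝ) (h : ι → ℝ) :
    D a F h = ∑ i, a i * D (Pi.single i 1) F h := by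
  have : a = ∑ i, a i • (Pi.single i (1:ℝ) : ι → ℝ) := by
    ext j; simp [Finset.sum_apply, Pi.single_apply]
  conv_lhs => rw [this]
  rw [D_sum]; simp only [D_smul]

section
variable {C : Set E} {F G : E → ℝ}

lemma D_congr (hC : IsOpen C) (H : ∀ h ∈ C, F h = G h) (a : E) {h : E} (hh : h ∈ C) : D a F h = D a G h := by
  have : F =ᶠ[nhds h] G := by
    filter_upwards [hC.mem_nhds hh] with x hx using H x hx
  rw [D, D, this.fderiv_eq]

lemma D_hasF (hC : IsOpen C) (hF : ContDiffOn ℝ ∞ F C) {h : E} (hh : h ∈ C) : DifferentiableAt ℝ F h :=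
  (hF.contDiffAt (hC.mem_nhds hh)).differentiableAt (by simp)

lemma D_smooth (hC : IsOpen C) (hF : ContDiffOn ℝ ∞ F C) (a : E) : ContDiffOn ℝ ∞ (D a F) C := by
  have := (contDiffOn_infty_iff_fderiv_of_isOpen hC).1 hF
  exact this.2.clm_apply contDiffOn_const

lemma D_comm (hC : IsOpen C) (hF : ContDiffOn ℝ ∞ F C) (a b : E) {h : E} (hh : h ∈ C) : D a (D b F) h = D b (D a F) h := by
  have h1 := hF.contDiffAt (hC.mem_nhds hh)
  have h2 : IsSymmSndFDerivAt ℝ F h := h1.isSymmSndFDerivAt (by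
    simp only [minSmoothness_of_isRCLikeNormedField]; exact WithTop.coe_le_coe.2 le_top)
  have hd : DifferentiableAt ℝ (fderiv ℝ F) h :=
    (((contDiffOn_infty_iff_fderiv_of_isOpen hC).1 hF).2.contDiffAt (hC.mem_nhds hh)).differentiableAt (by simp)
  have key : ∀ a b, D a (D b F) h = fderiv ℝ (fderiv ℝ F) h a b := by
    intro a b
    have : D b F = fun x => fderiv ℝ F x b := rfl
    rw [D, this, fderiv_clm_apply hd (differentiableAt_const b)]
    simp
  rw [key, key]
  exact h2.eq a b

lemma D_fadd (hC : IsOpen C) (hF : ContDiffOn ℝ ∞ F C) (hG : ContDiffOn ℝ ∞ G C) (a : E) {h : E} (hh : h ∈ C) :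
    D a (fun x => F x + G x) h = D a F h + D a G h := by
  rw [D, fderiv_fun_add (D_hasF hC hF hh) (D_hasF hC hG hh)]; rfl

lemma D_fsum (hC : IsOpen C) {κ : Type*} {s : Finset κ} {F : κ → E → ℝ} (hF : ∀ i ∈ s, ContDiffOn ℝ ∞ (F i) C) (a : E) {h : E} (hh : h ∈ C) :
    D a (fun x => ∑ i ∈ s, F i x) h = ∑ i ∈ s, D a (F i) h := by
  rw [D, fderiv_fun_sum (fun i hi => D_hasF hC (hF i hi) hh)]; simp [D]

lemma D_fmul (hC : IsOpen C) (c : ℝ) (hF : ContDiffOn ℝ ∞ F C) (a : E) {h : E} (hh : h ∈ C) :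
    D a (fun x => c * F x) h = c * D a F h := by
  rw [D, fderiv_const_mul (D_hasF hC hF hh)]; rfl

lemma D_const (hC : IsOpen C) (c : ℝ) (H : ∀ h ∈ C, F h = c) (a : E) {h : E} (hh : h ∈ C) : D a F h = 0 := by
  rw [D_congr hC (G := fun _ => c) H a hh]; simp [D]

lemma D_deriv (hC : IsOpen C) (hF : ContDiffOn ℝ ∞ F C) {h x : E} {t : ℝ} (hh : h + t • x ∈ C) :
    HasDerivAt (fun t : ℝ => F (h + t • x)) (D x F (h + t • x)) t := by
  have h1 := (D_hasF hC hF hh).hasFDerivAt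
  have h2 : HasDerivAt (fun t : ℝ => h + t • x) x t := by
    simpa using ((hasDerivAt_id t).smul_const x).const_add h
  exact h1.comp_hasDerivAt t h2

lemma D_comp (hC : IsOpen C) (T : E →ₗ[ℝ] E') (hT : Function.Surjective T) {F : E' → ℝ} (hF : ContDiffOn ℝ ∞ F (T '' C)) (a : E) {h : E} (hh : h ∈ C) :
    D a (fun x => F (T x)) h = D (T a) F (T h) := by
  have hop : IsOpen (T '' C) := T.isOpenMap_of_finiteDimensional hT C hC
  have h1 := (D_hasF hop hF ⟨h, hh, rfl⟩).hasFDerivAt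
  have h2 : HasFDerivAt (fun x => T x) T.toContinuousLinearMap h := T.toContinuousLinearMap.hasFDerivAt
  have : HasFDerivAt (fun x => F (T x)) _ h := HasFDerivAt.comp (g := F) (f := fun x => T x) h h1 h2
  rw [D, HasFDerivAt.fderiv this]
  rfl

lemma comp_smooth (hC : IsOpen C) (T : E →ₗ[ℝ] E') {F : E' → ℝ} (hF : ContDiffOn ℝ ∞ F (T '' C)) :
    ContDiffOn ℝ ∞ (fun x => F (T x)) C := by
  have : ContDiff ℝ ∞ T := T.toContinuousLinearMap.contDiff
  exact hF.comp this.contDiffOn (fun h hh => ⟨h, hh, rfl⟩)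

end

/-- cone hypotheses -/
structure Cone (C : Set E) : Prop where
  isOpen : IsOpen C
  add : ∀ h ∈ C, ∀ h' ∈ C, h + h' ∈ C
  smul : ∀ t : ℝ, 0 < t → ∀ h ∈ C, t • h ∈ C

def Hom (m : ℕ) (C : Set E) (F : E → ℝ) : Prop := ∀ t : ℝ, 0 < t → ∀ h ∈ C, F (t • h) = t ^ m * F h

variable {C : Set E} {F : E → ℝ} {m : ℕ}

lemma Cone.sub (c : Cone C) {h : E} (hh : h ∈ C) (z : E) : ∃ ε > 0, ∀ t : ℝ, |t| ≤ ε → h + t • z ∈ C := by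
  have hc : ContinuousAt (fun t : ℝ => h + t • z) 0 := by fun_prop
  have h0 : C ∈ nhds (h + (0:ℝ) • z) := by simpa using c.isOpen.mem_nhds hh
  obtain ⟨ε, hε, H⟩ := Metric.mem_nhds_iff.1 (hc h0)
  refine ⟨ε / 2, by positivity, fun t ht => ?_⟩
  exact H (by simp only [Metric.mem_ball, dist_zero_right, Real.norm_eq_abs]; linarith)

lemma Cone.split (c : Cone C) {h Z : E} (hh : h ∈ C) (hZ : Z ∈ C) : ∃ ε : ℝ, 0 < ε ∧ ∃ Y ∈ C, Z = Y + ε • h := by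
  obtain ⟨ε, hε, H⟩ := c.sub hZ h
  exact ⟨ε, hε, _, H (-ε) (by simp [abs_of_pos hε]), by simp⟩

lemma Hom.euler (c : Cone C) (hF : ContDiffOn ℝ ∞ F C) (H : Hom m C F) {h : E} (hh : h ∈ C) : D h F h = m * F h := by
  have h1 := D_deriv c.isOpen hF (h := 0) (x := h) (t := 1) (by simpa using hh)
  have h2 : HasDerivAt (fun t : ℝ => t ^ m * F h) (m * 1 ^ (m - 1) * F h) 1 :=
    (hasDerivAt_pow m 1).mul_const _
  simp only [zero_add, one_smul] at h1
  have h3 : HasDerivAt (fun t : ℝ => F (t • h)) (m * 1 ^ (m - 1) * F h) 1 := by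
    refine h2.congr_of_eventuallyEq ?_
    filter_upwards [lt_mem_nhds (show (0:ℝ) < 1 by norm_num)] with t ht
    exact H t ht h hh
  rw [h1.unique h3]; simp

lemma Hom.D (c : Cone C) (hF : ContDiffOn ℝ ∞ F C) (H : Hom (m+1) C F) (a : E) : Hom m C (D a F) := by
  intro t ht h hh
  have hth := c.smul t ht h hh
  let T : E →ₗ[ℝ] E := t • LinearMap.id
  have hT : Function.Surjective T := fun y => ⟨t⁻¹ • y, by simp [T, smul_smul, ht.ne']⟩
  have hTC : T '' C = C := by
    ext y; constructor
    · rintro ⟨x, hx, rfl⟩; exact c.smul t ht x hx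
    · intro hy; exact ⟨t⁻¹ • y, c.smul _ (inv_pos.2 ht) y hy, by simp [T, smul_smul, ht.ne']⟩
  have e1 := D_comp c.isOpen T hT (F := F) (by rwa [hTC]) a hh
  have e2 : PB.D a (fun x => F (T x)) h = PB.D a (fun x => t ^ (m+1) * F x) h :=
    D_congr c.isOpen (fun x hx => H t ht x hx) a hh
  rw [D_fmul c.isOpen _ hF a hh, e1] at e2
  have e3 : T a = t • a := rfl
  have e4 : T h = t • h := rfl
  rw [e3, e4, D_smul] at e2
  have : t * PB.D a F (t • h) = t * (t ^ m * PB.D a F h) := by rw [e2]; ring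
  exact mul_left_cancel₀ ht.ne' this

/-- Hessian as a bilinear map -/
noncomputable def Hs (F : E → ℝ) (h : E) (a b : E) : ℝ := D a (D b F) h

lemma Hs_add_left (F : E → ℝ) (h a a' b : E) : Hs F h (a + a') b = Hs F h a b + Hs F h a' b := D_add ..
lemma Hs_smul_left (F : E → ℝ) (h : E) (t : ℝ) (a b : E) : Hs F h (t • a) b = t * Hs F h a b := D_smul ..
lemma Hs_symm (c : Cone C) (hF : ContDiffOn ℝ ∞ F C) {h : E} (hh : h ∈ C) (a b : E) : Hs F h a b = Hs F h b a :=
  D_comm c.isOpen hF a b hh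

lemma hyp_transfer (B : E → E → ℝ) (hadd : ∀ a a' b, B (a + a') b = B a b + B a' b)
    (hsm : ∀ (t : ℝ) a b, B (t • a) b = t * B a b) (hs : ∀ a b, B a b = B b a) (h : E) (hh : 0 < B h h)
    (H : ∀ x, B x h = 0 → B x x ≤ 0) (y : E) (hy : 0 < B y y) (x : E) : B x x * B y y ≤ B x y ^ 2 := by
  have hyh : B y h ≠ 0 := fun h0 => by linarith [H y h0]
  set s := B x h / B y h with hsdef
  have h1 : B (x + (-s) • y) h = 0 := by
    rw [hadd, hsm, hsdef]; field_simp; ring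
  have h2 := H _ h1
  have e : B (x + (-s) • y) (x + (-s) • y) = B x x - 2 * s * B x y + s ^ 2 * B y y := by
    rw [hadd, hsm, hs x, hs y, hadd, hadd, hsm, hsm, hs y x]; ring
  rw [e] at h2
  nlinarith [sq_nonneg (s * B y y - B x y)]

lemma hyp_of_concave (c : Cone C) (hF : ContDiffOn ℝ ∞ F C) (H : Hom (m+2) C F) {h : E} (hh : h ∈ C)
    (hpos : ∀ h ∈ C, 0 < F h)
    (hc : ConcaveOn ℝ C (fun h => F h ^ (1 / ((m + 2 : ℕ) : ℝ)))) (x : E) : Hs F h x x * Hs F h h h ≤ Hs F h x h ^ 2 := by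
  obtain ⟨ε, hε, Hε⟩ := c.sub hh x
  have hin : ∀ t ∈ Set.Ioo (-ε) ε, h + t • x ∈ C := fun t ht => Hε t (abs_le.2 ⟨ht.1.le, ht.2.le⟩)
  have key := ineq_of_concave (f := fun t => F (h + t • x)) (f' := fun t => D x F (h + t • x)) (f'' := D x (D x F) h)
    (α := 1 / ((m + 2 : ℕ) : ℝ)) (by positivity) hε (fun t ht => D_deriv c.isOpen hF (hin t ht))
    (by
      have := D_deriv c.isOpen (D_smooth c.isOpen hF x) (h := h) (x := x) (t := 0) (by simpa using hh)
      simpa using this) (fun t ht => hpos _ (hin t ht)) (by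
      refine ⟨convex_Ioo _ _, fun s hs t ht a b ha hb hab => ?_⟩
      have := hc.2 (hin s hs) (hin t ht) ha hb hab
      refine this.trans (le_of_eq ?_)
      simp only [smul_eq_mul]
      congr 2
      rw [smul_add, smul_add, add_smul, smul_smul, smul_smul]
      nth_rewrite 3 [← one_smul ℝ h]
      rw [← hab, add_smul]; abel)
  simp only [zero_smul, add_zero] at key
  have e1 : Hs F h h h = (m + 1) * ((m + 2) * F h) := by
    rw [Hs, Hom.euler c (D_smooth c.isOpen hF h) (Hom.D c hF H h) hh, Hom.euler c hF H hh]; push_cast; ring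
  have e2 : Hs F h x h = (m + 1) * D x F h := by
    rw [Hs_symm c hF hh, Hs, Hom.euler c (D_smooth c.isOpen hF x) (Hom.D c hF H x) hh]; push_cast; ring
  rw [e1, e2]
  change D x (D x F) h * _ ≤ _
  have h3 : (1 - 1 / ((m + 2 : ℕ) : ℝ)) = (m + 1) / (m + 2) := by push_cast; field_simp; ring
  rw [h3] at key
  have h4 := mul_le_mul_of_nonneg_left key (show (0:ℝ) ≤ (m + 1) * (m + 2) by positivity)
  have h5 : ((m:ℝ) + 1) * (m + 2) * ((m + 1) / (m + 2) * D x F h ^ 2) = ((m + 1) * D x F h) ^ 2 := by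
    field_simp
  rw [h5] at h4
  linarith

lemma superadd_of_hyp (c : Cone C) (hF : ContDiffOn ℝ ∞ F C) (H : Hom (m+2) C F)
    (hpos : ∀ h ∈ C, 0 < F h)
    (hy : ∀ h ∈ C, ∀ x, Hs F h x x * Hs F h h h ≤ Hs F h x h ^ 2) {h h' : E} (hh : h ∈ C) (hh' : h' ∈ C) :
    F h ^ (1 / ((m + 2 : ℕ) : ℝ)) + F h' ^ (1 / ((m + 2 : ℕ) : ℝ)) ≤ F (h + h') ^ (1 / ((m + 2 : ℕ) : ℝ)) := by
  have hin : ∀ t ∈ Set.Icc (0:ℝ) 1, h + t • (h' - h) ∈ C := by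
    intro t ht
    rcases ht.1.eq_or_lt with rfl | h0
    · simpa using hh
    rcases ht.2.eq_or_lt with rfl | h1
    · simpa using hh'
    have : h + t • (h' - h) = (1 - t) • h + t • h' := by rw [smul_sub, sub_smul, one_smul]; abel
    rw [this]
    exact c.add _ (c.smul _ (by linarith) _ hh) _ (c.smul _ h0 _ hh')
  have hc := concave_of_ineq (f := fun t => F (h + t • (h' - h))) (f' := fun t => D (h' - h) F (h + t • (h' - h)))
    (f'' := fun t => D (h' - h) (D (h' - h) F) (h + t • (h' - h)))
    (α := 1 / ((m + 2 : ℕ) : ℝ)) (by positivity) (fun t ht => D_deriv c.isOpen hF (hin t ht))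
    (fun t ht => D_deriv c.isOpen (D_smooth c.isOpen hF _) (hin t ht)) (fun t ht => hpos _ (hin t ht)) (by
      intro t ht
      have hk := hin t ht
      have key := hy _ hk (h' - h)
      set k := h + t • (h' - h)
      have e1 : Hs F k k k = (m + 1) * ((m + 2) * F k) := by
        rw [Hs, Hom.euler c (D_smooth c.isOpen hF k) (Hom.D c hF H k) hk, Hom.euler c hF H hk]; push_cast; ring
      have e2 : ∀ x, Hs F k x k = (m + 1) * D x F k := fun x => by
        rw [Hs_symm c hF hk, Hs, Hom.euler c (D_smooth c.isOpen hF x) (Hom.D c hF H x) hk]; push_cast; ring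
      rw [e1, e2] at key
      have h3 : (1 - 1 / ((m + 2 : ℕ) : ℝ)) = (m + 1) / (m + 2) := by push_cast; field_simp; ring
      rw [h3, div_mul_eq_mul_div, le_div_iff₀ (by positivity)]
      have hm : (0:ℝ) < m + 1 := by positivity
      change D (h' - h) (D (h' - h) F) k * _ ≤ _ at key
      refine le_of_mul_le_mul_left ?_ hm
      linarith)
  have := hc.2 (show (0:ℝ) ∈ Set.Icc (0:ℝ) 1 by simp) (show (1:ℝ) ∈ Set.Icc (0:ℝ) 1 by simp) (show (0:ℝ) ≤ 1/2 by norm_num) (show (0:ℝ) ≤ 1/2 by norm_num) (by norm_num)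
  simp only [smul_eq_mul, zero_smul, add_zero, mul_zero, one_smul, zero_add, mul_one, add_sub_cancel] at this
  have e3 : h + (1/2:ℝ) • (h' - h) = (1/2:ℝ) • (h + h') := by
    rw [smul_sub, smul_add]
    have : h = (1/2:ℝ) • h + (1/2:ℝ) • h := by rw [← add_smul]; norm_num
    nth_rewrite 1 [this]; abel
  rw [e3, H _ (by norm_num) _ (c.add _ hh _ hh'), Real.mul_rpow (by positivity) (hpos _ (c.add _ hh _ hh')).le,
    one_div, one_div, Real.pow_rpow_inv_natCast (by norm_num) (by omega)] at this
  rw [one_div]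
  linarith

end calculus
end PB

open scoped Pointwise RealInnerProductSpace
open scoped MeasureTheory
open MeasureTheory
namespace PB
set_option linter.unusedSectionVars false
set_option linter.unusedVariables false

section adm
open scoped ContDiff
variable {E : Type*} [NormedAddCommGroup E] [NormedSpace ℝ E] [FiniteDimensional ℝ E]
variable {E' : Type*} [NormedAddCommGroup E'] [NormedSpace ℝ E'] [FiniteDimensional ℝ E']

structure Adm (m : ℕ) (C : Set E) (F : E → ℝ) : Prop where
  smooth : ContDiffOn ℝ ∞ F C
  hom : Hom m C F
  nonneg : ∀ h ∈ C, 0 ≤ F h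
  mono : ∀ h ∈ C, ∀ h' ∈ C, F h ≤ F (h + h')

variable {C : Set E} {F : E → ℝ} {m : ℕ}

lemma Adm.D_nonneg (c : Cone C) (A : Adm m C F) {h Z : E} (hh : h ∈ C) (hZ : Z ∈ C) : 0 ≤ D Z F h := by
  have h1 := D_deriv c.isOpen A.smooth (h := h) (x := Z) (t := 0) (by simpa using hh)
  simp only [zero_smul, add_zero] at h1
  have h2 : HasDerivWithinAt (fun t : ℝ => F (h + t • Z)) (D Z F h) (Set.Ici 0) 0 := h1.hasDerivWithinAt
  have h3 := hasDerivWithinAt_iff_tendsto_slope.1 h2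
  rw [show Set.Ici (0:ℝ) \ {0} = Set.Ioi 0 by ext; simp [lt_iff_le_and_ne, eq_comm]] at h3
  refine ge_of_tendsto h3 ?_
  filter_upwards [self_mem_nhdsWithin] with t ht
  have ht : 0 < t := ht
  rw [slope_def_field]
  have := A.mono h hh _ (c.smul t ht Z hZ)
  simp only [zero_smul, add_zero, sub_zero]
  exact div_nonneg (by linarith) ht.le

lemma Adm.pos_of (c : Cone C) (A : Adm m C F) {h h' : E} (hh : h ∈ C) (hh' : h' ∈ C) (hp : 0 < F h) : 0 < F h' := by
  obtain ⟨ε, hε, Y, hY, rfl⟩ := c.split hh hh'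
  have := A.mono _ (c.smul ε hε _ hh) _ hY
  rw [A.hom ε hε _ hh, add_comm] at this
  have h2 : 0 < ε ^ m * F h := by positivity
  linarith

lemma Adm.D_pos (c : Cone C) (A : Adm (m+1) C F) {h Z : E} (hh : h ∈ C) (hZ : Z ∈ C) (hp : 0 < F h) : 0 < D Z F h := by
  obtain ⟨ε, hε, Y, hY, rfl⟩ := c.split hh hZ
  rw [D_add, D_smul, Hom.euler c A.smooth A.hom hh]
  have := A.D_nonneg c hh hY
  push_cast
  positivity

lemma Adm.congr (A : Adm m C F) (c : Cone C) {G : E → ℝ} (H : ∀ h ∈ C, G h = F h) : Adm m C G where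
  smooth := A.smooth.congr H
  hom t ht h hh := by rw [H _ (c.smul t ht h hh), H h hh, A.hom t ht h hh]
  nonneg h hh := by rw [H h hh]; exact A.nonneg h hh
  mono h hh h' hh' := by rw [H h hh, H _ (c.add _ hh _ hh')]; exact A.mono h hh h' hh'

lemma Adm.zero (m : ℕ) (C : Set E) : Adm m C (fun _ => 0) where
  smooth := contDiffOn_const
  hom t ht h hh := by simp
  nonneg h hh := le_rfl
  mono h hh h' hh' := le_rfl

lemma Adm.comp (c : Cone C) (T : E →ₗ[ℝ] E') {F : E' → ℝ} (A : Adm m (T '' C) F) {r : ℝ} (hr : 0 ≤ r) :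
    Adm m C (fun h => r * F (T h)) where
  smooth := contDiffOn_const.mul (comp_smooth c.isOpen T A.smooth)
  hom t ht h hh := by
    simp only
    rw [map_smul, A.hom t ht _ ⟨h, hh, rfl⟩]; ring
  nonneg h hh := mul_nonneg hr (A.nonneg _ ⟨h, hh, rfl⟩)
  mono h hh h' hh' := by
    rw [map_add]
    exact mul_le_mul_of_nonneg_left (A.mono _ ⟨h, hh, rfl⟩ _ ⟨h', hh', rfl⟩) hr

lemma Hs_comp (c : Cone C) (T : E →ₗ[ℝ] E') (hT : Function.Surjective T) {F : E' → ℝ} (hF : ContDiffOn ℝ ∞ F (T '' C))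
    (r : ℝ) {h : E} (hh : h ∈ C) (a b : E) : Hs (fun h => r * F (T h)) h a b = r * Hs F (T h) (T a) (T b) := by
  have hop : IsOpen (T '' C) := T.isOpenMap_of_finiteDimensional hT C c.isOpen
  have h1 : ∀ x ∈ C, D b (fun h => r * F (T h)) x = r * D (T b) F (T x) := fun x hx => by
    rw [D_fmul c.isOpen r (comp_smooth c.isOpen T hF) b hx, D_comp c.isOpen T hT hF b hx]
  rw [Hs, D_congr c.isOpen h1 a hh, D_fmul c.isOpen r (comp_smooth c.isOpen T (D_smooth hop hF _)) a hh,
    D_comp c.isOpen T hT (D_smooth hop hF _) a hh]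
  rfl

/-- hyperbolicity of the Hessian -/
def Hyp (C : Set E) (F : E → ℝ) : Prop := ∀ h ∈ C, ∀ Z ∈ C, 0 < F h → 0 < Hs F h Z Z ∧
  ∀ x, Hs F h x x * Hs F h Z Z ≤ Hs F h x Z ^ 2

lemma Hyp.comp (c : Cone C) (T : E →ₗ[ℝ] E') (hT : Function.Surjective T) {F : E' → ℝ} (hF : ContDiffOn ℝ ∞ F (T '' C))
    (H : Hyp (T '' C) F) {r : ℝ} (hr : 0 < r) : Hyp C (fun h => r * F (T h)) := by
  intro h hh Z hZ hp
  have hp' : 0 < F (T h) := pos_of_mul_pos_right hp hr.le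
  obtain ⟨h1, h2⟩ := H (T h) ⟨h, hh, rfl⟩ (T Z) ⟨Z, hZ, rfl⟩ hp'
  refine ⟨?_, fun x => ?_⟩
  · rw [Hs_comp c T hT hF r hh]; positivity
  · rw [Hs_comp c T hT hF r hh, Hs_comp c T hT hF r hh, Hs_comp c T hT hF r hh]
    have := mul_le_mul_of_nonneg_left (h2 (T x)) (sq_nonneg r)
    nlinarith

lemma Hs_congr (c : Cone C) {G : E → ℝ} (H : ∀ h ∈ C, F h = G h) {h : E} (hh : h ∈ C) (a b : E) : Hs F h a b = Hs G h a b :=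
  D_congr c.isOpen (fun x hx => D_congr c.isOpen H b hx) a hh

lemma concave_of_superadd (c : Cone C) (H : Hom (m+1) C F) (h0 : ∀ h ∈ C, 0 ≤ F h)
    (hs : ∀ h ∈ C, ∀ h' ∈ C, F h ^ (1 / ((m + 1 : ℕ) : ℝ)) + F h' ^ (1 / ((m + 1 : ℕ) : ℝ)) ≤ F (h + h') ^ (1 / ((m + 1 : ℕ) : ℝ))) :
    ConcaveOn ℝ C (fun h => F h ^ (1 / ((m + 1 : ℕ) : ℝ))) := by
  have hcv : ∀ x ∈ C, ∀ y ∈ C, ∀ a b : ℝ, 0 ≤ a → 0 ≤ b → a + b = 1 → a • x + b • y ∈ C := by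
    intro x hx y hy a b ha hb hab
    rcases ha.eq_or_lt with rfl | ha
    · rw [zero_add] at hab; subst hab; simpa using hy
    rcases hb.eq_or_lt with rfl | hb
    · rw [add_zero] at hab; subst hab; simpa using hx
    exact c.add _ (c.smul a ha x hx) _ (c.smul b hb y hy)
  refine ⟨fun x hx y hy a b ha hb hab => hcv x hx y hy a b ha hb hab, ?_⟩
  intro x hx y hy a b ha hb hab
  rcases ha.eq_or_lt with rfl | ha
  · rw [zero_add] at hab; subst hab; simp
  rcases hb.eq_or_lt with rfl | hb
  · rw [add_zero] at hab; subst hab; simp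
  have e : ∀ z ∈ C, ∀ t : ℝ, 0 < t → t * F z ^ (1 / ((m + 1 : ℕ) : ℝ)) = F (t • z) ^ (1 / ((m + 1 : ℕ) : ℝ)) := by
    intro z hz t ht
    rw [H t ht z hz, Real.mul_rpow (by positivity) (h0 z hz), one_div, Real.pow_rpow_inv_natCast ht.le (by omega)]
  simp only [smul_eq_mul]
  rw [e x hx a ha, e y hy b hb]
  exact hs _ (c.smul a ha x hx) _ (c.smul b hb y hy)

end adm

section chamber3
open scoped ContDiff
variable {n : ℕ} {ι : Type} [Fintype ι] [DecidableEq ι] {u : ι → Eu n} {C : Set (ι → ℝ)}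

lemma Good.cone (g : Good u C) : Cone C := ⟨g.isOpen, g.add, g.smul⟩

lemma Good.adm (g : Good u C) : Adm n C (vv u) where
  smooth := (Good.contDiffOn n g).1
  hom t ht h hh := vv_smul u h ht
  nonneg h hh := vv_nonneg u h
  mono h hh h' hh' := g.mono hh hh'

lemma Good.facetD {u : ι → Eu (n+1)} (g : Good u C) (i : ι) :
    (∀ h ∈ C, D (Pi.single i 1) (vv u) h = 0) ∨
    ∃ (r : ℝ) (w : {j : ι // j ≠ i} → Eu n) (κ : ι → ℝ), 0 < r ∧ Good w (Tm i κ '' C) ∧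
      ∀ h ∈ C, D (Pi.single i 1) (vv u) h = r * vv w (Tm i κ h) := by
  have hd : ∀ h ∈ C, HasDerivAt (fun t => vv u (Function.update h i t)) (D (Pi.single i 1) (vv u) h) (h i) := by
    intro h hh
    have h1 := D_deriv g.isOpen g.adm.smooth (h := h) (x := Pi.single i 1) (t := 0) (by simpa using hh)
    simp only [zero_smul, add_zero] at h1
    have h2 : HasDerivAt (fun t : ℝ => t - h i) 1 (h i) := (hasDerivAt_id _).sub_const _
    have h3 : HasDerivAt (fun t : ℝ => vv u (h + t • Pi.single i 1)) (D (Pi.single i 1) (vv u) h) (h i - h i) := by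
      rwa [sub_self]
    have h4 := HasDerivAt.comp (h₂ := fun t : ℝ => vv u (h + t • Pi.single i 1)) (h := fun t : ℝ => t - h i) (h i) h3 h2
    rw [mul_one] at h4
    refine h4.congr_of_eventuallyEq (Filter.Eventually.of_forall fun t => ?_)
    change vv u _ = vv u _
    congr 1
    ext j
    by_cases hj : j = i
    · subst hj; simp
    · simp [hj]
  by_cases hu : u i = 0
  · left
    intro h hh
    exact (hd h hh).unique (partial_zero g i hu hh)
  · right
    obtain ⟨w, κ, H⟩ := facet u i hu
    obtain ⟨gw, H2⟩ := H C g
    exact ⟨_, w, κ, inv_pos.2 (norm_pos_iff.2 hu), gw, fun h hh => (hd h hh).unique (H2 h hh gw.adm.smooth.continuousOn)⟩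

lemma Good.adm_partial {u : ι → Eu (n+1)} (g : Good u C) (i : ι) : Adm n C (D (Pi.single i 1) (vv u)) := by
  rcases g.facetD i with h0 | ⟨r, w, κ, hr, gw, H⟩
  · exact (Adm.zero n C).congr g.cone h0
  · exact (Adm.comp g.cone (Tm i κ) gw.adm hr.le).congr g.cone H

lemma Good.D_trans {u : ι → Eu n} (g : Good u C) (x0 : Eu n) {h : ι → ℝ} (hh : h ∈ C) :
    D (fun i => ⟪u i, x0⟫) (vv u) h = 0 := by
  have h1 := D_deriv g.isOpen g.adm.smooth (h := h) (x := fun i => ⟪u i, x0⟫) (t := 0) (by simpa using hh)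
  simp only [zero_smul, add_zero] at h1
  refine h1.unique ((hasDerivAt_const (0:ℝ) (vv u h)).congr_of_eventuallyEq ?_)
  refine Filter.Eventually.of_forall fun t => ?_
  have := vv_translate u h (t • x0)
  rw [← this]
  simp only
  congr 2
  ext i; simp [inner_smul_right]

lemma Good.concave {u : ι → Eu (n+1)} (g : Good u C) : ConcaveOn ℝ C (fun h => vv u h ^ (1 / ((n + 1 : ℕ) : ℝ))) := by
  refine concave_of_superadd g.cone g.adm.hom g.adm.nonneg ?_
  intro h hh h' hh'
  by_cases hn : (PH u h).Nonempty
  · exact bm (by omega) (g.compact hh) (g.compact hh') (g.compact (g.add _ hh _ hh')) hn (g.nonempty_of hh' hh hn)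
      (fun a ha b hb => PH_add ha hb)
  · have hn' : ¬ (PH u h').Nonempty := fun h2 => hn (g.nonempty_of hh hh' h2)
    rw [Good.zero_of_empty hn, Good.zero_of_empty hn', Real.zero_rpow (by positivity), zero_add]
    exact Real.rpow_nonneg (vv_nonneg _ _) _

lemma Good.ne_of_pos {u : ι → Eu n} {h : ι → ℝ} (hp : 0 < vv u h) : (PH u h).Nonempty := by
  by_contra hn
  rw [Good.zero_of_empty hn] at hp
  exact lt_irrefl _ hp

lemma Good.hyp {u : ι → Eu (n+2)} (g : Good u C) : Hyp C (vv u) := by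
  intro h hh Z hZ hp
  have hpos : ∀ h' ∈ C, 0 < vv u h' := fun h' hh' => g.adm.pos_of g.cone hh hh' hp
  have h1 := hyp_of_concave g.cone g.adm.smooth g.adm.hom hh hpos g.concave
  have hhh : 0 < Hs (vv u) h h h := by
    rw [Hs, Hom.euler g.cone (D_smooth g.isOpen g.adm.smooth h) (Hom.D g.cone g.adm.smooth g.adm.hom h) hh,
      Hom.euler g.cone g.adm.smooth g.adm.hom hh]
    have := hpos h hh
    positivity
  have hnn : ∀ a ∈ C, ∀ b ∈ C, 0 ≤ Hs (vv u) h a b := by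
    intro a ha b hb
    obtain ⟨x0, ε, hε, hx0⟩ := g.slack hb (g.nonempty_of hb hh (Good.ne_of_pos hp))
    set b' : ι → ℝ := b - fun i => ⟪u i, x0⟫ with hb'
    have e1 : ∀ x ∈ C, D b (vv u) x = ∑ i, b' i * D (Pi.single i 1) (vv u) x := by
      intro x hx
      rw [← D_single, hb', D_sub, g.D_trans x0 hx, sub_zero]
    rw [Hs, D_congr g.isOpen e1 a hh, D_fsum g.isOpen (fun i _ => contDiffOn_const.mul (D_smooth g.isOpen g.adm.smooth _)) a hh]
    refine Finset.sum_nonneg fun i _ => ?_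
    rw [D_fmul g.isOpen _ (D_smooth g.isOpen g.adm.smooth _) a hh]
    have h2 := (g.adm_partial i).D_nonneg g.cone hh ha
    have h3 : 0 ≤ b' i := by simp only [hb', Pi.sub_apply]; linarith [hx0 i]
    positivity
  have hs := Hs_symm g.cone g.adm.smooth hh
  have hZZ : 0 < Hs (vv u) h Z Z := by
    obtain ⟨ε, hε, Y, hY, rfl⟩ := g.cone.split hh hZ
    rw [Hs_add_left, Hs_smul_left, hs h, Hs_add_left, Hs_smul_left]
    have h4 := hnn Y hY _ hZ
    have h5 := hnn Y hY h hh
    positivity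
  refine ⟨hZZ, fun x => ?_⟩
  refine hyp_transfer (Hs (vv u) h) (Hs_add_left _ _) (Hs_smul_left _ _) hs h hhh ?_ Z hZZ x
  intro x hx
  have := h1 x
  rw [hx] at this
  by_contra hcon
  push Not at hcon
  have : 0 < Hs (vv u) h x x * Hs (vv u) h h h := by positivity
  nlinarith

lemma Good.hyp_partial {u : ι → Eu (n+3)} (g : Good u C) (i : ι) : Hyp C (D (Pi.single i 1) (vv u)) := by
  rcases g.facetD i with h0 | ⟨r, w, κ, hr, gw, H⟩
  · intro h hh Z hZ hp
    rw [h0 h hh] at hp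
    exact absurd hp (lt_irrefl _)
  · have := Hyp.comp g.cone (Tm i κ) (Tm_surj i κ) gw.adm.smooth gw.hyp hr
    intro h hh Z hZ hp
    have H2 := this h hh Z hZ (by simp only; rw [← H h hh]; exact hp)
    simp only [Hs_congr g.cone H hh]
    exact H2

lemma Good.adm_partial2 {u : ι → Eu (n+2)} (g : Good u C) {i j : ι} (hij : j ≠ i) :
    Adm n C (D (Pi.single j 1) (D (Pi.single i 1) (vv u))) := by
  rcases g.facetD i with h0 | ⟨r, w, κ, hr, gw, H⟩
  · exact (Adm.zero n C).congr g.cone (fun h hh => D_const g.isOpen 0 h0 _ hh)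
  · refine (Adm.comp g.cone (Tm i κ) (gw.adm_partial ⟨j, hij⟩) hr.le).congr g.cone fun h hh => ?_
    rw [D_congr g.isOpen H _ hh, D_fmul g.isOpen r (comp_smooth g.isOpen _ gw.adm.smooth) _ hh,
      D_comp g.isOpen _ (Tm_surj i κ) gw.adm.smooth _ hh]
    congr 2
    ext k
    simp only [Tm, LinearMap.coe_mk, AddHom.coe_mk, Pi.single_apply, hij.symm, if_false, mul_zero, sub_zero]
    simp [Subtype.ext_iff]

end chamber3
end PB

open scoped Pointwise RealInnerProductSpace
open scoped MeasureTheory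
open MeasureTheory
namespace PB
set_option linter.unusedSectionVars false
set_option linter.unusedVariables false

section af
open scoped ContDiff
variable {n : ℕ} {ι : Type} [Fintype ι] [DecidableEq ι] {C : Set (ι → ℝ)}

lemma sum_sub {p : ι → Prop} [DecidablePred p] (φ : ι → ℝ) (H : ∀ i, ¬ p i → φ i = 0) :
    ∑ i : {i // p i}, φ i = ∑ i, φ i := by
  rw [← Finset.sum_filter_of_ne (p := p) (fun i _ hi => by by_contra h2; exact hi (H i h2)),
    ← Finset.sum_subtype_eq_sum_filter]
  exact Finset.sum_congr (by ext; simp) (fun _ _ => rfl)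

theorem Good.af {u : ι → Eu (n+3)} (g : Good u C) {Z : ι → ℝ} (hZ : Z ∈ C) {h : ι → ℝ} (hh : h ∈ C) (hp : 0 < vv u h)
    (x : ι → ℝ) : Hs (D Z (vv u)) h x x * Hs (D Z (vv u)) h h h ≤ Hs (D Z (vv u)) h x h ^ 2 := by
  classical
  set v := vv u with hv
  have sm : ContDiffOn ℝ ∞ v C := g.adm.smooth
  have hC := g.isOpen
  set q := D Z v with hq
  have smq : ContDiffOn ℝ ∞ q C := D_smooth hC sm Z
  let e : ι → (ι → ℝ) := fun i => Pi.single i 1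
  let f : ι → (ι → ℝ) → ℝ := fun i => D (e i) v
  have smf : ∀ i, ContDiffOn ℝ ∞ (f i) C := fun i => D_smooth hC sm _
  have af : ∀ i, Adm (n+2) C (f i) := fun i => g.adm_partial i
  have hne := Good.ne_of_pos hp
  -- shifts
  have shift : ∀ b ∈ C, ∃ b' : ι → ℝ, (∀ i, 0 < b' i) ∧ ∀ y ∈ C, D b' v y = D b v y := by
    intro b hb
    obtain ⟨x0, ε, hε, hx0⟩ := g.slack hb (g.nonempty_of hb hh hne)
    refine ⟨b - fun i => ⟪u i, x0⟫, fun i => ?_, fun y hy => ?_⟩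
    · simp only [Pi.sub_apply]; linarith [hx0 i]
    · rw [D_sub, g.D_trans x0 hy, sub_zero]
  obtain ⟨Z', hZ'0, hZ'⟩ := shift Z hZ
  obtain ⟨h', hh'0, hh'⟩ := shift h hh
  -- Q
  have swap12 : ∀ a b c, D a (D b (D c v)) h = D b (D a (D c v)) h := fun a b c =>
    D_comm hC (D_smooth hC sm c) a b hh
  have swap23 : ∀ a b c, D a (D b (D c v)) h = D a (D c (D b v)) h := fun a b c =>
    D_congr hC (fun y hy => D_comm hC sm b c hy) a hh
  have Qi : ∀ i y, Hs q h (e i) y = Hs (f i) h y Z := by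
    intro i y
    change D (e i) (D y (D Z v)) h = D y (D Z (D (e i) v)) h
    rw [swap12, swap23]
  have Qs := Hs_symm g.cone smq hh
  have Qexp : ∀ x y, Hs q h x y = ∑ i, x i * Hs q h (e i) y := fun x y => D_single x _ h
  have fz : ∀ i, ¬ 0 < f i h → ∀ y ∈ C, f i y = 0 := by
    intro i hi y hy
    by_contra hcon
    exact hi ((af i).pos_of g.cone hy hh (lt_of_le_of_ne ((af i).nonneg y hy) (Ne.symm hcon)))
  have Hz : ∀ i, ¬ 0 < f i h → ∀ a b, Hs (f i) h a b = 0 := by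
    intro i hi a b
    exact D_const hC 0 (fun y hy => D_const hC 0 (fz i hi) b hy) a hh
  let p : ι → Prop := fun i => 0 < f i h
  have Qexp' : ∀ x y, Hs q h x y = ∑ i : {i // p i}, x i * Hs q h (e i) y := fun x y => by
    rw [Qexp, ← sum_sub (p := p)]
    intro i hi
    rw [Qi, Hz i hi, mul_zero]
  have hyp := fun i => g.hyp_partial i
  have QZpos : ∀ i, p i → 0 < Hs q h (e i) Z := by
    intro i hi
    rw [Qi]; exact (hyp i h hh Z hZ hi).1
  have Qoff : ∀ i j, i ≠ j → 0 ≤ Hs q h (e i) (e j) ∧ (Hs q h (e i) (e j) = 0 → D (e j) (f i) h = 0) := by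
    intro i j hij
    have ad : Adm (n+1) C (D (e j) (f i)) := g.adm_partial2 (Ne.symm hij)
    have e1 : Hs q h (e i) (e j) = D Z (D (e j) (f i)) h := by
      rw [Qi]; exact D_comm hC (smf i) _ _ hh
    rw [e1]
    refine ⟨ad.D_nonneg g.cone hh hZ, fun h0 => ?_⟩
    by_contra hcon
    have := ad.D_pos g.cone hh hZ (lt_of_le_of_ne (ad.nonneg h hh) (Ne.symm hcon))
    linarith
  -- the hessian of v
  have Vs := Hs_symm g.cone sm hh
  have Vexp : ∀ x y, Hs v h x y = ∑ i, x i * Hs v h (e i) y := fun x y => D_single x _ h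
  have Vi : ∀ i y, Hs v h (e i) y = D y (f i) h := fun i y => by rw [Vs]; rfl
  have Vexp' : ∀ x y, Hs v h x y = ∑ i : {i // p i}, x i * Hs v h (e i) y := fun x y => by
    rw [Vexp, ← sum_sub (p := p)]
    intro i hi
    rw [Vi, D_const hC 0 (fz i hi) _ hh, mul_zero]
  -- nonempty
  have Vh' : ∀ x, Hs v h x h' = Hs v h x h := fun x => D_congr hC hh' x hh
  have vdeg : 0 < Hs v h h h := (g.hyp h hh h hh hp).1
  have key : ∀ x, Hs q h x Z = 0 → Hs q h x x ≤ 0 := by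
    intro x hx
    have := bochner (ι := {i // p i}) (fun i j => Hs q h (e i) (e j)) (fun i j => Qs _ _)
      (fun i => Z' i) (fun i => Hs q h (e i) Z / Z' i) (fun i => hZ'0 i) (fun i => div_pos (QZpos i i.2) (hZ'0 i))
      ?_ (fun i j hij => (Qoff i j (fun h => hij (Subtype.ext h))).1) ?_ ?_ (fun i => x i) ?_
    · rw [Qexp']
      refine le_trans (le_of_eq ?_) this
      refine Finset.sum_congr rfl fun i _ => ?_
      rw [Qs, Qexp', Finset.mul_sum]
      refine Finset.sum_congr rfl fun j _ => ?_
      rw [Qs (e j)]; ring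
    · intro i
      have hz := (hZ'0 i).ne'
      have e1 : ∑ j : {i // p i}, Hs q h (e i) (e j) * Z' j = Hs q h Z' (e i) := by
        rw [Qexp']; refine Finset.sum_congr rfl fun j _ => ?_
        rw [Qs]; ring
      rw [e1]
      have e2 : Hs q h Z' (e i) = Hs q h Z (e i) := by
        change D Z' (D (e i) (D Z v)) h = D Z (D (e i) (D Z v)) h
        have : ∀ a, D a (D (e i) (D Z v)) h = D (e i) (D Z (D a v)) h := fun a => by rw [swap12, swap23]
        rw [this, this]
        exact D_congr hC (fun y hy => D_congr hC hZ' Z hy) _ hh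
      rw [e2, Qs]; field_simp
    · intro y
      let X : ι → ℝ := fun i => if hi : p i then y ⟨i, hi⟩ else 0
      have hX : ∀ i : {i // p i}, X i = y i := fun i => by simp [X, i.2]
      have e0 : ∀ i : {i // p i}, ∑ j : {i // p i}, Hs q h (e i) (e j) * y j = Hs q h (e i) X := by
        intro i
        rw [Qs, Qexp']
        refine Finset.sum_congr rfl fun j _ => ?_
        rw [Qs, hX]; ring
      have e1 : ∑ i : {i // p i}, ∑ j : {i // p i}, Hs q h (e i) (e j) * y i * y j = Hs q h X X := by
        rw [Qexp']
        refine Finset.sum_congr rfl fun i _ => ?_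
        rw [← e0, Finset.mul_sum, hX]
        refine Finset.sum_congr rfl fun j _ => ?_
        ring
      simp only [e0]
      rw [e1]
      have e2 : Hs q h X X = ∑ i : {i // p i}, Z' i * Hs (f i) h X X := by
        rw [sum_sub (p := p) (fun i => Z' i * Hs (f i) h X X) (fun i hi => by rw [Hz i hi, mul_zero])]
        have e3 : Hs q h X X = D Z' (D X (D X v)) h := by
          have : ∀ a, D a (D X (D X v)) h = D X (D X (D a v)) h := fun a => by rw [swap12, swap23]
          rw [this]
          exact (D_congr hC (fun y hy => D_congr hC hZ' X hy) _ hh).symm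
        rw [e3, D_single]
        refine Finset.sum_congr rfl fun i _ => ?_
        congr 1
        change D (e i) (D X (D X v)) h = D X (D X (D (e i) v)) h
        rw [swap12, swap23]
      rw [e2]
      refine Finset.sum_le_sum fun i _ => ?_
      obtain ⟨h1, h2⟩ := hyp i h hh Z hZ i.2
      have h2 := h2 X
      rw [Qi, Qi]
      have hz := hZ'0 i
      change 0 < Hs (f i) h Z Z at h1
      change Hs (f i) h X X * Hs (f i) h Z Z ≤ Hs (f i) h X Z ^ 2 at h2
      rw [div_div_eq_mul_div, le_div_iff₀ h1]
      nlinarith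
    · intro S ⟨i0, hi0⟩ hS
      obtain ⟨j0, hj0⟩ := (Set.ne_univ_iff_exists_notMem S).1 hS
      by_contra hcon
      push Not at hcon
      let a : ι → ℝ := fun i => if hi : p i then (if (⟨i, hi⟩ : {i // p i}) ∈ S then h' i else 0) else 0
      let b : ι → ℝ := fun i => if hi : p i then (if (⟨i, hi⟩ : {i // p i}) ∈ S then 0 else h' i) else 0
      have ha : ∀ i : {i // p i}, a i = if i ∈ S then h' i else 0 := fun i => by simp [a, i.2]
      have hb : ∀ i : {i // p i}, b i = if i ∈ S then 0 else h' i := fun i => by simp [b, i.2]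
      have zero : ∀ i ∈ S, ∀ j ∉ S, Hs v h (e i) (e j) = 0 := by
        intro i hi j hj
        have hne : (i:ι) ≠ j := fun h => hj (by rw [← Subtype.ext h]; exact hi)
        rw [Vi]
        exact (Qoff i j hne).2 (hcon i hi j hj)
      have hab : Hs v h a b = 0 := by
        rw [Vexp']
        refine Finset.sum_eq_zero fun i _ => ?_
        rw [Vs, Vexp', Finset.mul_sum]
        refine Finset.sum_eq_zero fun j _ => ?_
        rw [ha, hb]
        by_cases hi : i ∈ S <;> by_cases hj : j ∈ S <;> simp [hi, hj]
        right; right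
        rw [Vs]; exact zero i hi j hj
      have hsum : ∀ y, Hs v h (a + b) y = Hs v h h' y := by
        intro y
        rw [Vexp', Vexp' h']
        refine Finset.sum_congr rfl fun i _ => ?_
        congr 1
        rw [Pi.add_apply, ha, hb]
        by_cases hi : i ∈ S <;> simp [hi]
      have Vih : ∀ i, Hs v h (e i) h = (n + 2) * f i h := fun i => by
        rw [Vi, Hom.euler g.cone (smf i) (af i).hom hh]; push_cast; ring
      have sumpos : ∀ (c : ι → ℝ), (∀ i : {i // p i}, 0 ≤ c i) → (∃ i : {i // p i}, 0 < c i) → 0 < Hs v h c h := by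
        rintro c hc ⟨i1, hi1⟩
        rw [Vexp']
        refine Finset.sum_pos' (fun i _ => ?_) ⟨i1, Finset.mem_univ _, ?_⟩
        · rw [Vih]; have := hc i; have h2 : 0 < f i h := i.2; positivity
        · rw [Vih]; have h2 : 0 < f i1 h := i1.2; positivity
      have ha1 : Hs v h a h = Hs v h a a := by
        have := hsum a
        rw [Hs_add_left, Vs b a, hab, add_zero, Vs h', Vh'] at this
        exact this.symm
      have hb1 : Hs v h b h = Hs v h b b := by
        have := hsum b
        rw [Hs_add_left, hab, zero_add, Vs h', Vh'] at this
        exact this.symm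
      have hapos : 0 < Hs v h a a := by
        rw [← ha1]
        refine sumpos a (fun i => ?_) ⟨i0, ?_⟩
        · rw [ha]; split_ifs; exacts [(hh'0 i).le, le_rfl]
        · rw [ha, if_pos hi0]; exact hh'0 _
      have hbpos : 0 < Hs v h b b := by
        rw [← hb1]
        refine sumpos b (fun i => ?_) ⟨j0, ?_⟩
        · rw [hb]; split_ifs; exacts [le_rfl, (hh'0 i).le]
        · rw [hb, if_neg hj0]; exact hh'0 _
      have hyp1 := (g.hyp h hh h hh hp).2
      have := hyp_transfer (Hs v h) (Hs_add_left _ _) (Hs_smul_left _ _) Vs h vdeg (by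
        intro x hx
        have h1 := hyp1 x
        change Hs v h x x * Hs v h h h ≤ Hs v h x h ^ 2 at h1
        rw [hx] at h1
        by_contra hcon
        push Not at hcon
        have : 0 < Hs v h x x * Hs v h h h := by positivity
        nlinarith) b hbpos a
      rw [hab] at this
      have : 0 < Hs v h a a * Hs v h b b := by positivity
      nlinarith
    · refine Eq.trans ?_ ((Qexp' x Z).symm.trans hx)
      refine Finset.sum_congr rfl fun i _ => ?_
      have := (hZ'0 i).ne'
      field_simp
  have qadm : 0 < q h := g.adm.D_pos g.cone hh hZ hp
  have qhom : Hom (n+2) C q := Hom.D g.cone sm g.adm.hom Z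
  have Qhh : 0 < Hs q h h h := by
    rw [Hs, Hom.euler g.cone (D_smooth hC smq h) (Hom.D g.cone smq qhom h) hh, Hom.euler g.cone smq qhom hh]
    positivity
  have QZZ : 0 < Hs q h Z Z := by
    by_contra hcon
    push Not at hcon
    have e2 : Hs q h Z Z = ∑ i : {i // p i}, Z' i * Hs q h (e i) Z := by
      rw [← Qexp']
      change D Z (D Z (D Z v)) h = D Z' (D Z (D Z v)) h
      have : ∀ a, D a (D Z (D Z v)) h = D Z (D Z (D a v)) h := fun a => by rw [swap12, swap23]
      rw [this Z']
      exact (D_congr hC (fun y hy => D_congr hC hZ' Z hy) _ hh).symm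
    have hz : ∀ i, ¬ p i := by
      intro i hi
      have : 0 < ∑ i : {i // p i}, Z' i * Hs q h (e i) Z :=
        Finset.sum_pos (fun i _ => mul_pos (hZ'0 i) (QZpos i i.2)) ⟨⟨i, hi⟩, Finset.mem_univ _⟩
      linarith
    rw [Vexp'] at vdeg
    have : IsEmpty {i // p i} := ⟨fun i => hz i i.2⟩
    simp at vdeg
  exact hyp_transfer (Hs q h) (Hs_add_left _ _) (Hs_smul_left _ _) Qs Z QZZ key h Qhh x

theorem Good.mink {u : ι → Eu (n+3)} (g : Good u C) {Z : ι → ℝ} (hZ : Z ∈ C) (hne : (PH u Z).Nonempty)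
    {h h' : ι → ℝ} (hh : h ∈ C) (hh' : h' ∈ C) :
    D Z (vv u) h ^ (1 / ((n + 2 : ℕ) : ℝ)) + D Z (vv u) h' ^ (1 / ((n + 2 : ℕ) : ℝ)) ≤ D Z (vv u) (h + h') ^ (1 / ((n + 2 : ℕ) : ℝ)) := by
  have hpos : ∀ k ∈ C, 0 < vv u k := fun k hk => g.pos hk (g.nonempty_of hk hZ hne)
  refine superadd_of_hyp g.cone (D_smooth g.isOpen g.adm.smooth Z) (Hom.D g.cone g.adm.smooth g.adm.hom Z)
    (fun k hk => g.adm.D_pos g.cone hk hZ (hpos k hk)) (fun k hk x => g.af hZ hk (hpos k hk) x) hh hh'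

end af
end PB

open scoped Pointwise RealInnerProductSpace
open scoped MeasureTheory
open MeasureTheory
namespace PB
set_option linter.unusedSectionVars false
set_option linter.unusedVariables false

section polyt
variable {n : ℕ} {ι : Type} [Fintype ι] [DecidableEq ι]

lemma sep {S : Set (Eu n)} (hc : IsClosed S) (hcv : Convex ℝ S) {x : Eu n} (hx : x ∉ S) :
    ∃ (c : Eu n) (r : ℝ), (∀ s ∈ S, ⟪c, s⟫ < r) ∧ r < ⟪c, x⟫ := by
  obtain ⟨f, r, h1, h2⟩ := geometric_hahn_banach_closed_point hcv hc hx
  refine ⟨(InnerProductSpace.toDual ℝ _).symm f, r, fun s hs => ?_, ?_⟩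
  · rw [InnerProductSpace.toDual_symm_apply]; exact h1 s hs
  · rw [InnerProductSpace.toDual_symm_apply]; exact h2

lemma move {u : ι → Eu n} {h : ι → ℝ} {x d : Eu n} (hx : x ∈ PH u h) (hd : ∀ i, ⟪u i, x⟫ = h i → ⟪u i, d⟫ ≤ 0) :
    ∃ ε : ℝ, 0 < ε ∧ x + ε • d ∈ PH u h := by
  have : ∀ᶠ ε in nhdsWithin (0:ℝ) (Set.Ioi 0), ∀ i, ⟪u i, x + ε • d⟫ ≤ h i := by
    rw [Filter.eventually_all]
    intro i
    by_cases hi : ⟪u i, x⟫ = h i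
    · filter_upwards [self_mem_nhdsWithin] with ε hε
      have hε : 0 < ε := hε
      rw [inner_add_right, inner_smul_right, hi]
      nlinarith [hd i hi]
    · have hlt : ⟪u i, x⟫ < h i := lt_of_le_of_ne (hx i) hi
      have hc : ContinuousAt (fun ε : ℝ => ⟪u i, x + ε • d⟫) 0 := by fun_prop
      have := hc.eventually_lt (g := fun _ => h i) continuousAt_const (by simpa using hlt)
      filter_upwards [this.filter_mono nhdsWithin_le_nhds] with ε hε using hε.le
  obtain ⟨ε, h1, h2⟩ := (this.and self_mem_nhdsWithin).exists
  exact ⟨ε, h2, h1⟩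

lemma ext_active {u : ι → Eu n} {h : ι → ℝ} {x d : Eu n} (hx : x ∈ (PH u h).extremePoints ℝ)
    (hd : ∀ i, ⟪u i, x⟫ = h i → ⟪u i, d⟫ = 0) : d = 0 := by
  obtain ⟨ε, hε, h1⟩ := move hx.1 (d := d) (fun i hi => (hd i hi).le)
  obtain ⟨ε', hε', h2⟩ := move hx.1 (d := -d) (fun i hi => by rw [inner_neg_right, hd i hi]; simp)
  have : x ∈ openSegment ℝ (x + ε • d) (x + ε' • -d) := by
    refine ⟨ε' / (ε + ε'), ε / (ε + ε'), by positivity, by positivity, by field_simp; ring, ?_⟩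
    rw [smul_add, smul_add, smul_smul, smul_smul, smul_neg,
      show ε' / (ε + ε') * ε = ε / (ε + ε') * ε' by ring]
    have : (ε' / (ε + ε')) • x + (ε / (ε + ε')) • x = x := by
      rw [← add_smul]; rw [show ε' / (ε + ε') + ε / (ε + ε') = 1 by field_simp; ring, one_smul]
    nth_rewrite 3 [← this]
    abel
  have h3 := hx.2 h1 h2 this
  have h4 : ε • d = 0 := by simpa using h3
  exact (smul_eq_zero.1 h4).resolve_left hε.ne'

lemma ext_finite (u : ι → Eu n) (h : ι → ℝ) : ((PH u h).extremePoints ℝ).Finite := by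
  refine Set.Finite.of_injOn (f := fun x => {i | ⟪u i, x⟫ = h i}) (t := Set.univ) (fun _ _ => Set.mem_univ _) ?_ Set.finite_univ
  intro x hx y hy hxy
  have := ext_active hx (d := x - y) (fun i hi => by
    have hxy' : {i | ⟪u i, x⟫ = h i} = {i | ⟪u i, y⟫ = h i} := hxy
    have : i ∈ {i | ⟪u i, y⟫ = h i} := by rw [← hxy']; exact hi
    have : ⟪u i, y⟫ = h i := this
    rw [inner_sub_right, hi, this]; simp)
  exact sub_eq_zero.1 this

lemma H_rep (V : Finset (Eu n)) (h0 : (0 : Eu n) ∈ interior (convexHull ℝ (V : Set (Eu n)))) :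
    ∃ (ι : Type) (_ : Fintype ι) (_ : DecidableEq ι) (u : ι → Eu n), convexHull ℝ (V : Set (Eu n)) = PH u 1 := by
  classical
  set P := convexHull ℝ (V : Set (Eu n)) with hP
  have hPc : IsCompact P := Set.Finite.isCompact_convexHull ℝ V.finite_toSet
  have hPcv : Convex ℝ P := convex_convexHull ℝ _
  let a : V → Eu n := fun v => v
  set R := PH a 1 with hR
  have hPR : ∀ y ∈ R, ∀ x ∈ P, ⟪y, x⟫ ≤ 1 := by
    intro y hy x hx
    have hcv : Convex ℝ {x : Eu n | ⟪y, x⟫ ≤ 1} := convex_halfSpace_le (innerₛₗ ℝ y).isLinear 1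
    refine convexHull_min (fun v hv => ?_) hcv hx
    have := hy ⟨v, hv⟩
    rw [Set.mem_ofPred_eq, real_inner_comm]; exact this
  have hRb : Bornology.IsBounded R := by
    obtain ⟨r, hr, hr2⟩ := Metric.isOpen_iff.1 isOpen_interior 0 h0
    refine (isBounded_iff_forall_norm_le).2 ⟨2 / r, fun y hy => ?_⟩
    by_cases hy0 : y = 0
    · rw [hy0]; simp; positivity
    have hyn : 0 < ‖y‖ := norm_pos_iff.2 hy0
    have hm : ((r / 2) / ‖y‖) • y ∈ P := interior_subset (hr2 (by
      rw [mem_ball_zero_iff, norm_smul, norm_div, norm_norm, Real.norm_of_nonneg (by positivity)]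
      field_simp; linarith))
    have := hPR y hy _ hm
    rw [inner_smul_right, real_inner_self_eq_norm_sq] at this
    rw [le_div_iff₀ hr]
    have h2 : r / 2 / ‖y‖ * ‖y‖ ^ 2 = r / 2 * ‖y‖ := by field_simp
    rw [h2] at this; linarith
  have hRc : IsCompact R := Metric.isCompact_of_isClosed_isBounded (PH_closed a 1) hRb
  have hfin := ext_finite a 1
  have hKM : convexHull ℝ (R.extremePoints ℝ) = R := by
    have := closure_convexHull_extremePoints hRc (PH_convex a 1)
    rwa [(Set.Finite.isCompact_convexHull ℝ hfin).isClosed.closure_eq] at this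
  have : Fintype (R.extremePoints ℝ) := hfin.fintype
  refine ⟨R.extremePoints ℝ, inferInstance, inferInstance, fun y => y, ?_⟩
  apply Set.Subset.antisymm
  · intro x hx y
    exact hPR y y.2.1 x hx
  · intro x hx
    by_contra hxP
    obtain ⟨c, r, h1, h2⟩ := sep hPc.isClosed hPcv hxP
    have hr : 0 < r := by simpa using h1 0 (interior_subset h0)
    have hcR : r⁻¹ • c ∈ R := by
      intro v
      have := h1 v (subset_convexHull ℝ _ v.2)
      change ⟪(v : Eu n), _⟫ ≤ 1
      rw [inner_smul_right, real_inner_comm, inv_mul_le_iff₀ hr]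
      simpa using this.le
    rw [← hKM] at hcR
    have hcv : Convex ℝ {y : Eu n | ⟪y, x⟫ ≤ 1} := by
      have : {y : Eu n | ⟪y, x⟫ ≤ 1} = {y : Eu n | ⟪x, y⟫ ≤ 1} := by ext; simp [real_inner_comm]
      rw [this]; exact convex_halfSpace_le (innerₛₗ ℝ x).isLinear 1
    have : ⟪r⁻¹ • c, x⟫ ≤ 1 := convexHull_min (fun y hy => hx ⟨y, hy⟩) hcv hcR
    rw [real_inner_smul_left, inv_mul_le_iff₀ hr] at this
    linarith

/-- vertex data -/
lemma vertex {u : ι → Eu n} {h : ι → ℝ} {x : Eu n} (hx : x ∈ (PH u h).extremePoints ℝ)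
    (hli : LinearIndependent ℝ (fun i : {i // ⟪u i, x⟫ = h i} => u i)) :
    ∃ d : ι → Eu n, (∀ i, ¬ ⟪u i, x⟫ = h i → d i = 0) ∧ (∀ c, c = ∑ i, ⟪d i, c⟫ • u i) ∧
      ∀ i j, ⟪u i, x⟫ = h i → ⟪u j, x⟫ = h j → ⟪d i, u j⟫ = if i = j then 1 else 0 := by
  classical
  have hspan : ⊤ ≤ Submodule.span ℝ (Set.range (fun i : {i // ⟪u i, x⟫ = h i} => u i)) := by
    rw [top_le_iff, ← Submodule.orthogonal_eq_bot_iff, eq_bot_iff]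
    intro d hd
    rw [Submodule.mem_bot]
    refine ext_active hx fun i hi => ?_
    exact hd (u i) (Submodule.subset_span ⟨⟨i, hi⟩, rfl⟩)
  let b := Module.Basis.mk hli hspan
  have hb : ∀ i, b i = u i := fun i => by simp [b]
  let d : ι → Eu n := fun i => if hi : ⟪u i, x⟫ = h i then
    (InnerProductSpace.toDual ℝ _).symm (b.coord ⟨i, hi⟩).toContinuousLinearMap else 0
  have hd : ∀ (i : {i // ⟪u i, x⟫ = h i}) c, ⟪d i, c⟫ = b.coord i c := by
    intro i c
    simp only [d, i.2, dif_pos]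
    rw [InnerProductSpace.toDual_symm_apply]; rfl
  refine ⟨d, fun i hi => by simp [d, hi], fun c => ?_, fun i j hi hj => ?_⟩
  · rw [← Finset.sum_filter_of_ne (p := fun i => ⟪u i, x⟫ = h i) (fun i _ hi => by
      by_contra h2
      apply hi
      simp [d, h2]), ← Finset.sum_subtype_eq_sum_filter]
    rw [← Finset.sum_congr (s₁ := Finset.univ) (by ext; simp) (fun i _ => rfl)]
    conv_lhs => rw [← b.sum_repr c]
    refine Finset.sum_congr rfl fun i _ => ?_
    rw [hd, hb]; rfl
  · rw [hd ⟨i, hi⟩, ← hb ⟨j, hj⟩]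
    simp [Finsupp.single_apply, Subtype.ext_iff, eq_comm]

end polyt
end PB

open scoped Pointwise RealInnerProductSpace
open scoped MeasureTheory
open MeasureTheory
namespace PB
set_option linter.unusedSectionVars false
set_option linter.unusedVariables false

section chamber
variable {n : ℕ} {ι : Type} [Fintype ι] [DecidableEq ι]

/-- for every index subset a null set of right hand sides covers the degenerate ones -/
lemma avoid (u : ι → Eu n) (A : Finset ι) : ∃ N : Set (ι → ℝ), volume N = 0 ∧ ∀ h, h ∉ N →
    ∀ x : Eu n, (∀ i ∈ A, ⟪u i, x⟫ = h i) → LinearIndependent ℝ (fun i : A => u i) := by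
  classical
  by_cases hA : LinearIndependent ℝ (fun i : A => u i)
  · exact ⟨∅, by simp, fun _ _ _ _ => hA⟩
  obtain ⟨g, hg, i0, hi0⟩ := Fintype.not_linearIndependent_iff.1 hA
  let l : (ι → ℝ) →ₗ[ℝ] ℝ := ∑ i : A, g i • LinearMap.proj (i : ι)
  have hl : ∀ h, l h = ∑ i : A, g i * h i := fun h => by simp [l]
  refine ⟨(LinearMap.ker l : Submodule ℝ (ι → ℝ)), ?_, ?_⟩
  · apply Measure.addHaar_submodule
    intro h
    have : Pi.single (i0 : ι) (1:ℝ) ∈ LinearMap.ker l := by rw [h]; trivial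
    rw [LinearMap.mem_ker, hl, Finset.sum_eq_single i0] at this
    · simp at this; exact hi0 this
    · intro b _ hb
      rw [Pi.single_eq_of_ne (fun h => hb (Subtype.ext h)), mul_zero]
    · simp
  · intro h hh x hx
    exfalso
    apply hh
    change h ∈ LinearMap.ker l
    rw [LinearMap.mem_ker, hl]
    have : ⟪∑ i : A, g i • u i, x⟫ = 0 := by rw [hg]; simp
    rw [sum_inner] at this
    rw [← this]
    refine Finset.sum_congr rfl fun i _ => ?_
    rw [real_inner_smul_left, hx i i.2]

lemma close (u : ι → Eu n) (hb : Bornology.IsBounded (PH u 1)) (A : Finset ι)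
    (hA : ¬ ∃ y ∈ PH u 1, ∀ i ∈ A, ⟪u i, y⟫ = 1) :
    ∃ δ : ℝ, 0 < δ ∧ ∀ h : ι → ℝ, (∀ i, |h i - 1| < δ) → (∀ i, h i ≤ 2) →
      ¬ ∃ y ∈ PH u h, ∀ i ∈ A, ⟪u i, y⟫ = h i := by
  have hc2 : IsCompact (PH u ((2:ℝ) • (1 : ι → ℝ))) := by
    rw [PH_smul u 1 two_pos]
    exact (Metric.isCompact_of_isClosed_isBounded (PH_closed u 1) hb).smul _
  let f : Eu n → ℝ := fun x => ∑ i ∈ A, |⟪u i, x⟫ - 1| + ∑ i, max 0 (⟪u i, x⟫ - 1)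
  have hf : Continuous f := by fun_prop
  have h0 : (0 : Eu n) ∈ PH u ((2:ℝ) • (1 : ι → ℝ)) := fun i => by simp
  obtain ⟨x0, hx0, hmin⟩ := hc2.exists_isMinOn ⟨0, h0⟩ hf.continuousOn
  have hpos : 0 < f x0 := by
    have hn : 0 ≤ f x0 := by positivity
    refine lt_of_le_of_ne hn fun he => hA ⟨x0, ?_, ?_⟩
    · intro i
      have h1 : ∑ i, max 0 (⟪u i, x0⟫ - 1) = 0 := by
        have : 0 ≤ ∑ i ∈ A, |⟪u i, x0⟫ - 1| := by positivity
        have : 0 ≤ ∑ i, max 0 (⟪u i, x0⟫ - 1) := by positivity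
        simp only [f] at he; linarith
      have := (Finset.sum_eq_zero_iff_of_nonneg (fun i _ => le_max_left _ _)).1 h1 i (Finset.mem_univ _)
      have h2 := le_max_right 0 (⟪u i, x0⟫ - 1)
      simp only [Pi.one_apply]; linarith
    · intro i hi
      have h1 : ∑ i ∈ A, |⟪u i, x0⟫ - 1| = 0 := by
        have : 0 ≤ ∑ i ∈ A, |⟪u i, x0⟫ - 1| := by positivity
        have : 0 ≤ ∑ i, max 0 (⟪u i, x0⟫ - 1) := by positivity
        simp only [f] at he; linarith
      have := (Finset.sum_eq_zero_iff_of_nonneg (fun i _ => abs_nonneg _)).1 h1 i hi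
      rw [abs_eq_zero] at this; linarith
  refine ⟨f x0 / (2 * Fintype.card ι + 1), by positivity, fun h hh h2 => ?_⟩
  rintro ⟨y, hy, hyA⟩
  have hy2 : y ∈ PH u ((2:ℝ) • (1 : ι → ℝ)) := fun i => by
    simpa using (hy i).trans (h2 i)
  have h3 : f x0 ≤ f y := hmin hy2
  set δ := f x0 / (2 * Fintype.card ι + 1) with hδ
  have hδ0 : 0 < δ := by positivity
  have h4 : ∑ i ∈ A, |⟪u i, y⟫ - 1| ≤ Fintype.card ι * δ := by
    calc _ ≤ ∑ i ∈ A, δ := Finset.sum_le_sum fun i hi => by rw [hyA i hi]; exact (hh i).le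
      _ ≤ ∑ i : ι, δ := Finset.sum_le_sum_of_subset_of_nonneg (Finset.subset_univ _) (fun _ _ _ => hδ0.le)
      _ = _ := by simp
  have h5 : ∑ i, max 0 (⟪u i, y⟫ - 1) ≤ Fintype.card ι * δ := by
    calc _ ≤ ∑ i : ι, δ := Finset.sum_le_sum fun i hi => by
            apply max_le hδ0.le
            have := hy i
            have := (abs_lt.1 (hh i)).2
            linarith
      _ = _ := by simp
  have h6 : f y ≤ 2 * Fintype.card ι * δ := by simp only [f]; linarith
  have h7 : f x0 = (2 * Fintype.card ι + 1) * δ := by rw [hδ]; field_simp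
  linarith

lemma generic (u : ι → Eu n) (hb : Bornology.IsBounded (PH u 1)) {η : ℝ} (hη : 0 < η) :
    ∃ h : ι → ℝ, (∀ i, |h i - 1| < η) ∧ (∀ i, 0 < h i) ∧ (∀ i, h i ≤ 2) ∧
      (∀ x : Eu n, LinearIndependent ℝ (fun i : {i // ⟪u i, x⟫ = h i} => u i)) ∧
      (∀ x ∈ PH u h, ∃ y ∈ PH u 1, ∀ i, ⟪u i, x⟫ = h i → ⟪u i, y⟫ = 1) := by
  classical
  have hcl : ∀ A : Finset ι, ∃ δ : ℝ, 0 < δ ∧ ((¬ ∃ y ∈ PH u 1, ∀ i ∈ A, ⟪u i, y⟫ = 1) → 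
      ∀ h : ι → ℝ, (∀ i, |h i - 1| < δ) → (∀ i, h i ≤ 2) →
      ¬ ∃ y ∈ PH u h, ∀ i ∈ A, ⟪u i, y⟫ = h i) := by
    intro A
    by_cases hA : ∃ y ∈ PH u 1, ∀ i ∈ A, ⟪u i, y⟫ = 1
    · exact ⟨1, one_pos, fun h => absurd hA h⟩
    · obtain ⟨δ, h1, h2⟩ := close u hb A hA
      exact ⟨δ, h1, fun _ => h2⟩
  choose δ hδ hδ2 using hcl
  choose N hN hN2 using avoid u
  have hmin : ∃ r : ℝ, 0 < r ∧ r ≤ 1 ∧ r ≤ η ∧ ∀ A, r ≤ δ A := by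
    have hne : (Finset.univ : Finset (Finset ι)).Nonempty := ⟨∅, Finset.mem_univ _⟩
    refine ⟨min (min 1 η) (Finset.univ.inf' hne δ), ?_, (min_le_left _ _).trans (min_le_left _ _), (min_le_left _ _).trans (min_le_right _ _), fun A => (min_le_right _ _).trans (Finset.inf'_le _ (Finset.mem_univ A))⟩
    rw [lt_min_iff, lt_min_iff, Finset.lt_inf'_iff]
    exact ⟨⟨one_pos, hη⟩, fun A _ => hδ A⟩
  obtain ⟨r, hr, hr1, hrη, hrδ⟩ := hmin
  have hnull : volume (⋃ A, N A) = 0 := measure_iUnion_null hN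
  have hball : 0 < volume (Metric.ball (1 : ι → ℝ) r) := Metric.measure_ball_pos _ _ hr
  have : ∃ h ∈ Metric.ball (1 : ι → ℝ) r, h ∉ ⋃ A, N A := by
    by_contra hcon
    push Not at hcon
    exact absurd (measure_mono_null hcon hnull) hball.ne'
  obtain ⟨h, hh, hhN⟩ := this
  have hd : ∀ i, |h i - 1| < r := fun i => by
    have := (dist_pi_lt_iff hr).1 (Metric.mem_ball.1 hh) i
    simpa [Real.dist_eq] using this
  have hle2 : ∀ i, h i ≤ 2 := fun i => by have := (abs_lt.1 (hd i)).2; linarith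
  refine ⟨h, fun i => (hd i).trans_le hrη, fun i => ?_, hle2, fun x => ?_, fun x hx => ?_⟩
  · have := (abs_lt.1 (hd i)).1; linarith
  · have := hN2 (Finset.univ.filter fun i => ⟪u i, x⟫ = h i) h (fun hc => hhN (Set.mem_iUnion.2 ⟨_, hc⟩)) x (by simp)
    refine (linearIndependent_equiv' (Equiv.subtypeEquivRight (by simp)) ?_).1 this
    rfl
  · by_contra hcon
    refine hδ2 (Finset.univ.filter fun i => ⟪u i, x⟫ = h i) ?_ h (fun i => (hd i).trans_le (hrδ _)) hle2 ⟨x, hx, by simp⟩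
    rintro ⟨y, hy, hy2⟩
    exact hcon ⟨y, hy, fun i hi => hy2 i (by simpa using hi)⟩

end chamber
end PB

open scoped Pointwise RealInnerProductSpace
open scoped MeasureTheory
open MeasureTheory
namespace PB
set_option linter.unusedSectionVars false
set_option linter.unusedVariables false

section chamber
variable {n : ℕ} {ι : Type} [Fintype ι] [DecidableEq ι]

lemma chamber (u : ι → Eu n) (hb : Bornology.IsBounded (PH u 1)) {η : ℝ} (hη : 0 < η) :
    ∃ (h0 : ι → ℝ) (CW C : Set (ι → ℝ)), (∀ i, |h0 i - 1| < η) ∧ (∀ i, 0 < h0 i) ∧ Good u C ∧ h0 ∈ C ∧ C ⊆ CW ∧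
      (∀ h ∈ CW, ∀ h' ∈ C, h + h' ∈ C) ∧
      (∀ h ∈ CW, ∀ h' ∈ CW, PH u (h + h') ⊆ PH u h + PH u h') ∧
      (∀ (K : Set (Eu n)) (hK : ι → ℝ), IsCompact K → Convex ℝ K → (∀ x ∈ K, ∀ i, ⟪u i, x⟫ ≤ hK i) →
        (∀ y ∈ PH u 1, ∃ k ∈ K, ∀ i, ⟪u i, y⟫ = 1 → ⟪u i, k⟫ = hK i) → hK ∈ CW ∧ PH u hK = K) := by
  classical
  obtain ⟨h0, h0η, h0p, h02, hLI, hcl⟩ := generic u hb hη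
  set P := PH u h0 with hP
  have hPb : Bornology.IsBounded P := by
    have : P ⊆ PH u ((2:ℝ) • (1 : ι → ℝ)) := fun x hx i => by simpa using (hx i).trans (h02 i)
    refine Bornology.IsBounded.subset ?_ this
    rw [PH_smul u 1 two_pos]
    exact hb.smul₀ _
  have hPc : IsCompact P := Metric.isCompact_of_isClosed_isBounded (PH_closed u h0) hPb
  have hP0 : (0 : Eu n) ∈ P := fun i => by simpa using (h0p i).le
  set E := P.extremePoints ℝ with hE
  have hEf : E.Finite := ext_finite u h0
  have hd : ∀ x : Eu n, ∃ d : ι → Eu n, x ∈ E → (∀ i, ¬ ⟪u i, x⟫ = h0 i → d i = 0) ∧ (∀ c, c = ∑ i, ⟪d i, c⟫ • u i) ∧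
      ∀ i j, ⟪u i, x⟫ = h0 i → ⟪u j, x⟫ = h0 j → ⟪d i, u j⟫ = if i = j then 1 else 0 := by
    intro x
    by_cases hx : x ∈ E
    · obtain ⟨d, h⟩ := vertex hx (hLI x)
      exact ⟨d, fun _ => h⟩
    · exact ⟨0, fun h => absurd h hx⟩
  choose d hd using hd
  let X : Eu n → (ι → ℝ) → Eu n := fun x h => ∑ i, h i • d x i
  have Xadd : ∀ x h h', X x (h + h') = X x h + X x h' := fun x h h' => by
    simp [X, add_smul, Finset.sum_add_distrib]
  have Xsmul : ∀ x (t : ℝ) h, X x (t • h) = t • X x h := fun x t h => by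
    simp [X, mul_smul, Finset.smul_sum]
  have Xc : ∀ x, Continuous (X x) := fun x => by simp only [X]; fun_prop
  have Xact : ∀ x ∈ E, ∀ h i, ⟪u i, x⟫ = h0 i → ⟪u i, X x h⟫ = h i := by
    intro x hx h i hi
    simp only [X, inner_sum, inner_smul_right]
    rw [Finset.sum_eq_single i]
    · rw [real_inner_comm, (hd x hx).2.2 i i hi hi]; simp
    · intro j _ hj
      by_cases hj2 : ⟪u j, x⟫ = h0 j
      · rw [real_inner_comm, (hd x hx).2.2 j i hj2 hi, if_neg hj, mul_zero]
      · rw [(hd x hx).1 j hj2]; simp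
    · simp
  have Xuniq : ∀ x ∈ E, ∀ h y, (∀ i, ⟪u i, x⟫ = h0 i → ⟪u i, y⟫ = h i) → y = X x h := by
    intro x hx h y hy
    refine sub_eq_zero.1 (ext_active hx fun i hi => ?_)
    rw [inner_sub_right, hy i hi, Xact x hx h i hi, sub_self]
  have cover : ∀ c : Eu n, ∃ x ∈ E, ∀ i, 0 ≤ ⟪d x i, c⟫ := by
    intro c
    obtain ⟨z, hz, hzm⟩ := hPc.exists_isMaxOn ⟨0, hP0⟩ (f := fun y => ⟪c, y⟫) (by fun_prop)
    let l : StrongDual ℝ (Eu n) := innerSL ℝ c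
    have hF : IsExposed ℝ P (l.toExposed P) := ContinuousLinearMap.toExposed.isExposed
    have hFc := hF.isCompact hPc
    have hne : (l.toExposed P).Nonempty := ⟨z, hz, fun y hy => hzm hy⟩
    obtain ⟨x, hx⟩ := hFc.extremePoints_nonempty hne
    have hxE : x ∈ E := hF.isExtreme.extremePoints_subset_extremePoints hx
    refine ⟨x, hxE, fun i => ?_⟩
    by_contra hneg
    push Not at hneg
    have hact : ⟪u i, x⟫ = h0 i := by
      by_contra h
      rw [(hd x hxE).1 i h] at hneg; simp at hneg
    obtain ⟨ε, hε, hm⟩ := move hxE.1 (d := - d x i) (fun j hj => by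
      rw [inner_neg_right, real_inner_comm, (hd x hxE).2.2 i j hact hj]; split_ifs <;> simp)
    have h1 : ⟪c, x + ε • -d x i⟫ ≤ ⟪c, x⟫ := hx.1.2 _ hm
    rw [inner_add_right, inner_smul_right, inner_neg_right, real_inner_comm (d x i) c] at h1
    have : 0 < ε * -⟪d x i, c⟫ := by apply mul_pos hε; linarith
    linarith
  have bound : ∀ c : Eu n, ∃ x ∈ E, ∀ h, ∀ y ∈ PH u h, ⟪c, y⟫ ≤ ⟪c, X x h⟫ := by
    intro c
    obtain ⟨x, hx, hx2⟩ := cover c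
    refine ⟨x, hx, fun h y hy => ?_⟩
    have h1 : ⟪c, y⟫ = ∑ i, ⟪d x i, c⟫ * ⟪u i, y⟫ := by
      conv_lhs => rw [(hd x hx).2.1 c]
      rw [sum_inner]
      simp only [real_inner_smul_left]
    rw [h1]
    simp only [X, inner_sum, inner_smul_right]
    refine Finset.sum_le_sum fun i _ => ?_
    rw [real_inner_comm (d x i) c, mul_comm]
    exact mul_le_mul_of_nonneg_right (hy i) (hx2 i)
  have bdd : ∀ h, Bornology.IsBounded (PH u h) := by
    intro h
    refine (isBounded_iff_forall_norm_le).2 ⟨∑ x ∈ hEf.toFinset, ‖X x h‖, fun y hy => ?_⟩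
    obtain ⟨x, hx, hx2⟩ := bound y
    have h1 := hx2 h y hy
    rw [real_inner_self_eq_norm_sq] at h1
    have h2 := real_inner_le_norm y (X x h)
    have h3 : ‖X x h‖ ≤ ∑ x ∈ hEf.toFinset, ‖X x h‖ :=
      Finset.single_le_sum (f := fun x => ‖X x h‖) (fun _ _ => norm_nonneg _) (hEf.mem_toFinset.2 hx)
    refine le_trans ?_ h3
    by_contra hlt
    push Not at hlt
    nlinarith [norm_nonneg (X x h)]
  have cpt : ∀ h, IsCompact (PH u h) := fun h => Metric.isCompact_of_isClosed_isBounded (PH_closed u h) (bdd h)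
  let CW : Set (ι → ℝ) := {h | ∀ x ∈ E, X x h ∈ PH u h}
  let C : Set (ι → ℝ) := {h | ∀ x ∈ E, ∀ k, ¬ ⟪u k, x⟫ = h0 k → ⟪u k, X x h⟫ < h k}
  have hCCW : C ⊆ CW := by
    intro h hh x hx k
    by_cases hk : ⟪u k, x⟫ = h0 k
    · exact (Xact x hx h k hk).le
    · exact (hh x hx k hk).le
  have hadd : ∀ h ∈ CW, ∀ h' ∈ CW, PH u (h + h') ⊆ PH u h + PH u h' := by
    intro h hh h' hh' z hz
    by_contra hcon
    obtain ⟨c, r, h1, h2⟩ := sep ((cpt h).add (cpt h')).isClosed ((PH_convex u h).add (PH_convex u h')) hcon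
    obtain ⟨x, hx, hx2⟩ := bound c
    have h3 := hx2 _ z hz
    rw [Xadd] at h3
    have h4 := h1 _ (Set.add_mem_add (hh x hx) (hh' x hx))
    linarith
  have hsum : ∀ h ∈ CW, ∀ h' ∈ C, h + h' ∈ C := by
    intro h hh h' hh' x hx k hk
    rw [Xadd, inner_add_right, Pi.add_apply]
    exact add_lt_add_of_le_of_lt (hh x hx k) (hh' x hx k hk)
  refine ⟨h0, CW, C, h0η, h0p, ⟨?_, fun h hh h' hh' => hsum h (hCCW hh) h' hh', ?_, fun h _ => bdd h,
    fun h hh h' hh' => hadd h (hCCW hh) h' (hCCW hh')⟩, ?_, hCCW, hsum, hadd, ?_⟩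
  · have : C = ⋂ x ∈ E, ⋂ k, ⋂ (_ : ¬ ⟪u k, x⟫ = h0 k), {h | ⟪u k, X x h⟫ < h k} := by
      ext h; simp [C]
    rw [this]
    refine hEf.isOpen_biInter fun x hx => isOpen_iInter_of_finite fun k => isOpen_iInter_of_finite fun _ => ?_
    exact isOpen_lt (continuous_const.inner (Xc x)) (continuous_apply k)
  · intro t ht h hh x hx k hk
    rw [Xsmul, inner_smul_right, Pi.smul_apply, smul_eq_mul]
    exact mul_lt_mul_of_pos_left (hh x hx k hk) ht
  · intro x hx k hk
    rw [← Xuniq x hx h0 x (fun i hi => hi)]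
    exact lt_of_le_of_ne (hx.1 k) hk
  · intro K hK hKc hKcv hle hface
    have hXK : ∀ x ∈ E, X x hK ∈ K := by
      intro x hx
      obtain ⟨y, hy, hy2⟩ := hcl x hx.1
      obtain ⟨k, hk, hk2⟩ := hface y hy
      rw [← Xuniq x hx hK k (fun i hi => hk2 i (hy2 i hi))]
      exact hk
    refine ⟨fun x hx => fun i => hle _ (hXK x hx) i, ?_⟩
    apply Set.Subset.antisymm
    · intro z hz
      by_contra hcon
      obtain ⟨c, r, h1, h2⟩ := sep hKc.isClosed hKcv hcon
      obtain ⟨x, hx, hx2⟩ := bound c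
      have := hx2 _ z hz
      have := h1 _ (hXK x hx)
      linarith
    · exact fun x hx i => hle x hx i

end chamber
end PB

open scoped Pointwise RealInnerProductSpace
open scoped MeasureTheory
open MeasureTheory
namespace PB
set_option linter.unusedSectionVars false
set_option linter.unusedVariables false

lemma mem_face {n : ℕ} {ι : Type} {u : ι → Eu n} {S T : Set (Eu n)} (hS : IsCompact S)
    (hS0 : S.Nonempty) (h : S + T = PH u 1) :
    ∃ hS : ι → ℝ, (∀ x ∈ S, ∀ i, ⟪u i, x⟫ ≤ hS i) ∧
      (∀ y ∈ PH u 1, ∃ k ∈ S, ∀ i, ⟪u i, y⟫ = 1 → ⟪u i, k⟫ = hS i) := by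
  have : ∀ i, ∃ m ∈ S, ∀ x ∈ S, ⟪u i, x⟫ ≤ ⟪u i, m⟫ := fun i => by
    obtain ⟨m, hm, hm2⟩ := hS.exists_isMaxOn hS0 (f := fun y => ⟪u i, y⟫) (by fun_prop)
    exact ⟨m, hm, fun x hx => hm2 hx⟩
  choose m hm hm2 using this
  refine ⟨fun i => ⟪u i, m i⟫, fun x hx i => hm2 i x hx, fun y hy => ?_⟩
  rw [← h] at hy
  obtain ⟨k, hk, t, ht, rfl⟩ := hy
  refine ⟨k, hk, fun i hi => le_antisymm (hm2 i k hk) ?_⟩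
  have h1 : m i + t ∈ PH u 1 := by rw [← h]; exact Set.add_mem_add (hm i) ht
  have h2 := h1 i
  rw [inner_add_right] at hi h2
  simp only [Pi.one_apply] at h2
  linarith

lemma poly_mink {n : ℕ} (VK VL VZ : Finset (Eu (n+3))) (K L Z : Set (Eu (n+3)))
    (hK : K = convexHull ℝ (VK : Set (Eu (n+3)))) (hL : L = convexHull ℝ (VL : Set (Eu (n+3))))
    (hZ : Z = convexHull ℝ (VZ : Set (Eu (n+3)))) (hK0 : (0 : Eu (n+3)) ∈ K) (hL0 : (0 : Eu (n+3)) ∈ L)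
    (hZ0 : (0 : Eu (n+3)) ∈ interior Z) :
    ∃ P : Set (Eu (n+3)), IsCompact P ∧ Convex ℝ P ∧ (0 : Eu (n+3)) ∈ P ∧ ∀ ε : ℝ, 0 < ε →
      ∃ wK wL wM : ℝ,
        HasDerivWithinAt (fun t : ℝ => volume.real ((K + ε • P) + t • (Z + ε • P))) wK (Set.Ici 0) 0 ∧
        HasDerivWithinAt (fun t : ℝ => volume.real ((L + ε • P) + t • (Z + ε • P))) wL (Set.Ici 0) 0 ∧
        HasDerivWithinAt (fun t : ℝ => volume.real (((K + ε • P) + (L + ε • P)) + t • (Z + ε • P))) wM (Set.Ici 0) 0 ∧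
        wK ^ (1/((n+2:ℕ):ℝ)) + wL ^ (1/((n+2:ℕ):ℝ)) ≤ wM ^ (1/((n+2:ℕ):ℝ)) := by
  classical
  have cK : IsCompact K := hK ▸ Set.Finite.isCompact_convexHull ℝ VK.finite_toSet
  have cL : IsCompact L := hL ▸ Set.Finite.isCompact_convexHull ℝ VL.finite_toSet
  have cZ : IsCompact Z := hZ ▸ Set.Finite.isCompact_convexHull ℝ VZ.finite_toSet
  have vK : Convex ℝ K := hK ▸ convex_convexHull ℝ _
  have vL : Convex ℝ L := hL ▸ convex_convexHull ℝ _
  have vZ : Convex ℝ Z := hZ ▸ convex_convexHull ℝ _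
  have hsum : convexHull ℝ ((VK + VL + VZ : Finset (Eu (n+3))) : Set (Eu (n+3))) = K + L + Z := by
    rw [Finset.coe_add, Finset.coe_add, convexHull_add, convexHull_add, hK, hL, hZ]
  have h_int0 : (0 : Eu (n+3)) ∈ interior (convexHull ℝ ((VK + VL + VZ : Finset (Eu (n+3))) : Set (Eu (n+3)))) := by
    rw [hsum]
    refine interior_mono ?_ hZ0
    intro z hz
    exact ⟨0, ⟨0, hK0, 0, hL0, by simp⟩, z, hz, by simp⟩
  obtain ⟨ι, _, _, u, hu⟩ := H_rep _ h_int0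
  have hb : Bornology.IsBounded (PH u 1) := by
    rw [← hu, hsum]; exact ((cK.add cL).add cZ).isBounded
  obtain ⟨h0, CW, C, h0η, h0p, good, h0C, hCCW, hadd, haddP, hrec⟩ := chamber u hb one_pos
  rw [hu] at hsum
  obtain ⟨a, ha1, ha2⟩ := mem_face (u := u) (S := K) (T := L + Z) cK ⟨_, hK0⟩ (by rw [hsum]; abel)
  obtain ⟨b, hb1, hb2⟩ := mem_face (u := u) (S := L) (T := K + Z) cL ⟨_, hL0⟩ (by rw [hsum]; abel)
  obtain ⟨c, hc1, hc2⟩ := mem_face (u := u) (S := Z) (T := K + L) cZ ⟨_, interior_subset hZ0⟩ (by rw [hsum]; abel)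
  obtain ⟨aC, aK⟩ := hrec K a cK vK ha1 ha2
  obtain ⟨bC, bL⟩ := hrec L b cL vL hb1 hb2
  obtain ⟨cC, cZ'⟩ := hrec Z c cZ vZ hc1 hc2
  have padd : ∀ h ∈ CW, ∀ h' ∈ CW, PH u (h + h') = PH u h + PH u h' := fun h hh h' hh' =>
    Set.Subset.antisymm (haddP h hh h' hh') (by rintro _ ⟨x, hx, y, hy, rfl⟩; exact PH_add hx hy)
  refine ⟨PH u h0, good.compact h0C, PH_convex u h0, fun i => by simpa using (h0p i).le, fun ε hε => ?_⟩
  have hε0 : ε • h0 ∈ C := good.smul ε hε h0 h0C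
  have key : ∀ h ∈ CW, h + ε • h0 ∈ C ∧ PH u (h + ε • h0) = PH u h + ε • PH u h0 := fun h hh =>
    ⟨hadd h hh _ hε0, by rw [padd h hh _ (hCCW hε0), PH_smul u h0 hε]⟩
  obtain ⟨a1, a2⟩ := key a aC
  obtain ⟨b1, b2⟩ := key b bC
  obtain ⟨c1, c2⟩ := key c cC
  rw [aK] at a2
  rw [bL] at b2
  rw [cZ'] at c2
  have ab2 : PH u ((a + ε • h0) + (b + ε • h0)) = (K + ε • PH u h0) + (L + ε • PH u h0) := by
    rw [padd _ (hCCW a1) _ (hCCW b1), a2, b2]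
  have der : ∀ h ∈ C, HasDerivWithinAt (fun t : ℝ => volume.real (PH u h + t • (Z + ε • PH u h0))) (D (c + ε • h0) (vv u) h) (Set.Ici 0) 0 := by
    intro h hh
    have h1 : HasDerivAt (fun t : ℝ => vv u (h + t • (c + ε • h0))) _ 0 := D_deriv good.isOpen good.adm.smooth (by simpa using hh)
    have h2 := h1.hasDerivWithinAt (s := Set.Ici 0)
    rw [zero_smul, add_zero] at h2
    refine h2.congr_of_mem ?_ (Set.mem_Ici.2 le_rfl)
    intro t ht
    have ht : 0 ≤ t := ht
    simp only [vv]
    congr 1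
    rcases ht.eq_or_lt with rfl | ht
    · have hne : (Z + ε • PH u h0).Nonempty := by
        rw [← c2]
        exact ⟨0, fun i => by
          have : 0 ≤ c i := by simpa using hc1 0 (interior_subset hZ0) i
          have := mul_pos hε (h0p i)
          simp; linarith⟩
      simp [Set.zero_smul_set hne]
    · rw [padd _ (hCCW hh) _ (hCCW (good.smul t ht _ c1)), PH_smul u _ ht, c2]
  refine ⟨_, _, _, ?_, ?_, ?_, good.mink c1 ?_ a1 b1⟩
  · rw [← a2]; exact der _ a1
  · rw [← b2]; exact der _ b1
  · rw [← ab2]; exact der _ (good.add _ a1 _ b1)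
  · rw [c2]; exact ⟨0, 0, interior_subset hZ0, 0, ⟨0, fun i => by simpa using (h0p i).le, by simp⟩, by simp⟩

end PB

open scoped Pointwise RealInnerProductSpace
open scoped MeasureTheory
open MeasureTheory
namespace PB
set_option linter.unusedSectionVars false
set_option linter.unusedVariables false

/-- volume increase when adding a segment -/
noncomputable def AA {n : ℕ} (K : Set (Eu n)) (w : Eu n) : ℝ :=
  volume.real (K + segment ℝ 0 w) - volume.real K

/-- shadow of a set in direction `e` -/
def pr {n : ℕ} (e : Eu (n+1)) (J : Eu n →ₗᵢ[ℝ] Eu (n+1)) (K : Set (Eu (n+1))) : Set (Eu n) :=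
  {y | ∃ s : ℝ, s • e + J y ∈ K}

lemma seg_compact {n : ℕ} (w : Eu n) : IsCompact (segment ℝ 0 w) := by
  rw [segment_eq_image]
  exact isCompact_Icc.image (by fun_prop)

lemma mem_seg0 {n : ℕ} {w x : Eu n} : x ∈ segment ℝ 0 w ↔ ∃ t : ℝ, 0 ≤ t ∧ t ≤ 1 ∧ x = t • w := by
  rw [segment_eq_image]
  constructor
  · rintro ⟨t, ht, rfl⟩
    exact ⟨t, ht.1, ht.2, by simp⟩
  · rintro ⟨t, h0, h1, rfl⟩
    exact ⟨t, ⟨h0, h1⟩, by simp⟩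

lemma zero_mem_seg {n : ℕ} (w : Eu n) : (0 : Eu n) ∈ segment ℝ 0 w := left_mem_segment ℝ 0 w

lemma seg_smul {n : ℕ} (c : ℝ) (w : Eu n) : segment ℝ 0 (c • w) = c • segment ℝ 0 w := by
  ext x
  rw [mem_seg0, Set.mem_smul_set]
  constructor
  · rintro ⟨t, h0, h1, rfl⟩
    exact ⟨t • w, mem_seg0.2 ⟨t, h0, h1, rfl⟩, by rw [smul_comm]⟩
  · rintro ⟨y, hy, rfl⟩
    obtain ⟨t, h0, h1, rfl⟩ := mem_seg0.1 hy
    exact ⟨t, h0, h1, by rw [smul_comm]⟩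

section
variable {n : ℕ} {e : Eu (n+1)} {J : Eu n →ₗᵢ[ℝ] Eu (n+1)} {K : Set (Eu (n+1))}

lemma pr_eq (he : ‖e‖ = 1) (h1 : ∀ y, ⟪J y, e⟫ = 0) (h2 : ∀ x, ∃ y, x = ⟪x, e⟫ • e + J y) :
    pr e J K = (ContinuousLinearMap.adjoint J.toContinuousLinearMap) '' K := by
  have hJe : ContinuousLinearMap.adjoint J.toContinuousLinearMap e = 0 := by
    refine ext_inner_left ℝ fun y => ?_
    rw [ContinuousLinearMap.adjoint_inner_right]
    simpa using h1 y
  have hJJ : ∀ y, ContinuousLinearMap.adjoint J.toContinuousLinearMap (J y) = y := fun y => by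
    refine ext_inner_left ℝ fun z => ?_
    rw [ContinuousLinearMap.adjoint_inner_right]
    simp
  ext y
  constructor
  · rintro ⟨s, hs⟩
    exact ⟨_, hs, by rw [map_add, map_smul, hJe, hJJ]; simp⟩
  · rintro ⟨x, hx, rfl⟩
    obtain ⟨y, hy⟩ := h2 x
    refine ⟨⟪x, e⟫, ?_⟩
    have : ContinuousLinearMap.adjoint J.toContinuousLinearMap x = y := by
      rw [hy, map_add, map_smul, hJe, hJJ]; simp
    rw [this, ← hy]; exact hx

lemma interval_add {I : Set ℝ} (hc : IsCompact I) (hcv : Convex ℝ I) (h0 : I.Nonempty) {t : ℝ} (ht : 0 ≤ t) :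
    volume (I + Set.Icc 0 t) = volume I + ENNReal.ofReal t := by
  obtain ⟨a, b, rfl⟩ : ∃ a b, I = Set.Icc a b :=
    ⟨_, _, eq_Icc_of_connected_compact ⟨h0, hcv.isPreconnected⟩ hc⟩
  rw [Set.nonempty_Icc] at h0
  rw [Set.Icc_add_Icc h0 ht, Real.volume_Icc, Real.volume_Icc, ← ENNReal.ofReal_add (by linarith) ht]
  congr 1; ring

lemma fub (hm : MeasurePreserving (fun p:ℝ×Eu n => p.1•e+J p.2) (volume.prod volume) volume)
    {S : Set (Eu (n+1))} (hS : MeasurableSet S) :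
    Measurable (fun y : Eu n => volume {s : ℝ | s • e + J y ∈ S}) ∧
    volume S = ∫⁻ y : Eu n, volume {s : ℝ | s • e + J y ∈ S} := by
  have hms := hm.measurable hS
  constructor
  · exact measurable_measure_prodMk_right hms
  · rw [← hm.measure_preimage hS.nullMeasurableSet, Measure.prod_apply_symm hms]
    rfl

lemma AA_formula (he : ‖e‖ = 1) (h1 : ∀ y, ⟪J y, e⟫ = 0) (h2 : ∀ x, ∃ y, x = ⟪x, e⟫ • e + J y)
    (hm : MeasurePreserving (fun p:ℝ×Eu n => p.1•e+J p.2) (volume.prod volume) volume)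
    (hK : IsCompact K) (hKc : Convex ℝ K) {t : ℝ} (ht : 0 ≤ t) :
    AA K (t • e) = t * volume.real (pr e J K) := by
  have cpr : IsCompact (pr e J K) := by
    rw [pr_eq he h1 h2]; exact hK.image (ContinuousLinearMap.continuous _)
  have hS : IsCompact (K + segment ℝ 0 (t • e)) := hK.add (seg_compact _)
  obtain ⟨m1, f1⟩ := fub hm hK.measurableSet
  obtain ⟨m2, f2⟩ := fub hm hS.measurableSet
  have hfib : ∀ y, volume {s : ℝ | s • e + J y ∈ K + segment ℝ 0 (t • e)} =
      volume {s : ℝ | s • e + J y ∈ K} + (pr e J K).indicator (fun _ => ENNReal.ofReal t) y := by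
    intro y
    have hset : {s : ℝ | s • e + J y ∈ K + segment ℝ 0 (t • e)} = {s : ℝ | s • e + J y ∈ K} + Set.Icc 0 t := by
      ext s
      constructor
      · rintro ⟨k, hk, z, hz, hkz⟩
        obtain ⟨r, hr0, hr1, rfl⟩ := mem_seg0.1 hz
        refine ⟨s - r * t, ?_, r * t, ⟨by positivity, by nlinarith⟩, by simp⟩
        change (s - r * t) • e + J y ∈ K
        have : (s - r * t) • e + J y = k := by
          have hkz : k + r • t • e = s • e + J y := hkz
          rw [sub_smul, mul_smul, eq_comm, ← sub_eq_zero]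
          rw [← sub_eq_zero] at hkz
          rw [← hkz]; abel
        rw [this]; exact hk
      · rintro ⟨s', hs', r, hr, rfl⟩
        refine ⟨_, hs', r • e, ?_, ?_⟩
        · rw [mem_seg0]
          rcases ht.eq_or_lt with h | h
          · rw [← h] at hr ⊢
            obtain rfl : r = 0 := le_antisymm hr.2 hr.1
            exact ⟨0, le_rfl, zero_le_one, by simp⟩
          · refine ⟨r / t, by have := hr.1; positivity, by rw [div_le_one h]; exact hr.2, ?_⟩
            rw [smul_smul, div_mul_cancel₀ _ h.ne']
        · change s' • e + J y + r • e = (s' + r) • e + J y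
          rw [add_smul]; abel
    rw [hset]
    by_cases hy : y ∈ pr e J K
    · rw [Set.indicator_of_mem hy]
      have hcont : Continuous (fun s : ℝ => s • e + J y) := by fun_prop
      refine interval_add ?_ ?_ hy ht
      · have hiso : Topology.IsClosedEmbedding (fun s : ℝ => s • e + J y) := by
          refine Isometry.isClosedEmbedding (Isometry.of_dist_eq fun a b => ?_)
          rw [dist_eq_norm, dist_eq_norm, add_sub_add_right_eq_sub, ← sub_smul, norm_smul, he, mul_one]
        exact hiso.isCompact_preimage hK
      · intro a ha b hb p q hp hq hpq
        change (p • a + q • b) • e + J y ∈ K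
        have := hKc ha hb hp hq hpq
        convert this using 1
        have h3 : J y = p • J y + q • J y := by rw [← add_smul, hpq, one_smul]
        conv_lhs => rw [h3]
        simp only [smul_add, add_smul, smul_smul, smul_eq_mul]; abel
    · rw [Set.indicator_of_notMem hy]
      have : {s : ℝ | s • e + J y ∈ K} = ∅ := by
        ext s; simp only [Set.mem_ofPred_eq, Set.mem_empty_iff_false, iff_false]
        exact fun h => hy ⟨s, h⟩
      rw [this]; simp
  have hv : volume (K + segment ℝ 0 (t • e)) = volume K + ENNReal.ofReal t * volume (pr e J K) := by
    rw [f2, f1, lintegral_congr hfib, lintegral_add_left m1, lintegral_indicator cpr.measurableSet]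
    simp
  rw [AA, Measure.real, Measure.real, hv, ENNReal.toReal_add hK.measure_lt_top.ne
    (ENNReal.mul_ne_top ENNReal.ofReal_ne_top cpr.measure_lt_top.ne), ENNReal.toReal_mul, ENNReal.toReal_ofReal ht]
  simp [Measure.real]

end

lemma framed {n : ℕ} (w : Eu (n+1)) : ∃ (e : Eu (n+1)) (J : Eu n →ₗᵢ[ℝ] Eu (n+1)), w = ‖w‖ • e ∧ ‖e‖ = 1 ∧
    (∀ y, ⟪J y, e⟫ = 0) ∧ (∀ x, ∃ y, x = ⟪x, e⟫ • e + J y) ∧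
    MeasurePreserving (fun p:ℝ×Eu n => p.1•e+J p.2) (volume.prod volume) volume := by
  have : ∃ e : Eu (n+1), w = ‖w‖ • e ∧ ‖e‖ = 1 := by
    by_cases hw : w = 0
    · obtain ⟨e, he⟩ := exists_norm_eq (Eu (n+1)) zero_le_one
      exact ⟨e, by simp [hw], he⟩
    · have : ‖w‖ ≠ 0 := norm_ne_zero_iff.2 hw
      exact ⟨‖w‖⁻¹ • w, by rw [smul_smul, mul_inv_cancel₀ this, one_smul], by
        rw [norm_smul, norm_inv, norm_norm, inv_mul_cancel₀ this]⟩
  obtain ⟨e, h1, h2⟩ := this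
  obtain ⟨J, h3⟩ := frame e h2
  exact ⟨e, J, h1, h2, h3⟩

lemma AA_w {n : ℕ} (w : Eu (n+1)) : ∃ (e : Eu (n+1)) (J : Eu n →ₗᵢ[ℝ] Eu (n+1)), ‖e‖ = 1 ∧
    (∀ y, ⟪J y, e⟫ = 0) ∧ (∀ x, ∃ y, x = ⟪x, e⟫ • e + J y) ∧
    ∀ K : Set (Eu (n+1)), IsCompact K → Convex ℝ K → IsCompact (pr e J K) ∧
      ∀ t : ℝ, 0 ≤ t → AA K (t • w) = t * ‖w‖ * volume.real (pr e J K) := by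
  obtain ⟨e, J, hw, he, h1, h2, h3⟩ := framed w
  refine ⟨e, J, he, h1, h2, fun K hK hKc => ⟨?_, fun t ht => ?_⟩⟩
  · rw [pr_eq he h1 h2]; exact hK.image (ContinuousLinearMap.continuous _)
  · conv_lhs => rw [hw, smul_smul]
    exact AA_formula he h1 h2 h3 hK hKc (by positivity)

section
variable {n : ℕ} {K K' : Set (Eu (n+1))}

lemma pr_mono {e : Eu (n+1)} {J : Eu n →ₗᵢ[ℝ] Eu (n+1)} (h : K ⊆ K') : pr e J K ⊆ pr e J K' :=
  fun _ ⟨s, hs⟩ => ⟨s, h hs⟩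

lemma AA_smul (hK : IsCompact K) (hKc : Convex ℝ K) (w : Eu (n+1)) {t : ℝ} (ht : 0 ≤ t) : AA K (t • w) = t * AA K w := by
  obtain ⟨e, J, he, h1, h2, h⟩ := AA_w w
  obtain ⟨c, f⟩ := h K hK hKc
  have := f 1 zero_le_one
  rw [one_smul] at this
  rw [f t ht, this]; ring

lemma AA_nonneg (hK : IsCompact K) (hKc : Convex ℝ K) (w : Eu (n+1)) : 0 ≤ AA K w := by
  obtain ⟨e, J, he, h1, h2, h⟩ := AA_w w
  obtain ⟨c, f⟩ := h K hK hKc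
  have := f 1 zero_le_one
  rw [one_smul] at this
  rw [this]; positivity

lemma AA_mono (hK : IsCompact K) (hKc : Convex ℝ K) (hK' : IsCompact K') (hKc' : Convex ℝ K') (h : K ⊆ K') (w : Eu (n+1)) :
    AA K w ≤ AA K' w := by
  obtain ⟨e, J, he, h1, h2, hh⟩ := AA_w w
  obtain ⟨c, f⟩ := hh K hK hKc
  obtain ⟨c', f'⟩ := hh K' hK' hKc'
  have e1 := f 1 zero_le_one
  have e2 := f' 1 zero_le_one
  rw [one_smul] at e1 e2
  rw [e1, e2]
  exact mul_le_mul_of_nonneg_left (vol_mono c' (pr_mono h)) (by positivity)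

lemma AA_dil (hK : IsCompact K) (hKc : Convex ℝ K) (w : Eu (n+1)) {c : ℝ} (hc : 0 < c) : AA (c • K) w = c ^ n * AA K w := by
  have h1 : c • K + segment ℝ 0 w = c • (K + segment ℝ 0 (c⁻¹ • w)) := by
    rw [smul_add, ← seg_smul, smul_smul, mul_inv_cancel₀ hc.ne', one_smul]
  have h2 : AA (c • K) w = c ^ (n+1) * AA K (c⁻¹ • w) := by
    rw [AA, h1, vol_smul c hc.le, vol_smul c hc.le, AA]; ring
  rw [h2, AA_smul hK hKc w (by positivity), pow_succ]
  field_simp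

lemma AA_neg (K : Set (Eu (n+1))) (w : Eu (n+1)) : AA K (-w) = AA K w := by
  rw [AA, AA]
  congr 1
  have : K + segment ℝ 0 (-w) = (fun y => -w + y) '' (K + segment ℝ 0 w) := by
    have hs : segment ℝ 0 (-w) = (fun y => -w + y) '' segment ℝ 0 w := by
      have := segment_translate_image ℝ (-w) 0 w
      rw [this, segment_symm]; simp
    rw [hs]
    ext x
    constructor
    · rintro ⟨k, hk, _, ⟨y, hy, rfl⟩, rfl⟩
      exact ⟨k + y, ⟨k, hk, y, hy, rfl⟩, by simp; abel⟩
    · rintro ⟨_, ⟨k, hk, y, hy, rfl⟩, rfl⟩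
      exact ⟨k, hk, _, ⟨y, hy, rfl⟩, by simp; abel⟩
  rw [this, vol_add_left]

lemma AA_zero (K : Set (Eu (n+1))) : AA K 0 = 0 := by
  simp [AA]

/-- a lower linear bound for bodies -/
lemma AA_lower (hK : IsCompact K) (hKc : Convex ℝ K) (h0 : (0 : Eu (n+1)) ∈ interior K) :
    ∃ δ : ℝ, 0 < δ ∧ ∀ w, δ * ‖w‖ ≤ AA K w := by
  obtain ⟨r, hr, hr2⟩ := Metric.isOpen_iff.1 isOpen_interior 0 h0
  refine ⟨volume.real (Metric.ball (0 : Eu n) r), ?_, fun w => ?_⟩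
  · exact ENNReal.toReal_pos (Metric.measure_ball_pos _ _ hr).ne' Metric.isBounded_ball.measure_lt_top.ne
  obtain ⟨e, J, he, h1, h2, hh⟩ := AA_w w
  obtain ⟨c, f⟩ := hh K hK hKc
  have e1 := f 1 zero_le_one
  rw [one_smul] at e1
  rw [e1, one_mul, mul_comm]
  refine mul_le_mul_of_nonneg_left (vol_mono c ?_) (by positivity)
  intro y hy
  refine ⟨0, interior_subset (hr2 ?_)⟩
  rw [mem_ball_zero_iff] at hy ⊢
  simpa using hy

lemma AA_pair {K L : Set (Eu 2)} (hK : IsCompact K) (hKc : Convex ℝ K) (hL : IsCompact L) (hLc : Convex ℝ L)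
    (hK0 : K.Nonempty) (hL0 : L.Nonempty) (w : Eu 2) : AA K w + AA L w ≤ AA (K + L) w := by
  obtain ⟨e, J, he, h1, h2, hh⟩ := AA_w (n := 1) w
  obtain ⟨c, f⟩ := hh K hK hKc
  obtain ⟨c', f'⟩ := hh L hL hLc
  obtain ⟨c'', f''⟩ := hh (K + L) (hK.add hL) (hKc.add hLc)
  have e1 := f 1 zero_le_one
  have e2 := f' 1 zero_le_one
  have e3 := f'' 1 zero_le_one
  rw [one_smul] at e1 e2 e3
  rw [e1, e2, e3, ← mul_add]
  refine mul_le_mul_of_nonneg_left ?_ (by positivity)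
  have ne : ∀ S : Set (Eu 2), S.Nonempty → (pr e J S).Nonempty := fun S hS => by
    rw [pr_eq he h1 h2]; exact hS.image _
  have := bm one_pos c c' c'' (ne K hK0) (ne L hL0) (by
    rintro a ⟨s, hs⟩ b ⟨t, ht⟩
    refine ⟨s + t, ?_⟩
    convert Set.add_mem_add hs ht using 1
    rw [map_add, add_smul]; abel)
  simpa using this

end
end PB

open scoped Pointwise RealInnerProductSpace
open scoped MeasureTheory
open MeasureTheory
namespace PB
set_option linter.unusedSectionVars false
set_option linter.unusedVariables false

section
variable {n : ℕ} {κ : Type} [DecidableEq κ]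

/-- partial zonotope -/
def ZS (S : Finset κ) (q : κ → Eu n) : Set (Eu n) := ∑ j ∈ S, segment ℝ 0 (q j)

lemma ZS_empty (q : κ → Eu n) : ZS ∅ q = 0 := by simp [ZS]
lemma ZS_insert {S : Finset κ} {a : κ} (ha : a ∉ S) (q : κ → Eu n) : ZS (insert a S) q = ZS S q + segment ℝ 0 (q a) := by
  rw [ZS, Finset.sum_insert ha, add_comm]; rfl

lemma ZS_compact (S : Finset κ) (q : κ → Eu n) : IsCompact (ZS S q) := by
  induction S using Finset.induction_on with
  | empty => rw [ZS_empty]; exact isCompact_singleton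
  | insert a S ha ih => rw [ZS_insert ha]; exact ih.add (seg_compact _)

lemma ZS_convex (S : Finset κ) (q : κ → Eu n) : Convex ℝ (ZS S q) := by
  induction S using Finset.induction_on with
  | empty => rw [ZS_empty]; exact convex_singleton 0
  | insert a S ha ih => rw [ZS_insert ha]; exact ih.add (convex_segment _ _)

lemma ZS_zero (S : Finset κ) (q : κ → Eu n) : (0 : Eu n) ∈ ZS S q := by
  induction S using Finset.induction_on with
  | empty => rw [ZS_empty]; rfl
  | insert a S ha ih => rw [ZS_insert ha]; exact ⟨0, ih, 0, zero_mem_seg _, by simp⟩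

lemma ZS_hull (S : Finset κ) (q : κ → Eu n) : ∃ V : Finset (Eu n), ZS S q = convexHull ℝ (V : Set (Eu n)) := by
  classical
  induction S using Finset.induction_on with
  | empty => exact ⟨{0}, by rw [ZS_empty]; simp; rfl⟩
  | insert a S ha ih =>
    obtain ⟨V, hV⟩ := ih
    refine ⟨V + {0, q a}, ?_⟩
    rw [ZS_insert ha, hV, Finset.coe_add, convexHull_add, Finset.coe_pair, convexHull_pair]

lemma ZS_smul (S : Finset κ) (q : κ → Eu n) (t : ℝ) : t • ZS S q = ZS S (t • q) := by
  induction S using Finset.induction_on with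
  | empty => rw [ZS_empty, ZS_empty]; simp
  | insert a S ha ih => rw [ZS_insert ha, ZS_insert ha, smul_add, ih, Pi.smul_apply, seg_smul]

/-- support function of a zonotope -/
lemma ZS_supp (S : Finset κ) (q : κ → Eu n) (w : Eu n) :
    (∀ x ∈ ZS S q, ⟪x, w⟫ ≤ ∑ j ∈ S, max 0 ⟪q j, w⟫) ∧ ∃ x ∈ ZS S q, ⟪x, w⟫ = ∑ j ∈ S, max 0 ⟪q j, w⟫ := by
  induction S using Finset.induction_on with
  | empty =>
    rw [ZS_empty]
    refine ⟨fun x hx => ?_, 0, rfl, by simp⟩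
    obtain rfl : x = 0 := hx
    simp
  | insert a S ha ih =>
    obtain ⟨i1, y, hy, i2⟩ := ih
    rw [ZS_insert ha, Finset.sum_insert ha]
    constructor
    · rintro _ ⟨x, hx, z, hz, rfl⟩
      obtain ⟨t, h0, h1, rfl⟩ := mem_seg0.1 hz
      simp only
      rw [inner_add_left, real_inner_smul_left, add_comm]
      refine add_le_add ?_ (i1 x hx)
      rcases le_total 0 ⟪q a, w⟫ with h | h
      · rw [max_eq_right h]; nlinarith
      · rw [max_eq_left h]; nlinarith
    · rcases le_total 0 ⟪q a, w⟫ with h | h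
      · refine ⟨y + q a, ⟨y, hy, q a, right_mem_segment _ _ _, rfl⟩, ?_⟩
        rw [max_eq_right h, inner_add_left, i2, add_comm]
      · refine ⟨y + 0, ⟨y, hy, 0, zero_mem_seg _, rfl⟩, ?_⟩
        rw [max_eq_left h, add_zero, i2, zero_add]

variable {K : Set (Eu (n+1))}

lemma tele_lower (hK : IsCompact K) (hKc : Convex ℝ K) (S : Finset κ) (q : κ → Eu (n+1)) :
    volume.real K + ∑ j ∈ S, AA K (q j) ≤ volume.real (K + ZS S q) := by
  induction S using Finset.induction_on with
  | empty => rw [ZS_empty]; simp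
  | insert a S ha ih =>
    have hc := hK.add (ZS_compact S q)
    have hv := hKc.add (ZS_convex S q)
    have h1 : AA K (q a) ≤ AA (K + ZS S q) (q a) := AA_mono hK hKc hc hv
      (fun x hx => ⟨x, hx, 0, ZS_zero S q, by simp⟩) _
    rw [ZS_insert ha, Finset.sum_insert ha, ← add_assoc K]
    have h2 : AA (K + ZS S q) (q a) = volume.real (K + ZS S q + segment ℝ 0 (q a)) - volume.real (K + ZS S q) := rfl
    linarith

lemma tele_upper (hK : IsCompact K) (hKc : Convex ℝ K) (S : Finset κ) (q : κ → Eu (n+1)) :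
    volume.real (K + ZS S q) ≤ volume.real K + ∑ j ∈ S, AA (K + ZS S q) (q j) := by
  induction S using Finset.induction_on with
  | empty => rw [ZS_empty]; simp
  | insert a S ha ih =>
    have hc := hK.add (ZS_compact S q)
    have hv := hKc.add (ZS_convex S q)
    have hc' := hK.add (ZS_compact (insert a S) q)
    have hv' := hKc.add (ZS_convex (insert a S) q)
    have hsub : K + ZS S q ⊆ K + ZS (insert a S) q := by
      rw [ZS_insert ha, ← add_assoc]
      exact fun x hx => ⟨x, hx, 0, zero_mem_seg _, by simp⟩
    have h1 : ∀ j, AA (K + ZS S q) (q j) ≤ AA (K + ZS (insert a S) q) (q j) := fun j => AA_mono hc hv hc' hv' hsub _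
    have h2 : AA (K + ZS S q) (q a) = volume.real (K + ZS (insert a S) q) - volume.real (K + ZS S q) := by
      rw [ZS_insert ha, ← add_assoc]; rfl
    rw [Finset.sum_insert ha]
    have h3 := Finset.sum_le_sum (fun j (_ : j ∈ S) => h1 j)
    have := h1 a
    linarith

lemma absorb {m : ℕ} {P Z : Set (Eu m)} (hP : Bornology.IsBounded P) (hZ : (0 : Eu m) ∈ interior Z) :
    ∃ r : ℝ, 0 < r ∧ P ⊆ r • Z := by
  obtain ⟨δ, hδ, h2⟩ := Metric.isOpen_iff.1 isOpen_interior 0 hZ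
  obtain ⟨R, hR, hR2⟩ := hP.exists_pos_norm_lt
  refine ⟨R / δ, by positivity, fun x hx => ?_⟩
  rw [Set.mem_smul_set_iff_inv_smul_mem₀ (by positivity)]
  refine interior_subset (h2 ?_)
  rw [mem_ball_zero_iff, norm_smul, Real.norm_of_nonneg (by positivity), inv_div, div_mul_eq_mul_div, div_lt_iff₀ hR]
  exact mul_lt_mul_of_pos_left (hR2 x hx) hδ

lemma absorb_add {m : ℕ} {P Z : Set (Eu m)} {r ε : ℝ} (hr : 0 < r) (hε : 0 ≤ ε) (hZ : Convex ℝ Z) (h : P ⊆ r • Z) :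
    Z + ε • P ⊆ (1 + ε * r) • Z := by
  rw [hZ.add_smul zero_le_one (by positivity), one_smul, mul_smul]
  exact Set.add_subset_add_left (Set.smul_set_mono h)

/-- upper bound for volume of `K + t Z` -/
lemma zon_upper (hK : IsCompact K) (hKc : Convex ℝ K) (h0 : (0 : Eu (n+1)) ∈ interior K) (S : Finset κ) (q : κ → Eu (n+1)) :
    ∃ r : ℝ, 0 < r ∧ ∀ t : ℝ, 0 ≤ t → volume.real (K + t • ZS S q) ≤ volume.real K + t * ((1 + t * r) ^ n * ∑ j ∈ S, AA K (q j)) := by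
  obtain ⟨r, hr, hr2⟩ := absorb (ZS_compact S q).isBounded h0
  refine ⟨r, hr, fun t ht => ?_⟩
  rw [ZS_smul]
  refine (tele_upper hK hKc S (t • q)).trans ?_
  rw [← ZS_smul]
  refine add_le_add le_rfl ?_
  rw [Finset.mul_sum, Finset.mul_sum]
  refine Finset.sum_le_sum fun j _ => ?_
  have hc : IsCompact (K + t • ZS S q) := hK.add ((ZS_compact S q).smul t)
  have hv : Convex ℝ (K + t • ZS S q) := hKc.add ((ZS_convex S q).smul t)
  rw [Pi.smul_apply, AA_smul hc hv _ ht]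
  refine mul_le_mul_of_nonneg_left ?_ ht
  have hp : 0 < 1 + t * r := by positivity
  rw [← AA_dil hK hKc _ hp]
  exact AA_mono hc hv (hK.smul _) (hKc.smul _) (absorb_add hr ht hKc hr2) _

lemma zon_lower (hK : IsCompact K) (hKc : Convex ℝ K) (S : Finset κ) (q : κ → Eu (n+1)) {t : ℝ} (ht : 0 ≤ t) :
    volume.real K + t * ∑ j ∈ S, AA K (q j) ≤ volume.real (K + t • ZS S q) := by
  rw [ZS_smul]
  refine le_trans (le_of_eq ?_) (tele_lower hK hKc S (t • q))
  rw [Finset.mul_sum]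
  congr 1
  exact Finset.sum_congr rfl fun j _ => (AA_smul hK hKc _ ht).symm

lemma deriv_ge {f : ℝ → ℝ} {w a : ℝ} (hf : HasDerivWithinAt f w (Set.Ici 0) 0) (h : ∀ t : ℝ, 0 < t → f 0 + t * a ≤ f t) : a ≤ w := by
  have h1 := hasDerivWithinAt_iff_tendsto_slope.1 hf
  have h2 : (Set.Ici (0:ℝ) \ {0}) = Set.Ioi 0 := by ext; simp [lt_iff_le_and_ne, eq_comm]
  rw [h2] at h1
  refine ge_of_tendsto h1 ?_
  filter_upwards [self_mem_nhdsWithin] with t ht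
  have ht : 0 < t := ht
  rw [slope_def_field, sub_zero, le_div_iff₀ ht]
  linarith [h t ht]

lemma deriv_le {f : ℝ → ℝ} {w : ℝ} {g : ℝ → ℝ} (hg : ContinuousAt g 0) (hf : HasDerivWithinAt f w (Set.Ici 0) 0) (h : ∀ t : ℝ, 0 < t → f t ≤ f 0 + t * g t) : w ≤ g 0 := by
  have h1 := hasDerivWithinAt_iff_tendsto_slope.1 hf
  have h2 : (Set.Ici (0:ℝ) \ {0}) = Set.Ioi 0 := by ext; simp [lt_iff_le_and_ne, eq_comm]
  rw [h2] at h1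
  refine le_of_tendsto_of_tendsto h1 (hg.mono_left nhdsWithin_le_nhds) ?_
  filter_upwards [self_mem_nhdsWithin] with t ht
  have ht : 0 < t := ht
  rw [slope_def_field, sub_zero, div_le_iff₀ ht]
  linarith [h t ht]

end

lemma af_zon3 {n : ℕ} {κ : Type} [DecidableEq κ] (S : Finset κ) (q : κ → Eu (n+3)) (VK VL : Finset (Eu (n+3))) (K L : Set (Eu (n+3)))
    (hK : K = convexHull ℝ (VK : Set (Eu (n+3)))) (hL : L = convexHull ℝ (VL : Set (Eu (n+3))))
    (hK0 : (0 : Eu (n+3)) ∈ interior K) (hL0 : (0 : Eu (n+3)) ∈ interior L) (hZ0 : (0 : Eu (n+3)) ∈ interior (ZS S q)) :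
    (∑ j ∈ S, AA K (q j)) ^ (1/((n+2:ℕ):ℝ)) + (∑ j ∈ S, AA L (q j)) ^ (1/((n+2:ℕ):ℝ)) ≤ (∑ j ∈ S, AA (K + L) (q j)) ^ (1/((n+2:ℕ):ℝ)) := by
  obtain ⟨VZ, hZ⟩ := ZS_hull S q
  have cK : IsCompact K := hK ▸ Set.Finite.isCompact_convexHull ℝ VK.finite_toSet
  have cL : IsCompact L := hL ▸ Set.Finite.isCompact_convexHull ℝ VL.finite_toSet
  have vK : Convex ℝ K := hK ▸ convex_convexHull ℝ _
  have vL : Convex ℝ L := hL ▸ convex_convexHull ℝ _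
  have hKi := interior_subset hK0
  have hLi := interior_subset hL0
  obtain ⟨P, cP, vP, P0, H⟩ := poly_mink VK VL VZ K L (ZS S q) hK hL hZ hKi hLi hZ0
  have hKL0 : (0 : Eu (n+3)) ∈ interior (K + L) := interior_mono (fun x hx => Set.mem_add.2 ⟨x, hx, 0, hLi, by simp⟩) hK0
  obtain ⟨r, hr, hr2⟩ := absorb cP.isBounded hZ0
  obtain ⟨r', hr', hr2'⟩ := absorb cP.isBounded hKL0
  set W := ∑ j ∈ S, AA (K + L) (q j) with hW
  have hP0 : ∀ ε : ℝ, (0 : Eu (n+3)) ∈ ε • P := fun ε => ⟨0, P0, by simp⟩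
  -- lower estimates
  have low : ∀ (ε : ℝ), 0 < ε → ∀ (A : Set (Eu (n+3))) (w : ℝ), IsCompact A → Convex ℝ A →
      HasDerivWithinAt (fun t : ℝ => volume.real ((A + ε • P) + t • (ZS S q + ε • P))) w (Set.Ici 0) 0 →
      ∑ j ∈ S, AA A (q j) ≤ w := by
    intro ε hε A w cA vA hw
    have cA' : IsCompact (A + ε • P) := cA.add (cP.smul ε)
    have vA' : Convex ℝ (A + ε • P) := vA.add (vP.smul ε)
    have h1 : ∑ j ∈ S, AA A (q j) ≤ ∑ j ∈ S, AA (A + ε • P) (q j) := Finset.sum_le_sum fun j _ =>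
      AA_mono cA vA cA' vA' (fun x hx => Set.mem_add.2 ⟨x, hx, 0, hP0 ε, by simp⟩) _
    refine h1.trans (deriv_ge hw fun t ht => ?_)
    have hz : (0:ℝ) • (ZS S q + ε • P) = 0 := Set.zero_smul_set ⟨0, 0, ZS_zero S q, 0, hP0 ε, by simp⟩
    simp only [hz, add_zero]
    refine (zon_lower cA' vA' S q ht.le).trans ?_
    refine vol_mono (cA'.add (((ZS_compact S q).add (cP.smul ε)).smul t)) ?_
    refine Set.add_subset_add_left (Set.smul_set_mono ?_)
    exact fun x hx => ⟨x, hx, 0, hP0 ε, by simp⟩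
  have main : ∀ ε : ℝ, 0 < ε → (∑ j ∈ S, AA K (q j)) ^ (1/((n+2:ℕ):ℝ)) + (∑ j ∈ S, AA L (q j)) ^ (1/((n+2:ℕ):ℝ)) ≤
      ((1 + ε * r) * ((1 + (2 * ε) * r') ^ (n+2) * W)) ^ (1/((n+2:ℕ):ℝ)) := by
    intro ε hε
    obtain ⟨wK, wL, wM, dK, dL, dM, hw⟩ := H ε hε
    have nn : ∀ A : Set (Eu (n+3)), IsCompact A → Convex ℝ A → 0 ≤ ∑ j ∈ S, AA A (q j) := fun A cA vA =>
      Finset.sum_nonneg fun j _ => AA_nonneg cA vA _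
    have l1 := low ε hε K wK cK vK dK
    have l2 := low ε hε L wL cL vL dL
    have hexp : 0 ≤ (1/((n+2:ℕ):ℝ)) := by positivity
    refine (add_le_add (Real.rpow_le_rpow (nn K cK vK) l1 hexp) (Real.rpow_le_rpow (nn L cL vL) l2 hexp)).trans (hw.trans ?_)
    set M := (K + ε • P) + (L + ε • P) with hM
    have cM : IsCompact M := (cK.add (cP.smul ε)).add (cL.add (cP.smul ε))
    have vM : Convex ℝ M := (vK.add (vP.smul ε)).add (vL.add (vP.smul ε))
    have eM : M = (K + L) + (2 * ε) • P := by
      rw [hM, show (2 * ε) = ε + ε by ring, vP.add_smul hε.le hε.le]; abel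
    have hsub : M ⊆ (1 + (2 * ε) * r') • (K + L) := by
      rw [eM]; exact absorb_add hr' (by positivity) (vK.add vL) hr2'
    have hMAA : ∑ j ∈ S, AA M (q j) ≤ (1 + (2 * ε) * r') ^ (n+2) * W := by
      rw [hW, Finset.mul_sum]
      refine Finset.sum_le_sum fun j _ => ?_
      have hp : 0 < 1 + (2 * ε) * r' := by positivity
      rw [← AA_dil (cK.add cL) (vK.add vL) _ hp]
      exact AA_mono cM vM ((cK.add cL).smul _) ((vK.add vL).smul _) hsub _
    have hM0 : (0 : Eu (n+3)) ∈ interior M := by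
      rw [eM]; exact interior_mono (fun x hx => Set.mem_add.2 ⟨x, hx, 0, hP0 _, by simp⟩) hKL0
    obtain ⟨ρ, hρ, hρ2⟩ := zon_upper cM vM hM0 S q
    set b := 1 + ε * r with hb
    have hb0 : 0 < b := by positivity
    have hz : (0:ℝ) • (ZS S q + ε • P) = 0 := Set.zero_smul_set ⟨0, 0, ZS_zero S q, 0, hP0 ε, by simp⟩
    have hup : wM ≤ b * ∑ j ∈ S, AA M (q j) := by
      have := deriv_le (g := fun t => b * ((1 + (t * b) * ρ) ^ (n+2) * ∑ j ∈ S, AA M (q j))) (by fun_prop) dM (fun t ht => ?_)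
      · simpa using this
      · simp only [hz, add_zero]
        have h1 := hρ2 (t * b) (by positivity)
        have h2 : volume.real (M + t • (ZS S q + ε • P)) ≤ volume.real (M + (t * b) • ZS S q) := by
          refine vol_mono (cM.add ((ZS_compact S q).smul _)) (Set.add_subset_add_left ?_)
          rw [mul_smul]
          exact Set.smul_set_mono (absorb_add hr hε.le (ZS_convex S q) hr2)
        refine h2.trans (h1.trans (le_of_eq ?_))
        ring
    have hwM : 0 ≤ wM := (nn M cM vM).trans (by
      refine deriv_ge dM fun t ht => ?_
      simp only [hz, add_zero]
      refine (zon_lower cM vM S q ht.le).trans ?_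
      refine vol_mono (cM.add (((ZS_compact S q).add (cP.smul ε)).smul t)) ?_
      refine Set.add_subset_add_left (Set.smul_set_mono ?_)
      exact fun x hx => ⟨x, hx, 0, hP0 ε, by simp⟩)
    refine Real.rpow_le_rpow hwM (hup.trans ?_) hexp
    exact mul_le_mul_of_nonneg_left hMAA hb0.le
  have hlim : Filter.Tendsto (fun ε : ℝ => ((1 + ε * r) * ((1 + (2 * ε) * r') ^ (n+2) * W)) ^ (1/((n+2:ℕ):ℝ))) (nhdsWithin 0 (Set.Ioi 0)) (nhds (W ^ (1/((n+2:ℕ):ℝ)))) := by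
    have hc : Continuous (fun ε : ℝ => ((1 + ε * r) * ((1 + (2 * ε) * r') ^ (n+2) * W)) ^ (1/((n+2:ℕ):ℝ))) := by
      refine Continuous.rpow_const (by fun_prop) fun _ => Or.inr (by positivity)
    have := hc.tendsto 0
    simp only [zero_mul, mul_zero, add_zero, one_pow, one_mul] at this
    exact this.mono_left nhdsWithin_le_nhds
  refine ge_of_tendsto hlim ?_
  filter_upwards [self_mem_nhdsWithin] with ε hε using main ε hε

lemma af_zon {n : ℕ} {κ : Type} [DecidableEq κ] (S : Finset κ) (q : κ → Eu (n+2)) (VK VL : Finset (Eu (n+2))) (K L : Set (Eu (n+2)))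
    (hK : K = convexHull ℝ (VK : Set (Eu (n+2)))) (hL : L = convexHull ℝ (VL : Set (Eu (n+2))))
    (hK0 : (0 : Eu (n+2)) ∈ interior K) (hL0 : (0 : Eu (n+2)) ∈ interior L) (hZ0 : (0 : Eu (n+2)) ∈ interior (ZS S q)) :
    (∑ j ∈ S, AA K (q j)) ^ (1/((n+1:ℕ):ℝ)) + (∑ j ∈ S, AA L (q j)) ^ (1/((n+1:ℕ):ℝ)) ≤ (∑ j ∈ S, AA (K + L) (q j)) ^ (1/((n+1:ℕ):ℝ)) := by
  rcases n with _ | n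
  · have cK : IsCompact K := hK ▸ Set.Finite.isCompact_convexHull ℝ VK.finite_toSet
    have cL : IsCompact L := hL ▸ Set.Finite.isCompact_convexHull ℝ VL.finite_toSet
    have vK : Convex ℝ K := hK ▸ convex_convexHull ℝ _
    have vL : Convex ℝ L := hL ▸ convex_convexHull ℝ _
    simp only [zero_add, Nat.cast_one, div_one, Real.rpow_one]
    rw [← Finset.sum_add_distrib]
    exact Finset.sum_le_sum fun j _ => AA_pair cK vK cL vL ⟨_, interior_subset hK0⟩ ⟨_, interior_subset hL0⟩ _
  · exact af_zon3 S q VK VL K L hK hL hK0 hL0 hZ0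

end PB

open scoped Pointwise RealInnerProductSpace
open scoped MeasureTheory
open MeasureTheory
namespace PB
set_option linter.unusedSectionVars false
set_option linter.unusedVariables false

lemma deriv_ge' {f : ℝ → ℝ} {w a : ℝ} (hf : HasDerivAt f w 0)
    (h : ∀ᶠ t in nhdsWithin (0:ℝ) (Set.Ioi 0), f 0 + t * a ≤ f t) : a ≤ w := by
  have h1 := hasDerivWithinAt_iff_tendsto_slope.1 (hf.hasDerivWithinAt (s := Set.Ici 0))
  have h2 : (Set.Ici (0:ℝ) \ {0}) = Set.Ioi 0 := by ext; simp [lt_iff_le_and_ne, eq_comm]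
  rw [h2] at h1
  refine ge_of_tendsto h1 ?_
  filter_upwards [self_mem_nhdsWithin, h] with t ht h
  have ht : 0 < t := ht
  rw [slope_def_field, sub_zero, le_div_iff₀ ht]
  linarith

/-- Cauchy formula for simple polytopes -/
lemma cauchy {n : ℕ} {ι : Type} [Fintype ι] [DecidableEq ι] {u : ι → Eu (n+1)} {C : Set (ι → ℝ)} (g : Good u C) {h : ι → ℝ} (hh : h ∈ C) (w : Eu (n+1)) :
    AA (PH u h) w = ∑ i, max 0 ⟪(D (Pi.single i 1) (vv u) h) • u i, w⟫ := by
  set K := PH u h with hK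
  have cK : IsCompact K := g.compact hh
  have vK : Convex ℝ K := PH_convex u h
  set c : ι → ℝ := fun i => D (Pi.single i 1) (vv u) h with hc
  have c0 : ∀ i, 0 ≤ c i := fun i => (g.adm_partial i).nonneg h hh
  have hvol : ∀ t : ℝ, 0 ≤ t → volume.real (K + segment ℝ 0 (t • w)) = volume.real K + t * AA K w := fun t ht => by
    rw [← AA_smul cK vK w ht, AA]; ring
  have hmem : ∀ z : ι → ℝ, ∀ᶠ t in nhdsWithin (0:ℝ) (Set.Ioi 0), h + t • z ∈ C := fun z => by
    have hct : ContinuousAt (fun t : ℝ => h + t • z) 0 := by fun_prop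
    have : ∀ᶠ t in nhds (0:ℝ), h + t • z ∈ C := hct.eventually_mem (g.isOpen.mem_nhds (by simpa using hh))
    exact this.filter_mono nhdsWithin_le_nhds
  have hder : ∀ z : ι → ℝ, HasDerivAt (fun t : ℝ => vv u (h + t • z)) (∑ i, z i * c i) 0 := fun z => by
    have := D_deriv g.isOpen g.adm.smooth (h := h) (x := z) (t := 0) (by simpa using hh)
    simp only [zero_smul, add_zero] at this
    rwa [D_single] at this
  have htr : ∑ i, ⟪u i, w⟫ * c i = 0 := by
    rw [← g.D_trans w hh, D_single]
  have hup : AA K w ≤ ∑ i, max 0 ⟪u i, w⟫ * c i := by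
    refine deriv_ge' (hder fun i => max 0 ⟪u i, w⟫) ?_
    filter_upwards [self_mem_nhdsWithin, hmem fun i => max 0 ⟪u i, w⟫] with t ht hm
    have ht : 0 < t := ht
    rw [zero_smul, add_zero]
    change volume.real K + _ ≤ _
    rw [← hvol t ht.le]
    refine vol_mono (g.compact hm) ?_
    rintro _ ⟨k, hk, z, hz, rfl⟩
    obtain ⟨s, s0, s1, rfl⟩ := mem_seg0.1 hz
    intro i
    simp only [Pi.add_apply, Pi.smul_apply, smul_eq_mul]
    rw [inner_add_right, inner_smul_right, inner_smul_right]
    refine add_le_add (hk i) ?_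
    rcases le_total 0 ⟪u i, w⟫ with h | h
    · rw [max_eq_right h]
      have := mul_nonneg ht.le h
      nlinarith
    · rw [max_eq_left h, mul_zero]
      have := mul_nonpos_of_nonneg_of_nonpos ht.le h
      nlinarith
  have hlo : ∑ i, max 0 (-⟪u i, w⟫) * c i ≤ AA K w := by
    have : -AA K w ≤ ∑ i, (-max 0 (-⟪u i, w⟫)) * c i := by
      refine deriv_ge' (hder fun i => -max 0 (-⟪u i, w⟫)) ?_
      filter_upwards [self_mem_nhdsWithin, hmem fun i => -max 0 (-⟪u i, w⟫)] with t ht hm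
      have ht : 0 < t := ht
      rw [zero_smul, add_zero]
      change volume.real K + _ ≤ volume.real (PH u (h + t • fun i => -max 0 (-⟪u i, w⟫)))
      set K2 := (fun y => t • w + y) '' K with hK2
      have cK2 : IsCompact K2 := cK.image (by fun_prop)
      have h_int0 : K ∩ K2 = PH u (h + t • fun i => -max 0 (-⟪u i, w⟫)) := by
        ext x
        have e1 : x ∈ K2 ↔ ∀ i, ⟪u i, x⟫ ≤ h i + t * ⟪u i, w⟫ := by
          constructor
          · rintro ⟨y, hy, rfl⟩ i
            have := hy i
            rw [inner_add_right, inner_smul_right]; linarith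
          · intro hx
            refine ⟨x - t • w, fun i => ?_, by simp⟩
            rw [inner_sub_right, inner_smul_right]
            linarith [hx i]
        rw [Set.mem_inter_iff, e1]
        constructor
        · rintro ⟨h1, h2⟩ i
          simp only [Pi.add_apply, Pi.smul_apply, smul_eq_mul]
          rcases le_total 0 (-⟪u i, w⟫) with h | h
          · rw [max_eq_right h]; linarith [h2 i]
          · rw [max_eq_left h]; linarith [h1 i]
        · intro hx
          refine ⟨fun i => ?_, fun i => ?_⟩
          · have := hx i
            simp only [Pi.add_apply, Pi.smul_apply, smul_eq_mul] at this
            have := mul_nonneg ht.le (le_max_left 0 (-⟪u i, w⟫))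
            linarith
          · have := hx i
            simp only [Pi.add_apply, Pi.smul_apply, smul_eq_mul] at this
            have := mul_le_mul_of_nonneg_left (le_max_right 0 (-⟪u i, w⟫)) ht.le
            linarith
      rw [← h_int0]
      have h3 := measureReal_union_add_inter (μ := volume) (s := K) (t := K2) cK2.measurableSet cK.measure_lt_top.ne cK2.measure_lt_top.ne
      have h4 : volume.real K2 = volume.real K := vol_add_left _ _
      have h5 : volume.real (K ∪ K2) ≤ volume.real (K + segment ℝ 0 (t • w)) := by
        refine vol_mono (cK.add (seg_compact _)) ?_
        rintro x (hx | ⟨y, hy, rfl⟩)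
        · exact ⟨x, hx, 0, zero_mem_seg _, by simp⟩
        · exact ⟨y, hy, t • w, right_mem_segment _ _ _, add_comm _ _⟩
      rw [hvol t ht.le] at h5
      linarith
    simp only [neg_mul, Finset.sum_neg_distrib] at this
    linarith
  have heq : ∑ i, max 0 (-⟪u i, w⟫) * c i = ∑ i, max 0 ⟪u i, w⟫ * c i := by
    have : ∑ i, max 0 ⟪u i, w⟫ * c i - ∑ i, max 0 (-⟪u i, w⟫) * c i = ∑ i, ⟪u i, w⟫ * c i := by
      rw [← Finset.sum_sub_distrib]
      refine Finset.sum_congr rfl fun i _ => ?_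
      rcases le_total 0 ⟪u i, w⟫ with h | h
      · rw [max_eq_right h, max_eq_left (by linarith)]; ring
      · rw [max_eq_left h, max_eq_right (by linarith)]; ring
    linarith
  rw [le_antisymm hup (heq ▸ hlo)]
  refine Finset.sum_congr rfl fun i _ => ?_
  rw [real_inner_smul_left]
  change _ = max 0 (c i * _)
  rw [mul_comm, mul_max_of_nonneg _ _ (c0 i), mul_zero]

/-- Wulff shape of `AA K`, i.e. the projection body -/
def Wu {n : ℕ} (K : Set (Eu n)) : Set (Eu n) := {x | ∀ w, ⟪x, w⟫ ≤ AA K w}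

def Cau {n : ℕ} (K : Set (Eu n)) {κ : Type} [Fintype κ] (a : κ → Eu n) : Prop := ∀ w, AA K w = ∑ j, max 0 ⟪a j, w⟫

lemma Wu_closed {n : ℕ} (K : Set (Eu n)) : IsClosed (Wu K) := by
  have : Wu K = ⋂ w, {x | ⟪x, w⟫ ≤ AA K w} := by ext; simp [Wu]
  rw [this]
  exact isClosed_iInter fun w => isClosed_le (by fun_prop) continuous_const

lemma Wu_convex {n : ℕ} (K : Set (Eu n)) : Convex ℝ (Wu K) := by
  intro x hx y hy a b ha hb hab w
  rw [inner_add_left, real_inner_smul_left, real_inner_smul_left]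
  have h1 := mul_le_mul_of_nonneg_left (hx w) ha
  have h2 := mul_le_mul_of_nonneg_left (hy w) hb
  have : a * AA K w + b * AA K w = AA K w := by rw [← add_mul, hab, one_mul]
  linarith

lemma Wu_zon {n : ℕ} {K : Set (Eu n)} {κ : Type} [Fintype κ] [DecidableEq κ] {a : κ → Eu n} (h : Cau K a) :
    Wu K = ZS Finset.univ a := by
  apply Set.Subset.antisymm
  · intro x hx
    by_contra hcon
    obtain ⟨c, r, h1, h2⟩ := sep (ZS_compact _ _).isClosed (ZS_convex _ _) hcon
    obtain ⟨s, hs, hs2⟩ := (ZS_supp Finset.univ a c).2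
    have h3 := h1 s hs
    have h4 := hx c
    rw [h c, ← hs2, real_inner_comm, real_inner_comm c s] at h4
    linarith
  · intro x hx w
    rw [h w]
    exact (ZS_supp Finset.univ a w).1 x hx

section
variable {n : ℕ} {K K' : Set (Eu (n+1))}

lemma Wu_int (hK : IsCompact K) (hKc : Convex ℝ K) (h0 : (0 : Eu (n+1)) ∈ interior K) : (0 : Eu (n+1)) ∈ interior (Wu K) := by
  obtain ⟨δ, hδ, h⟩ := AA_lower hK hKc h0
  rw [mem_interior]
  refine ⟨Metric.ball 0 δ, fun x hx w => ?_, Metric.isOpen_ball, by simpa using hδ⟩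
  rw [mem_ball_zero_iff] at hx
  refine (real_inner_le_norm _ _).trans (le_trans ?_ (h w))
  exact mul_le_mul_of_nonneg_right hx.le (norm_nonneg _)

lemma Wu_mono (hK : IsCompact K) (hKc : Convex ℝ K) (hK' : IsCompact K') (hKc' : Convex ℝ K') (h : K ⊆ K') : Wu K ⊆ Wu K' :=
  fun x hx w => (hx w).trans (AA_mono hK hKc hK' hKc' h w)

lemma Wu_dil (hK : IsCompact K) (hKc : Convex ℝ K) {c : ℝ} (hc : 0 < c) : Wu (c • K) = c ^ n • Wu K := by
  ext x
  have hp : 0 < c ^ n := by positivity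
  rw [Set.mem_smul_set_iff_inv_smul_mem₀ hp.ne']
  simp only [Wu, Set.mem_ofPred_eq, real_inner_smul_left, AA_dil hK hKc _ hc, inv_mul_le_iff₀ hp]

lemma Wu_compact (hK : IsCompact K) (hKc : Convex ℝ K) : IsCompact (Wu K) := by
  refine Metric.isCompact_of_isClosed_isBounded (Wu_closed K) ?_
  -- bounded by `|x i| ≤ max`
  obtain ⟨b, hb⟩ : ∃ b : Fin (n+1) → ℝ, ∀ x ∈ Wu K, ∀ i, |x i| ≤ b i := by
    refine ⟨fun i => AA K (EuclideanSpace.single i 1), fun x hx i => abs_le.2 ⟨?_, ?_⟩⟩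
    · have := hx (-EuclideanSpace.single i 1)
      rw [AA_neg, inner_neg_right] at this
      simp [EuclideanSpace.inner_single_right] at this
      linarith
    · have := hx (EuclideanSpace.single i 1)
      simpa [EuclideanSpace.inner_single_right] using this
  refine isBounded_iff_forall_norm_le.2 ⟨√(∑ i, b i ^ 2), fun x hx => ?_⟩
  rw [EuclideanSpace.norm_eq]
  refine Real.sqrt_le_sqrt (Finset.sum_le_sum fun i _ => ?_)
  rw [Real.norm_eq_abs]
  exact pow_le_pow_left₀ (abs_nonneg _) (hb x hx i) 2

lemma approx (hK : IsCompact K) (hKc : Convex ℝ K) (h0 : (0 : Eu (n+1)) ∈ interior K) {θ : ℝ} (hθ : 0 < θ) (hθ1 : θ < 1) :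
    ∃ (K' : Set (Eu (n+1))) (V : Finset (Eu (n+1))), θ • K ⊆ K' ∧ K' ⊆ K ∧ K' = convexHull ℝ (V : Set (Eu (n+1))) ∧
      (0 : Eu (n+1)) ∈ interior K' ∧ ∃ (κ : Type) (_ : Fintype κ) (_ : DecidableEq κ) (a : κ → Eu (n+1)), Cau K' a := by
  classical
  set σ := √θ with hσ
  have hσ0 : 0 < σ := Real.sqrt_pos.2 hθ
  have hσ1 : σ < 1 := by rw [hσ, Real.sqrt_lt' one_pos]; simpa using hθ1
  have hσσ : σ * σ = θ := Real.mul_self_sqrt hθ.le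
  have hsub : σ • K ⊆ interior K := by
    rintro _ ⟨x, hx, rfl⟩
    have := hKc.combo_interior_self_mem_interior h0 hx (a := 1 - σ) (b := σ) (by linarith) hσ0.le (by ring)
    simpa using this
  obtain ⟨V, hV1, hV2⟩ := (hKc.smul σ).exists_subset_interior_convexHull_finset_of_isCompact (hK.smul σ)
    (t := interior K) (isOpen_interior.mem_nhdsSet.2 hsub)
  have hV0 : (0 : Eu (n+1)) ∈ interior (convexHull ℝ (V : Set (Eu (n+1)))) := hV1 ⟨0, interior_subset h0, by simp⟩
  obtain ⟨ι, _, _, u, hu⟩ := H_rep V hV0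
  have hPc : IsCompact (PH u 1) := hu ▸ Set.Finite.isCompact_convexHull ℝ V.finite_toSet
  set η := (1 - σ) / (1 + σ) with hη
  have hη0 : 0 < η := by rw [hη]; exact div_pos (by linarith) (by linarith)
  have hησ : 1 - η = σ * (1 + η) := by rw [hη]; field_simp; ring
  obtain ⟨g0, CW, C, gη, gp, good, gC, -, -, -, -⟩ := chamber u hPc.isBounded hη0
  have hp : 0 < (1 + η)⁻¹ := by positivity
  set k := (1 + η)⁻¹ • g0 with hk
  have kC : k ∈ C := good.smul _ hp _ gC
  have k1 : ∀ i, k i ≤ 1 := fun i => by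
    have := (abs_lt.1 (gη i)).2
    rw [hk, Pi.smul_apply, smul_eq_mul, inv_mul_le_iff₀ (by positivity)]; linarith
  have k2 : ∀ i, σ ≤ k i := fun i => by
    have := (abs_lt.1 (gη i)).1
    rw [hk, Pi.smul_apply, smul_eq_mul, le_inv_mul_iff₀ (by positivity), mul_comm, ← hησ]; linarith
  have cP : IsCompact (PH u k) := good.compact kC
  have hfin := ext_finite u k
  have hKM : convexHull ℝ ((PH u k).extremePoints ℝ) = PH u k := by
    have := closure_convexHull_extremePoints cP (PH_convex u k)
    rwa [(Set.Finite.isCompact_convexHull ℝ hfin).isClosed.closure_eq] at this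
  have hin : θ • K ⊆ PH u k := by
    have h1 : σ • PH u 1 ⊆ PH u k := by
      rw [← PH_smul u 1 hσ0]
      intro x hx i
      refine (hx i).trans ?_
      simpa using k2 i
    refine Set.Subset.trans ?_ h1
    rw [← hσσ, mul_smul, ← hu]
    exact Set.smul_set_mono (hV1.trans interior_subset)
  refine ⟨PH u k, hfin.toFinset, hin, ?_, by rw [hfin.coe_toFinset, hKM], ?_, ι, inferInstance, inferInstance, _, fun w => cauchy good kC w⟩
  · intro x hx
    refine interior_subset (hV2 ?_)
    rw [hu]
    exact fun i => (hx i).trans (k1 i)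
  · refine interior_mono hin ?_
    rw [interior_smul₀ hθ.ne']
    exact ⟨0, h0, by simp⟩

end
end PB

open scoped Pointwise RealInnerProductSpace
open scoped MeasureTheory
open MeasureTheory
namespace PB
set_option linter.unusedSectionVars false
set_option linter.unusedVariables false

section
variable {n : ℕ} {κ : Type} [DecidableEq κ] {K L Q : Set (Eu (n+1))}

lemma zon_mink (hK : IsCompact K) (hKc : Convex ℝ K) (h0 : (0 : Eu (n+1)) ∈ interior K) (S : Finset κ) (q : κ → Eu (n+1)) :
    ((n+1:ℕ):ℝ) * (volume.real K ^ (1/((n+1:ℕ):ℝ))) ^ n * volume.real (ZS S q) ^ (1/((n+1:ℕ):ℝ)) ≤ ∑ j ∈ S, AA K (q j) := by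
  obtain ⟨r, hr, h⟩ := zon_upper hK hKc h0 S q
  set x := volume.real K ^ (1/((n+1:ℕ):ℝ)) with hx
  set y := volume.real (ZS S q) ^ (1/((n+1:ℕ):ℝ)) with hy
  have hN : ((n+1:ℕ):ℝ) ≠ 0 := by positivity
  have x0 : 0 ≤ x := by positivity
  have y0 : 0 ≤ y := by positivity
  have pw : ∀ v : ℝ, 0 ≤ v → (v ^ (1/((n+1:ℕ):ℝ))) ^ (n+1) = v := fun v hv => by
    rw [one_div, Real.rpow_inv_natCast_pow hv (by omega)]
  have xN : x ^ (n+1) = volume.real K := pw _ measureReal_nonneg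
  have hder : HasDerivWithinAt (fun t : ℝ => (x + t * y) ^ (n+1)) (((n+1:ℕ):ℝ) * x ^ n * y) (Set.Ici 0) 0 := by
    have h1 : HasDerivAt (fun t : ℝ => x + t * y) (1 * y) 0 := ((hasDerivAt_id (0:ℝ)).mul_const y).const_add x
    have h2 : HasDerivAt (fun t : ℝ => (x + t * y) ^ (n+1)) _ 0 := h1.pow (n+1)
    have := h2.hasDerivWithinAt (s := Set.Ici 0)
    simpa using this
  have := deriv_le (g := fun t : ℝ => (1 + t * r) ^ n * ∑ j ∈ S, AA K (q j)) (by fun_prop) hder ?_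
  · simpa using this
  · intro t ht
    have e0 : (x + 0 * y) ^ (n+1) = volume.real K := by rw [zero_mul, add_zero, xN]
    change (x + t * y) ^ (n+1) ≤ (x + 0 * y) ^ (n+1) + _
    rw [e0]
    refine le_trans ?_ (h t ht.le)
    have cc := hK.add ((ZS_compact S q).smul t)
    have hb := bm (n := n+1) (by omega) hK ((ZS_compact S q).smul t) cc ⟨0, interior_subset h0⟩ ⟨0, 0, ZS_zero S q, by simp⟩
      (fun a ha b hb => Set.add_mem_add ha hb)
    rw [vol_smul t ht.le, Real.mul_rpow (by positivity) measureReal_nonneg, one_div, Real.pow_rpow_inv_natCast ht.le (by omega), ← one_div] at hb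
    calc (x + t * y) ^ (n+1) ≤ (volume.real (K + t • ZS S q) ^ (1/((n+1:ℕ):ℝ))) ^ (n+1) := pow_le_pow_left₀ (by positivity) hb _
      _ = _ := pw _ measureReal_nonneg

lemma zon_cap (hK : IsCompact K) (hKc : Convex ℝ K) (S : Finset κ) (q : κ → Eu (n+1)) {r : ℝ} (hr : 0 < r)
    (h : ZS S q ⊆ r • K) : ∑ j ∈ S, AA K (q j) ≤ ((n+1:ℕ):ℝ) * r * volume.real K := by
  have hder : HasDerivWithinAt (fun t : ℝ => (1 + t * r) ^ (n+1) * volume.real K) (((n+1:ℕ):ℝ) * r * volume.real K) (Set.Ici 0) 0 := by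
    have h1 : HasDerivAt (fun t : ℝ => 1 + t * r) (1 * r) 0 := ((hasDerivAt_id (0:ℝ)).mul_const r).const_add 1
    have := ((h1.pow (n+1)).mul_const (volume.real K)).hasDerivWithinAt (s := Set.Ici 0)
    simpa using this
  refine deriv_ge hder fun t ht => ?_
  change (1 + 0 * r) ^ (n+1) * volume.real K + _ ≤ (1 + t * r) ^ (n+1) * volume.real K
  rw [zero_mul, add_zero, one_pow, one_mul]
  refine (zon_lower hK hKc S q ht.le).trans ?_
  rw [← vol_smul _ (by positivity)]
  exact vol_mono (hK.smul _) (absorb_add hr ht.le hKc h)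

lemma cau_symm {n : ℕ} {κ κ' : Type} [Fintype κ] [Fintype κ'] {A B : Set (Eu n)} {a : κ → Eu n} {b : κ' → Eu n} (ha : Cau A a) (hb : Cau B b) :
    ∑ j, AA A (b j) = ∑ i, AA B (a i) := by
  simp only [ha _, hb _]
  rw [Finset.sum_comm]
  simp only [real_inner_comm]

/-- normalized volume of the projection body -/
noncomputable def FF (K : Set (Eu (n+2))) : ℝ := volume.real (Wu K) ^ (1 / (((n+2:ℕ):ℝ) * ((n+1:ℕ):ℝ)))

lemma FF_nonneg (K : Set (Eu (n+2))) : 0 ≤ FF K := Real.rpow_nonneg measureReal_nonneg _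

lemma FF_eq (K : Set (Eu (n+2))) : FF K = (volume.real (Wu K) ^ (1/((n+2:ℕ):ℝ))) ^ (1/((n+1:ℕ):ℝ)) := by
  rw [FF, ← Real.rpow_mul measureReal_nonneg, one_div_mul_one_div]

lemma FF_dil {K : Set (Eu (n+2))} (hK : IsCompact K) (hKc : Convex ℝ K) {c : ℝ} (hc : 0 < c) : FF (c • K) = c * FF K := by
  rw [FF_eq, FF_eq, Wu_dil hK hKc hc, vol_smul _ (by positivity), Real.mul_rpow (by positivity) measureReal_nonneg, one_div ((n+2:ℕ):ℝ),
    Real.pow_rpow_inv_natCast (by positivity) (by omega), Real.mul_rpow (by positivity) (by positivity), one_div ((n+1:ℕ):ℝ),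
    Real.pow_rpow_inv_natCast hc.le (by omega)]

lemma FF_mono {K K' : Set (Eu (n+2))} (hK : IsCompact K) (hKc : Convex ℝ K) (hK' : IsCompact K') (hKc' : Convex ℝ K') (h : K ⊆ K') : FF K ≤ FF K' :=
  Real.rpow_le_rpow measureReal_nonneg (vol_mono (Wu_compact hK' hKc') (Wu_mono hK hKc hK' hKc' h)) (by positivity)

lemma vol_pos {n : ℕ} {K : Set (Eu n)} (hK : IsCompact K) (h0 : (0 : Eu n) ∈ interior K) : 0 < volume.real K :=
  ENNReal.toReal_pos (Measure.measure_pos_of_nonempty_interior _ ⟨0, h0⟩).ne' hK.measure_lt_top.ne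

lemma FF_pos {K : Set (Eu (n+2))} (hK : IsCompact K) (hKc : Convex ℝ K) (h0 : (0 : Eu (n+2)) ∈ interior K) : 0 < FF K :=
  Real.rpow_pos_of_pos (vol_pos (Wu_compact hK hKc) (Wu_int hK hKc h0)) _

lemma zero_int_smul {n : ℕ} {K : Set (Eu n)} (h0 : (0 : Eu n) ∈ interior K) {c : ℝ} (hc : 0 < c) : (0 : Eu n) ∈ interior (c • K) := by
  rw [interior_smul₀ hc.ne']
  exact ⟨0, h0, by simp⟩

lemma super_aux {K L : Set (Eu (n+2))} (hK : IsCompact K) (hKc : Convex ℝ K) (hK0 : (0 : Eu (n+2)) ∈ interior K)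
    (hL : IsCompact L) (hLc : Convex ℝ L) (hL0 : (0 : Eu (n+2)) ∈ interior L) {θ : ℝ} (hθ : 0 < θ) (hθ1 : θ < 1) :
    θ * (FF K + FF L) ≤ (θ⁻¹) ^ (1/((n+1:ℕ):ℝ)) * (θ⁻¹ * FF (K + L)) := by
  classical
  have hi : 0 < θ⁻¹ := by positivity
  obtain ⟨K', VK, K1, K2, K3, K4, κK, _, _, a, ha⟩ := approx hK hKc hK0 hθ hθ1
  obtain ⟨L', VL, L1, L2, L3, L4, κL, _, _, b, hb⟩ := approx hL hLc hL0 hθ hθ1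
  have cS := hK.add hL
  have vS := hKc.add hLc
  have S0 : (0 : Eu (n+2)) ∈ interior (K + L) := by
    refine interior_mono ?_ hK0
    intro x hx
    exact ⟨x, hx, 0, interior_subset hL0, by simp⟩
  have cT := cS.smul θ⁻¹
  have vT := vS.smul θ⁻¹
  obtain ⟨N', VN, N1, N2, N3, N4, κN, _, _, c, hc⟩ := approx cT vT (zero_int_smul S0 hi) hθ hθ1
  rw [smul_smul, mul_inv_cancel₀ hθ.ne', one_smul] at N1
  have cK' : IsCompact K' := K3 ▸ Set.Finite.isCompact_convexHull ℝ VK.finite_toSet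
  have vK' : Convex ℝ K' := K3 ▸ convex_convexHull ℝ _
  have cL' : IsCompact L' := L3 ▸ Set.Finite.isCompact_convexHull ℝ VL.finite_toSet
  have vL' : Convex ℝ L' := L3 ▸ convex_convexHull ℝ _
  have cN' : IsCompact N' := N3 ▸ Set.Finite.isCompact_convexHull ℝ VN.finite_toSet
  have vN' : Convex ℝ N' := N3 ▸ convex_convexHull ℝ _
  have cQ := Wu_compact cN' vN'
  obtain ⟨Q', VQ, Q1, Q2, Q3, Q4, κQ, _, _, q, hq⟩ := approx cQ (Wu_convex N') (Wu_int cN' vN' N4) hθ hθ1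
  have cQ' : IsCompact Q' := Q3 ▸ Set.Finite.isCompact_convexHull ℝ VQ.finite_toSet
  have vQ' : Convex ℝ Q' := Q3 ▸ convex_convexHull ℝ _
  have hZ0 : (0 : Eu (n+2)) ∈ interior (ZS Finset.univ q) := by
    rw [← Wu_zon hq]; exact Wu_int cQ' vQ' Q4
  have haf := af_zon Finset.univ q VK VL K' L' K3 L3 K4 L4 hZ0
  have hKL : K' + L' ⊆ N' := (Set.add_subset_add K2 L2).trans N1
  have hmono : ∑ j, AA (K' + L') (q j) ≤ ∑ j, AA N' (q j) :=
    Finset.sum_le_sum fun j _ => AA_mono (cK'.add cL') (vK'.add vL') cN' vN' hKL _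
  set m := 1/((n+1:ℕ):ℝ) with hm
  have m0 : 0 < m := by rw [hm]; positivity
  set x := volume.real Q' ^ (1/((n+2:ℕ):ℝ)) with hx
  have x0 : 0 < x := Real.rpow_pos_of_pos (vol_pos cQ' Q4) _
  have xN : x ^ (n+2) = volume.real Q' := by
    rw [hx, one_div, Real.rpow_inv_natCast_pow measureReal_nonneg (by omega)]
  have iK := zon_mink cQ' vQ' Q4 Finset.univ a
  have iL := zon_mink cQ' vQ' Q4 Finset.univ b
  have iN := zon_cap cQ' vQ' Finset.univ c hi (by
    rw [← Wu_zon hc]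
    have := Set.smul_set_mono (a := θ⁻¹) Q1
    rwa [smul_smul, inv_mul_cancel₀ hθ.ne', one_smul] at this)
  rw [← Wu_zon ha, cau_symm hq ha] at iK
  rw [← Wu_zon hb, cau_symm hq hb] at iL
  rw [cau_symm hq hc] at iN
  change ((n+2:ℕ):ℝ) * x ^ (n+1) * volume.real (Wu K') ^ (1/((n+2:ℕ):ℝ)) ≤ _ at iK
  change ((n+2:ℕ):ℝ) * x ^ (n+1) * volume.real (Wu L') ^ (1/((n+2:ℕ):ℝ)) ≤ _ at iL
  change _ ≤ ((n+2:ℕ):ℝ) * θ⁻¹ * volume.real Q' at iN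
  set C := ((n+2:ℕ):ℝ) * x ^ (n+1) with hC
  have C0 : 0 < C := by positivity
  have iN' : ∑ j, AA N' (q j) ≤ C * (θ⁻¹ * x) := by
    refine iN.trans (le_of_eq ?_)
    rw [← xN, hC]; ring
  have jK : C ^ m * FF K' ≤ (∑ j, AA K' (q j)) ^ m := by
    rw [FF_eq, ← hm, ← Real.mul_rpow C0.le (by positivity)]
    exact Real.rpow_le_rpow (by positivity) iK m0.le
  have jL : C ^ m * FF L' ≤ (∑ j, AA L' (q j)) ^ m := by
    rw [FF_eq, ← hm, ← Real.mul_rpow C0.le (by positivity)]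
    exact Real.rpow_le_rpow (by positivity) iL m0.le
  have jN : (∑ j, AA (K' + L') (q j)) ^ m ≤ C ^ m * (θ⁻¹ * x) ^ m := by
    rw [← Real.mul_rpow C0.le (by positivity)]
    exact Real.rpow_le_rpow (Finset.sum_nonneg fun j _ => AA_nonneg (cK'.add cL') (vK'.add vL') _) (hmono.trans iN') m0.le
  have Cm : 0 < C ^ m := Real.rpow_pos_of_pos C0 m
  have main : FF K' + FF L' ≤ (θ⁻¹ * x) ^ m := by
    refine le_of_mul_le_mul_left ?_ Cm
    linarith
  have xN' : x ^ m ≤ FF N' := by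
    rw [FF_eq, ← hm]
    refine Real.rpow_le_rpow x0.le (Real.rpow_le_rpow measureReal_nonneg (vol_mono cQ Q2) (by positivity)) m0.le
  have e1 : θ * FF K ≤ FF K' := by
    rw [← FF_dil hK hKc hθ]; exact FF_mono (hK.smul θ) (hKc.smul θ) cK' vK' K1
  have e2 : θ * FF L ≤ FF L' := by
    rw [← FF_dil hL hLc hθ]; exact FF_mono (hL.smul θ) (hLc.smul θ) cL' vL' L1
  have e3 : FF N' ≤ θ⁻¹ * FF (K + L) := by
    rw [← FF_dil cS vS hi]; exact FF_mono cN' vN' cT vT N2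
  rw [Real.mul_rpow hi.le x0.le] at main
  have := mul_le_mul_of_nonneg_left (xN'.trans e3) (Real.rpow_nonneg hi.le m)
  linarith

theorem superadd {K L : Set (Eu (n+2))} (hK : IsCompact K) (hKc : Convex ℝ K) (hK0 : (0 : Eu (n+2)) ∈ interior K)
    (hL : IsCompact L) (hLc : Convex ℝ L) (hL0 : (0 : Eu (n+2)) ∈ interior L) : FF K + FF L ≤ FF (K + L) := by
  have h1 : Filter.Tendsto (fun θ : ℝ => θ * (FF K + FF L)) (nhdsWithin 1 (Set.Iio 1)) (nhds (1 * (FF K + FF L))) :=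
    ((continuous_id.mul continuous_const).tendsto (1:ℝ)).mono_left nhdsWithin_le_nhds
  have h2 : Filter.Tendsto (fun θ : ℝ => (θ⁻¹) ^ (1/((n+1:ℕ):ℝ)) * (θ⁻¹ * FF (K + L))) (nhdsWithin 1 (Set.Iio 1))
      (nhds (((1:ℝ)⁻¹) ^ (1/((n+1:ℕ):ℝ)) * ((1:ℝ)⁻¹ * FF (K + L)))) := by
    have hc : ContinuousAt (fun θ : ℝ => θ⁻¹) 1 := continuousAt_inv₀ one_ne_zero
    have h3 : ContinuousAt (fun θ : ℝ => (θ⁻¹) ^ (1/((n+1:ℕ):ℝ)) * (θ⁻¹ * FF (K + L))) 1 :=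
      (hc.rpow_const (Or.inl (by norm_num))).mul (hc.mul_const _)
    exact h3.tendsto.mono_left nhdsWithin_le_nhds
  have := le_of_tendsto_of_tendsto h1 h2 (by
    filter_upwards [Ioo_mem_nhdsLT (show (0:ℝ) < 1 by norm_num)] with θ hθ
    exact super_aux hK hKc hK0 hL hLc hL0 hθ.1 hθ.2)
  simpa using this
end
end PB

open scoped Pointwise RealInnerProductSpace
open scoped MeasureTheory
open MeasureTheory
namespace PB
set_option linter.unusedSectionVars false
set_option linter.unusedVariables false

section
variable {n : ℕ} {A B : Set (Eu n)}

lemma supp_ge (hA : IsCompact A) {x : Eu n} (hx : x ∈ A) (u : Eu n) : ⟪x, u⟫ ≤ supp A u :=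
  le_csSup (hA.image (f := fun x : Eu n => ⟪x, u⟫) (by fun_prop)).bddAbove ⟨x, hx, rfl⟩

lemma supp_att (hA : IsCompact A) (h0 : A.Nonempty) (u : Eu n) : ∃ x ∈ A, ⟪x, u⟫ = supp A u := by
  have := (hA.image (f := fun x : Eu n => ⟪x, u⟫) (by fun_prop)).sSup_mem (h0.image _)
  exact this

lemma supp_eq (hA : IsCompact A) {u : Eu n} {r : ℝ} (h1 : ∀ x ∈ A, ⟪x, u⟫ ≤ r) (h2 : ∃ x ∈ A, ⟪x, u⟫ = r) : supp A u = r := by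
  obtain ⟨x, hx, hr⟩ := h2
  obtain ⟨y, hy, hy2⟩ := supp_att hA ⟨x, hx⟩ u
  refine le_antisymm (hy2 ▸ h1 y hy) (hr ▸ supp_ge hA hx u)

lemma mem_of_supp (hA : IsCompact A) (hAc : Convex ℝ A) (h0 : A.Nonempty) {x : Eu n} (h : ∀ u : Eu n, ‖u‖ = 1 → ⟪x, u⟫ ≤ supp A u) : x ∈ A := by
  by_contra hcon
  obtain ⟨c, r, h1, h2⟩ := sep hA.isClosed hAc hcon
  have hc : c ≠ 0 := by
    rintro rfl
    obtain ⟨s, hs⟩ := h0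
    have := h1 s hs
    simp at this h2
    linarith
  have hn : 0 < ‖c‖ := norm_pos_iff.2 hc
  obtain ⟨s, hs, hs2⟩ := supp_att hA h0 (‖c‖⁻¹ • c)
  have h3 := h (‖c‖⁻¹ • c) (by rw [norm_smul, norm_inv, norm_norm, inv_mul_cancel₀ hn.ne'])
  rw [← hs2, inner_smul_right, inner_smul_right] at h3
  have h4 := le_of_mul_le_mul_left h3 (inv_pos.2 hn)
  have := h1 s hs
  rw [real_inner_comm] at this h2
  linarith

lemma subset_of_supp (hA : IsCompact A) (hB : IsCompact B) (hBc : Convex ℝ B) (h0 : B.Nonempty)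
    (h : ∀ u : Eu n, ‖u‖ = 1 → supp A u ≤ supp B u) : A ⊆ B :=
  fun x hx => mem_of_supp hB hBc h0 fun u hu => (supp_ge hA hx u).trans (h u hu)

lemma eq_of_supp (hA : IsCompact A) (hAc : Convex ℝ A) (hA0 : A.Nonempty) (hB : IsCompact B) (hBc : Convex ℝ B) (h0 : B.Nonempty)
    (h : ∀ u : Eu n, ‖u‖ = 1 → supp A u = supp B u) : A = B :=
  Set.Subset.antisymm (subset_of_supp hA hB hBc h0 fun u hu => (h u hu).le) (subset_of_supp hB hA hAc hA0 fun u hu => (h u hu).ge)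

lemma supp_smul (hA : IsCompact A) (h0 : A.Nonempty) {c : ℝ} (hc : 0 ≤ c) (u : Eu n) : supp (c • A) u = c * supp A u := by
  refine supp_eq (hA.smul c) ?_ ?_
  · rintro _ ⟨x, hx, rfl⟩
    simp only [real_inner_smul_left]
    exact mul_le_mul_of_nonneg_left (supp_ge hA hx u) hc
  · obtain ⟨x, hx, h⟩ := supp_att hA h0 u
    exact ⟨c • x, Set.smul_mem_smul_set hx, by rw [real_inner_smul_left, h]⟩

lemma supp_add (hA : IsCompact A) (h0 : A.Nonempty) (hB : IsCompact B) (hB0 : B.Nonempty) (u : Eu n) : supp (A + B) u = supp A u + supp B u := by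
  refine supp_eq (hA.add hB) ?_ ?_
  · rintro _ ⟨x, hx, y, hy, rfl⟩
    simp only [inner_add_left]
    exact add_le_add (supp_ge hA hx u) (supp_ge hB hy u)
  · obtain ⟨x, hx, h⟩ := supp_att hA h0 u
    obtain ⟨y, hy, h'⟩ := supp_att hB hB0 u
    exact ⟨x + y, Set.add_mem_add hx hy, by rw [inner_add_left, h, h']⟩

lemma supp_pos (hA : IsCompact A) (h0 : (0 : Eu n) ∈ interior A) {u : Eu n} (hu : ‖u‖ = 1) : 0 < supp A u := by
  obtain ⟨δ, hδ, h2⟩ := Metric.isOpen_iff.1 isOpen_interior 0 h0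
  have : (δ/2) • u ∈ A := by
    refine interior_subset (h2 ?_)
    rw [mem_ball_zero_iff, norm_smul, hu, Real.norm_of_nonneg (by positivity)]; linarith
  have := supp_ge hA this u
  rw [real_inner_smul_left, real_inner_self_eq_norm_sq, hu] at this
  linarith

/-- nested convex bodies of the same volume agree -/
lemma nested (hA : IsCompact A) (hB : IsCompact B) (hBc : Convex ℝ B) (h0 : (interior B).Nonempty) (h : A ⊆ B)
    (hv : volume.real A = volume.real B) : A = B := by
  refine Set.Subset.antisymm h ?_
  have hz : volume (interior B \ A) = 0 := by
    have h1 : volume (B \ A) = 0 := by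
      rw [measure_sdiff h hA.measurableSet.nullMeasurableSet hA.measure_lt_top.ne]
      have : volume A = volume B := (ENNReal.toReal_eq_toReal_iff' hA.measure_lt_top.ne hB.measure_lt_top.ne).1 hv
      rw [this, tsub_self]
    exact measure_mono_null (Set.sdiff_subset_sdiff_left interior_subset) h1
  have he : interior B \ A = ∅ := (isOpen_interior.sdiff hA.isClosed).measure_eq_zero_iff volume |>.1 hz
  have hs : interior B ⊆ A := Set.sdiff_eq_empty.1 he
  have := hBc.closure_interior_eq_closure_of_nonempty_interior h0
  rw [hB.isClosed.closure_eq] at this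
  rw [← this]
  exact closure_minimal hs hA.isClosed

end

section
variable {n : ℕ}

lemma haus (n : ℕ) : ∃ κ : ℝ, 0 < κ ∧ ∀ (K : Set (Eu (n+1))), IsCompact K → Convex ℝ K → ∀ u : Eu (n+1), ‖u‖ = 1 →
    (μH[((n+1:ℕ):ℝ) - 1] (projPerp u K)).toReal = κ * AA K u := by
  have hvol := Measure.isAddLeftInvariant_eq_smul (volume : Measure (Eu n)) μH[(n:ℝ)]
  have hne := Measure.addHaarScalarFactor_volume_hausdorffMeasure_ne_zero n
  set σ := Measure.addHaarScalarFactor (volume : Measure (Eu n)) μH[(n:ℝ)] with hσ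
  have σ0 : 0 < (σ:ℝ) := lt_of_le_of_ne σ.2 (fun h => hne (NNReal.coe_eq_zero.1 h.symm))
  refine ⟨(σ:ℝ)⁻¹, by positivity, fun K hK hKc u hu => ?_⟩
  obtain ⟨J, h1, h2, h3⟩ := frame u hu
  have hA := AA_formula hu h1 h2 h3 hK hKc zero_le_one
  rw [one_smul, one_mul] at hA
  have hset : projPerp u K = J '' pr u J K := by
    ext z
    constructor
    · rintro ⟨x, hx, rfl⟩
      obtain ⟨y, hy⟩ := h2 x
      refine ⟨y, ⟨⟪x, u⟫, by rw [← hy]; exact hx⟩, ?_⟩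
      exact eq_sub_of_add_eq' hy.symm
    · rintro ⟨y, ⟨s, hs⟩, rfl⟩
      refine ⟨_, hs, ?_⟩
      change s • u + J y - ⟪s • u + J y, u⟫ • u = J y
      rw [inner_add_left, real_inner_smul_left, h1, real_inner_self_eq_norm_sq, hu]
      simp
  have hdim : ((n+1:ℕ):ℝ) - 1 = n := by push_cast; ring
  rw [hset, hdim, J.isometry.hausdorffMeasure_image (Or.inl (by positivity)), hA, Measure.real, hvol]
  rw [Measure.smul_apply, ENNReal.smul_def, smul_eq_mul, ENNReal.toReal_mul, ENNReal.coe_toReal, inv_mul_cancel_left₀ σ0.ne']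

lemma PK_eq {K P : Set (Eu (n+1))} (hK : IsCompact K) (hKc : Convex ℝ K) (hP : IsCompact P) (hPc : Convex ℝ P) (hP0 : P.Nonempty)
    {κ : ℝ} (hκ : 0 < κ) (h : ∀ u : Eu (n+1), ‖u‖ = 1 → supp P u = κ * AA K u) : P = κ • Wu K := by
  ext x
  rw [Set.mem_smul_set_iff_inv_smul_mem₀ hκ.ne']
  constructor
  · intro hx w
    obtain ⟨e, J, hw, he, -⟩ := framed w
    rw [hw, AA_smul hK hKc _ (norm_nonneg _), inner_smul_right, real_inner_smul_left]
    refine mul_le_mul_of_nonneg_left ?_ (norm_nonneg _)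
    rw [inv_mul_le_iff₀ hκ, ← h e he]
    exact supp_ge hP hx e
  · intro hx
    refine mem_of_supp hP hPc hP0 fun u hu => ?_
    have := hx u
    rwa [real_inner_smul_left, inv_mul_le_iff₀ hκ, ← h u hu] at this

lemma eq_of_Wu {N M : Set (Eu (n+2))} (hN : IsCompact N) (hNc : Convex ℝ N) (hM : IsCompact M) (hMc : Convex ℝ M) (h0 : (0 : Eu (n+2)) ∈ interior M)
    (h : N ⊆ M) (hN0 : N.Nonempty) (hW : Wu N = Wu M) (hatt : ∀ u : Eu (n+2), ‖u‖ = 1 → ∃ x ∈ Wu M, ⟪x, u⟫ = AA M u) : N = M := by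
  refine Set.Subset.antisymm h fun x hx => ?_
  by_contra hcon
  obtain ⟨c, r, c1, c2⟩ := sep hN.isClosed hNc hcon
  obtain ⟨e, J0, hc, he, i1, -⟩ := framed c
  obtain ⟨z, hz⟩ := exists_norm_eq (Eu (n+1)) zero_le_one
  set u := J0 z with hu
  have u1 : ‖u‖ = 1 := by rw [hu, J0.norm_map, hz]
  have cu : ⟪c, u⟫ = 0 := by rw [hc, real_inner_smul_left, real_inner_comm, i1, mul_zero]
  obtain ⟨J, h1, h2, h3⟩ := frame u u1
  have AM := AA_formula u1 h1 h2 h3 hM hMc zero_le_one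
  have AN := AA_formula u1 h1 h2 h3 hN hNc zero_le_one
  rw [one_smul, one_mul] at AM AN
  have hAA : AA N u = AA M u := by
    refine le_antisymm (AA_mono hN hNc hM hMc h u) ?_
    obtain ⟨y, hy, hy2⟩ := hatt u u1
    rw [← hW] at hy
    rw [← hy2]; exact hy u
  have hpr : pr u J N = pr u J M := by
    have p1 : pr u J M = _ := pr_eq u1 h1 h2
    have p2 : pr u J N = _ := pr_eq u1 h1 h2
    refine nested ?_ ?_ ?_ ?_ (pr_mono h) (by rw [← AM, ← AN, hAA])
    · rw [p2]; exact hN.image (ContinuousLinearMap.continuous _)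
    · rw [p1]; exact hM.image (ContinuousLinearMap.continuous _)
    · rw [p1]; exact hMc.linear_image (ContinuousLinearMap.adjoint J.toContinuousLinearMap).toLinearMap
    · refine ⟨0, mem_interior.2 ⟨J ⁻¹' interior M, fun y hy => ⟨0, ?_⟩, isOpen_interior.preimage J.continuous, ?_⟩⟩
      · rw [zero_smul, zero_add]; exact interior_subset hy
      · change J 0 ∈ interior M
        rw [map_zero]; exact h0
  obtain ⟨y, hy⟩ := h2 x
  have hyM : y ∈ pr u J M := ⟨⟪x, u⟫, by rw [← hy]; exact hx⟩
  rw [← hpr] at hyM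
  obtain ⟨s, hs⟩ := hyM
  have e1 := c1 _ hs
  rw [hy] at c2
  rw [inner_add_right, inner_smul_right, cu] at e1 c2
  linarith

end
end PB

open scoped Pointwise RealInnerProductSpace
open scoped MeasureTheory
open MeasureTheory
namespace PB
set_option linter.unusedSectionVars false
set_option linter.unusedVariables false

/-- two-term strict convexity of the power function -/
lemma pow_conv {p : ℝ} (hp : 1 < p) {a b X Y : ℝ} (ha : 0 < a) (hb : 0 < b) (hab : a + b = 1) (hX : 0 < X) (hY : 0 < Y) :
    (a * X + b * Y) ^ p ≤ a * X ^ p + b * Y ^ p ∧ ((a * X + b * Y) ^ p = a * X ^ p + b * Y ^ p → X = Y) := by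
  have hs := strictConvexOn_rpow hp
  constructor
  · have := hs.convexOn.2 (x := X) hX.le (y := Y) hY.le ha.le hb.le hab
    simpa using this
  · intro h
    by_contra hne
    have := hs.2 (x := X) hX.le (y := Y) hY.le hne ha hb hab
    simp only [smul_eq_mul] at this
    linarith

theorem top {n : ℕ} {p : ℝ} (hp : 1 < p) {K L M : Set (Eu (n+2))} (hK : IsConvexBodyO K) (hL : IsConvexBodyO L) (hM : IsConvexBodyO M)
    (hMs : ∀ u : Eu (n+2), ‖u‖ = 1 → supp M u ^ p = supp K u ^ p + supp L u ^ p)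
    (hatt : ∀ u : Eu (n+2), ‖u‖ = 1 → ∃ x ∈ Wu M, ⟪x, u⟫ = AA M u) :
    FF K ^ p + FF L ^ p ≤ FF M ^ p ∧ (FF M ^ p = FF K ^ p + FF L ^ p ↔ ∃ c : ℝ, 0 < c ∧ K = c • L) := by
  obtain ⟨cK, vK, K0⟩ := hK
  obtain ⟨cL, vL, L0⟩ := hL
  obtain ⟨cM, vM, M0⟩ := hM
  have nK : K.Nonempty := ⟨0, interior_subset K0⟩
  have nL : L.Nonempty := ⟨0, interior_subset L0⟩
  have nM : M.Nonempty := ⟨0, interior_subset M0⟩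
  have p0 : 0 < p := by linarith
  set f := FF K with hf
  set g := FF L with hg
  have f0 : 0 < f := FF_pos cK vK K0
  have g0 : 0 < g := FF_pos cL vL L0
  have fp : 0 < f ^ p := Real.rpow_pos_of_pos f0 p
  have gp : 0 < g ^ p := Real.rpow_pos_of_pos g0 p
  set s := f ^ p + g ^ p with hs
  have s0 : 0 < s := by positivity
  set S := s ^ (1/p) with hS
  have S0 : 0 < S := Real.rpow_pos_of_pos s0 _
  have Sp : S ^ p = s := by rw [hS, one_div, Real.rpow_inv_rpow s0.le p0.ne']
  set a := f ^ p / s with ha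
  set b := g ^ p / s with hb
  have a0 : 0 < a := by positivity
  have b0 : 0 < b := by positivity
  have hab : a + b = 1 := by rw [ha, hb, ← add_div, div_self s0.ne']
  have c1 : 0 < S * a / f := by positivity
  have c2 : 0 < S * b / g := by positivity
  set N := (S * a / f) • K + (S * b / g) • L with hN
  have cN : IsCompact N := (cK.smul _).add (cL.smul _)
  have vN : Convex ℝ N := (vK.smul _).add (vL.smul _)
  have nN : N.Nonempty := (nK.smul_set).add (nL.smul_set)
  have FN : S ≤ FF N := by
    have := superadd (cK.smul (S * a / f)) (vK.smul _) (zero_int_smul K0 c1) (cL.smul (S * b / g)) (vL.smul _) (zero_int_smul L0 c2)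
    rw [FF_dil cK vK c1, FF_dil cL vL c2, ← hf, ← hg, div_mul_cancel₀ _ f0.ne', div_mul_cancel₀ _ g0.ne', ← mul_add, hab, mul_one] at this
    exact this
  have key : ∀ u : Eu (n+2), ‖u‖ = 1 → supp N u = S * (a * (supp K u / f) + b * (supp L u / g)) ∧
      supp M u ^ p = s * (a * (supp K u / f) ^ p + b * (supp L u / g) ^ p) ∧ 0 < supp K u / f ∧ 0 < supp L u / g ∧ 0 < supp M u := by
    intro u hu
    have k0 := supp_pos cK K0 hu
    have l0 := supp_pos cL L0 hu
    refine ⟨?_, ?_, by positivity, by positivity, supp_pos cM M0 hu⟩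
    · rw [hN, supp_add (cK.smul _) nK.smul_set (cL.smul _) nL.smul_set, supp_smul cK nK c1.le, supp_smul cL nL c2.le]
      field_simp
    · rw [hMs u hu, Real.div_rpow k0.le f0.le, Real.div_rpow l0.le g0.le, ha, hb]
      field_simp
  have hNM : N ⊆ M := by
    refine subset_of_supp cN cM vM nM fun u hu => ?_
    obtain ⟨e1, e2, x0, y0, m0⟩ := key u hu
    refine (Real.rpow_le_rpow_iff (by rw [e1]; positivity) m0.le p0).1 ?_
    rw [e1, e2, Real.mul_rpow S0.le (by positivity), Sp]
    exact mul_le_mul_of_nonneg_left (pow_conv hp a0 b0 hab x0 y0).1 s0.le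
  have FM : FF N ≤ FF M := FF_mono cN vN cM vM hNM
  refine ⟨?_, ?_, ?_⟩
  · rw [← Sp]
    exact Real.rpow_le_rpow S0.le (FN.trans FM) p0.le
  · intro h
    have hSM : FF M = S := by
      rw [← Sp] at h
      exact (Real.rpow_left_inj (FF_nonneg M) S0.le p0.ne').1 h
    have hNMF : FF N = FF M := le_antisymm FM (hSM ▸ FN)
    have hvol : volume.real (Wu N) = volume.real (Wu M) :=
      (Real.rpow_left_inj measureReal_nonneg measureReal_nonneg (by positivity)).1 hNMF
    have hW : Wu N = Wu M := nested (Wu_compact cN vN) (Wu_compact cM vM) (Wu_convex M) ⟨0, Wu_int cM vM M0⟩ (Wu_mono cN vN cM vM hNM) hvol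
    have hE : N = M := eq_of_Wu cN vN cM vM M0 hNM nN hW hatt
    refine ⟨f / g, by positivity, ?_⟩
    refine eq_of_supp cK vK nK (cL.smul _) (vL.smul _) nL.smul_set fun u hu => ?_
    obtain ⟨e1, e2, x0, y0, m0⟩ := key u hu
    rw [← hE, e1, Real.mul_rpow S0.le (by positivity), Sp] at e2
    have := (pow_conv hp a0 b0 hab x0 y0).2 (mul_left_cancel₀ s0.ne' e2)
    rw [supp_smul cL nL (by positivity)]
    field_simp at this ⊢
    linarith
  · rintro ⟨c, hc, hKL⟩
    have cp : 0 < 1 + c ^ p := by have := Real.rpow_pos_of_pos hc p; positivity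
    set d := (1 + c ^ p) ^ (1/p) with hd
    have d0 : 0 < d := Real.rpow_pos_of_pos cp _
    have dp : d ^ p = 1 + c ^ p := by rw [hd, one_div, Real.rpow_inv_rpow cp.le p0.ne']
    have hE : M = d • L := by
      refine eq_of_supp cM vM nM (cL.smul _) (vL.smul _) nL.smul_set fun u hu => ?_
      have l0 := supp_pos cL L0 hu
      refine (Real.rpow_left_inj (supp_pos cM M0 hu).le ?_ p0.ne').1 ?_
      · rw [supp_smul cL nL d0.le]; positivity
      · rw [hMs u hu, hKL, supp_smul cL nL hc.le, supp_smul cL nL d0.le, Real.mul_rpow hc.le l0.le, Real.mul_rpow d0.le l0.le, dp]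
        ring
    have hfc : f = c * g := by rw [hf, hKL, FF_dil cL vL hc]
    rw [hs, hE, FF_dil cL vL d0, ← hg, hfc, Real.mul_rpow hc.le g0.le, Real.mul_rpow d0.le g0.le, dp]
    ring

lemma vol_PK {n : ℕ} {p κ : ℝ} (hκ : 0 < κ) (K : Set (Eu (n+2))) :
    volume.real (κ • Wu K) ^ (p / (((n+2:ℕ):ℝ) * (((n+2:ℕ):ℝ) - 1))) = (κ ^ (n+2)) ^ (p / (((n+2:ℕ):ℝ) * (((n+2:ℕ):ℝ) - 1))) * FF K ^ p := by
  rw [vol_smul κ hκ.le, Real.mul_rpow (by positivity) measureReal_nonneg, FF, ← Real.rpow_mul measureReal_nonneg]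
  congr 2
  have : ((n+2:ℕ):ℝ) - 1 = ((n+1:ℕ):ℝ) := by push_cast; ring
  rw [this, one_div_mul_eq_div]

theorem final {n : ℕ} (p : ℝ) (hp : 1 < p)
    (K L M PK PL PM : Set (Eu (n+2)))
    (hK : IsConvexBodyO K) (hL : IsConvexBodyO L) (hM : IsConvexBodyO M)
    (hPK : IsConvexBody PK) (hPL : IsConvexBody PL) (hPM : IsConvexBody PM)
    (hMsupp : ∀ u : Eu (n+2), ‖u‖ = 1 → supp M u ^ p = supp K u ^ p + supp L u ^ p)
    (hPKsupp : ∀ u : Eu (n+2), ‖u‖ = 1 → supp PK u = (μH[((n+2:ℕ) : ℝ) - 1] (projPerp u K)).toReal)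
    (hPLsupp : ∀ u : Eu (n+2), ‖u‖ = 1 → supp PL u = (μH[((n+2:ℕ) : ℝ) - 1] (projPerp u L)).toReal)
    (hPMsupp : ∀ u : Eu (n+2), ‖u‖ = 1 → supp PM u = (μH[((n+2:ℕ) : ℝ) - 1] (projPerp u M)).toReal) :
    (volume PK).toReal ^ (p / (((n+2:ℕ):ℝ) * (((n+2:ℕ):ℝ) - 1))) + (volume PL).toReal ^ (p / (((n+2:ℕ):ℝ) * (((n+2:ℕ):ℝ) - 1))) ≤
        (volume PM).toReal ^ (p / (((n+2:ℕ):ℝ) * (((n+2:ℕ):ℝ) - 1))) ∧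
      ((volume PM).toReal ^ (p / (((n+2:ℕ):ℝ) * (((n+2:ℕ):ℝ) - 1))) =
          (volume PK).toReal ^ (p / (((n+2:ℕ):ℝ) * (((n+2:ℕ):ℝ) - 1))) +
            (volume PL).toReal ^ (p / (((n+2:ℕ):ℝ) * (((n+2:ℕ):ℝ) - 1))) ↔
        ∃ c : ℝ, 0 < c ∧ K = c • L) := by
  obtain ⟨κ, hκ, hh⟩ := haus (n+1)
  have aux : ∀ A P : Set (Eu (n+2)), IsConvexBodyO A → IsConvexBody P →
      (∀ u : Eu (n+2), ‖u‖ = 1 → supp P u = (μH[((n+2:ℕ) : ℝ) - 1] (projPerp u A)).toReal) → P = κ • Wu A ∧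
      ∀ u : Eu (n+2), ‖u‖ = 1 → ∃ x ∈ Wu A, ⟪x, u⟫ = AA A u := by
    intro A P hA hP hs
    have hs' : ∀ u : Eu (n+2), ‖u‖ = 1 → supp P u = κ * AA A u := fun u hu => (hs u hu).trans (hh A hA.1 hA.2.1 u hu)
    have nP : P.Nonempty := hP.2.2.mono interior_subset
    have e := PK_eq hA.1 hA.2.1 hP.1 hP.2.1 nP hκ hs'
    refine ⟨e, fun u hu => ?_⟩
    obtain ⟨x, hx, hx2⟩ := supp_att hP.1 nP u
    rw [e] at hx
    obtain ⟨y, hy, rfl⟩ := hx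
    refine ⟨y, hy, ?_⟩
    simp only [real_inner_smul_left] at hx2
    rw [hs' u hu] at hx2
    exact mul_left_cancel₀ hκ.ne' hx2
  have eK := (aux K PK hK hPK hPKsupp).1
  have eL := (aux L PL hL hPL hPLsupp).1
  obtain ⟨eM, hatt⟩ := aux M PM hM hPM hPMsupp
  obtain ⟨t1, t2⟩ := top hp hK hL hM hMsupp hatt
  change volume.real PK ^ _ + volume.real PL ^ _ ≤ volume.real PM ^ _ ∧ (volume.real PM ^ _ = volume.real PK ^ _ + volume.real PL ^ _ ↔ _)
  rw [eK, eL, eM, vol_PK hκ, vol_PK hκ, vol_PK hκ, ← mul_add]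
  have q0 : 0 < (κ ^ (n+2)) ^ (p / (((n+2:ℕ):ℝ) * (((n+2:ℕ):ℝ) - 1))) := Real.rpow_pos_of_pos (by positivity) _
  refine ⟨mul_le_mul_of_nonneg_left t1 q0.le, ?_⟩
  rw [← t2]
  exact ⟨fun h => mul_left_cancel₀ q0.ne' h, fun h => by rw [h]⟩
end PB

/-- Volume–projection-body case of Theorem 4.4: `j = n`,
`k = n - 1`. For `n ≥ 2`, `1 < p < ∞`, `K, L ∈ 𝒦ⁿₒ`, `M = K +_p L` (the convex body
with origin in its interior whose support function satisfies `h_M^p = h_K^p + h_L^p`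
on the unit sphere), and `PK, PL, PM` the projection bodies of `K, L, M` (the convex
bodies whose support functions are `u ↦ H^{n-1}(K|u^⊥)` etc. on the unit sphere),
`V_n(PM)^{p/(n(n-1))} ≥ V_n(PK)^{p/(n(n-1))} + V_n(PL)^{p/(n(n-1))}`, with equality if
and only if `K` and `L` are dilates. -/
theorem projection_body_lp_brunn_minkowski {n : ℕ} (hn : 2 ≤ n) (p : ℝ) (hp : 1 < p)
    (K L M PK PL PM : Set (EuclideanSpace ℝ (Fin n)))
    (hK : IsConvexBodyO K) (hL : IsConvexBodyO L) (hM : IsConvexBodyO M)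
    (hPK : IsConvexBody PK) (hPL : IsConvexBody PL) (hPM : IsConvexBody PM)
    (hMsupp : ∀ u : EuclideanSpace ℝ (Fin n), ‖u‖ = 1 →
      supp M u ^ p = supp K u ^ p + supp L u ^ p)
    (hPKsupp : ∀ u : EuclideanSpace ℝ (Fin n), ‖u‖ = 1 →
      supp PK u = (μH[(n : ℝ) - 1] (projPerp u K)).toReal)
    (hPLsupp : ∀ u : EuclideanSpace ℝ (Fin n), ‖u‖ = 1 →
      supp PL u = (μH[(n : ℝ) - 1] (projPerp u L)).toReal)
    (hPMsupp : ∀ u : EuclideanSpace ℝ (Fin n), ‖u‖ = 1 →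
      supp PM u = (μH[(n : ℝ) - 1] (projPerp u M)).toReal) :
    (volume PK).toReal ^ (p / (n * (n - 1))) + (volume PL).toReal ^ (p / (n * (n - 1))) ≤
        (volume PM).toReal ^ (p / (n * (n - 1))) ∧
      ((volume PM).toReal ^ (p / (n * (n - 1))) =
          (volume PK).toReal ^ (p / (n * (n - 1))) +
            (volume PL).toReal ^ (p / (n * (n - 1))) ↔
        ∃ c : ℝ, 0 < c ∧ K = c • L) := by
  obtain ⟨m, rfl⟩ : ∃ m, n = m + 2 := ⟨n - 2, by omega⟩
  exact PB.final p hp K L M PK PL PM hK hL hM hPK hPL hPM hMsupp hPKsupp hPLsupp hPMsupp
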